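/- Fix an integer k ≥ 1 and a real γ with 0 < γ ≤ 1/4, and for each X ≥ 3 take the Selberg weights (λ_d) associated with k and the choice √D = X^γ · exp(−√(log X)). Define H₂(X) = Σ_{n≥1} g(n/X) · (|S(1,1;n)|/√n) · μ²(n) · (k/2)^{ω(n)} · (Σ_{d|n} λ_d)². Then limsup_{X→∞} H₂(X) · (log X) / (g̃(1) · X) ≤ (k!)² · R_k(γ), where R_k(y) = Σ_{j=1}^{k} Σ_{i=0}^{j−1} C(k,j) · C(j−1,i) · C(2(k−j), k−j) · (Γ(j+i)/Γ(j)²) · ((−1)^i/(2k−j+i)!) · y^{−(j−i)}, with C(a,b) denoting binomial coefficients and Γ the Gamma function. -/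

import Mathlib

open MeasureTheory Filter

/-- The Kloosterman sum `S(m,n;c)` (a real number). -/
noncomputable def Kloosterman (m n : ℤ) (c : ℕ) : ℝ :=
  ∑ a ∈ (Finset.range c).filter (fun a => Nat.Coprime a c),
    (Complex.exp (2 * Real.pi * Complex.I *
      (((m * a + n * (((a : ZMod c)⁻¹).val : ℤ) : ℤ) : ℂ) / c))).re

/-- The Selberg sieve weight `λ_d = μ(d)(log(√D/d)/log √D)^k` for squarefree
`1 ≤ d ≤ √D`, and `λ_d = 0` otherwise; here `sD` stands for `√D`. -/
noncomputable def selbergWeight (k : ℕ) (sD : ℝ) (d : ℕ) : ℝ :=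
  if Squarefree d ∧ (d : ℝ) ≤ sD then
    ((ArithmeticFunction.moebius d : ℤ) : ℝ) * (Real.log (sD / d) / Real.log sD) ^ k
  else 0

/-- The polynomial `R_k(y)` appearing in the upper bound for `H₂(X)`. -/
noncomputable def Rpoly (k : ℕ) (y : ℝ) : ℝ :=
  ∑ j ∈ Finset.Icc 1 k, ∑ i ∈ Finset.range j,
    (k.choose j : ℝ) * ((j - 1).choose i : ℝ) * ((2 * (k - j)).choose (k - j) : ℝ) *
      (Real.Gamma ((j : ℝ) + i) / Real.Gamma (j : ℝ) ^ 2) *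
      ((-1 : ℝ) ^ i / (Nat.factorial (2 * k - j + i) : ℝ)) / y ^ (j - i)

section PartA1

open Polynomial

namespace Weil

set_option linter.unusedSectionVars false
set_option linter.unusedDecidableInType false
set_option linter.unusedFintypeInType false

variable {K : Type*} [Field K] [Fintype K] [DecidableEq K]

/-- The multiplicative function on monic polynomials attached to the Kloosterman sum. -/
noncomputable def Lam (ψ : AddChar K ℂ) (b : K) (h : K[X]) : ℂ :=
  if h.coeff 0 = 0 then 0 else ψ (-h.nextCoeff - b * (h.coeff 1 / h.coeff 0))

lemma Lam_one (ψ : AddChar K ℂ) (b : K) : Lam ψ b 1 = 1 := by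
  simp [Lam, nextCoeff, coeff_one]

lemma Lam_mul (ψ : AddChar K ℂ) (b : K) {f g : K[X]} (hf : f.Monic) (hg : g.Monic) :
    Lam ψ b (f * g) = Lam ψ b f * Lam ψ b g := by
  unfold Lam
  by_cases h1 : f.coeff 0 = 0
  · simp [h1, mul_coeff_zero]
  by_cases h2 : g.coeff 0 = 0
  · simp [h2, mul_coeff_zero]
  rw [if_neg h1, if_neg h2, if_neg (by simp [mul_coeff_zero, h1, h2]), ← AddChar.map_add_eq_mul,
    hf.nextCoeff_mul hg, mul_coeff_zero]
  congr 1
  have : (f * g).coeff 1 = f.coeff 0 * g.coeff 1 + f.coeff 1 * g.coeff 0 := by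
    rw [coeff_mul]
    simp [Finset.antidiagonal, Finset.Nat.antidiagonal_succ]
  rw [this]
  field_simp
  ring

lemma Lam_pow (ψ : AddChar K ℂ) (b : K) {f : K[X]} (hf : f.Monic) (n : ℕ) :
    Lam ψ b (f ^ n) = Lam ψ b f ^ n := by
  induction n with
  | zero => simp [Lam_one]
  | succ n ih => rw [pow_succ, Lam_mul ψ b (hf.pow n) hf, ih, pow_succ]

lemma finite_monic (n : ℕ) : {h : K[X] | h.Monic ∧ h.natDegree = n}.Finite := by
  have : Finite (degreeLT K n) := Finite.of_equiv _ (degreeLTEquiv K n).toEquiv.symm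
  have h2 : (Set.range (fun x : degreeLT K n => (x : K[X]) + X ^ n)).Finite := Set.finite_range _
  refine h2.subset ?_
  rintro h ⟨hm, hd⟩
  refine ⟨⟨h - X ^ n, ?_⟩, by simp⟩
  rw [mem_degreeLT]
  have hd' : h.degree = n := by rw [degree_eq_natDegree hm.ne_zero, hd]
  have := degree_sub_lt_left (p := h) (q := X ^ n) (by rw [hd', degree_X_pow]) hm.ne_zero
    (by rw [hm.leadingCoeff, (monic_X_pow n).leadingCoeff])
  rwa [hd'] at this

/-- monic polynomials of degree `n` -/
noncomputable def Mo (K : Type*) [Field K] [Fintype K] [DecidableEq K] (n : ℕ) : Finset K[X] :=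
  (finite_monic (K := K) n).toFinset

lemma mem_Mo {n : ℕ} {h : K[X]} : h ∈ Mo K n ↔ h.Monic ∧ h.natDegree = n := by
  simp [Mo]

open Classical in
/-- monic irreducible polynomials of degree `n` -/
noncomputable def Ir (K : Type*) [Field K] [Fintype K] [DecidableEq K] (n : ℕ) : Finset K[X] :=
  (Mo K n).filter Irreducible

lemma mem_Ir {n : ℕ} {h : K[X]} : h ∈ Ir K n ↔ h.Monic ∧ h.natDegree = n ∧ Irreducible h := by
  simp [Ir, mem_Mo, and_assoc]

/-- coefficients of the L-function -/
noncomputable def LA (ψ : AddChar K ℂ) (b : K) (n : ℕ) : ℂ := ∑ h ∈ Mo K n, Lam ψ b h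

/-- power sums via irreducible polynomials -/
noncomputable def LT (ψ : AddChar K ℂ) (b : K) (j : ℕ) : ℂ :=
  ∑ d ∈ j.divisors, ∑ P ∈ Ir K d, (d : ℂ) * Lam ψ b P ^ (j / d)

open Classical in
lemma deg_formula {n : ℕ} {h : K[X]} (hh : h ∈ Mo K n) :
    n = ∑ d ∈ Finset.Icc 1 n, ∑ P ∈ Ir K d, ∑ e ∈ Finset.Icc 1 n, if P ^ e ∣ h then d else 0 := by
  obtain ⟨hm, hd⟩ := mem_Mo.1 hh
  have h0 : h ≠ 0 := hm.ne_zero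
  have e1 : ∀ d, ∀ P ∈ Ir K d, (∑ e ∈ Finset.Icc 1 n, if P ^ e ∣ h then d else 0) =
      (UniqueFactorizationMonoid.normalizedFactors h).count P * d := by
    intro d P hP
    obtain ⟨hPm, hPd, hPi⟩ := mem_Ir.1 hP
    have hem := UniqueFactorizationMonoid.emultiplicity_eq_count_normalizedFactors hPi h0
    rw [hPm.normalize_eq_self] at hem
    rw [← Finset.sum_filter, Finset.sum_const, smul_eq_mul]
    congr 1
    have : (Finset.Icc 1 n).filter (fun e => P ^ e ∣ h) = Finset.Icc 1
        ((UniqueFactorizationMonoid.normalizedFactors h).count P) := by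
      ext e
      simp only [Finset.mem_filter, Finset.mem_Icc]
      rw [pow_dvd_iff_le_emultiplicity, hem, Nat.cast_le]
      constructor
      · rintro ⟨⟨a, b⟩, c⟩; exact ⟨a, c⟩
      · rintro ⟨a, c⟩
        refine ⟨⟨a, ?_⟩, c⟩
        have hdv : P ^ e ∣ h := by
          rw [pow_dvd_iff_le_emultiplicity, hem, Nat.cast_le]; exact c
        have := natDegree_le_of_dvd hdv h0
        rw [natDegree_pow, hd] at this
        have hpos := hPi.natDegree_pos
        nlinarith
    rw [this, Nat.card_Icc]; simp
  rw [Finset.sum_congr rfl fun d _ => Finset.sum_congr rfl (e1 d)]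
  have hprod : (UniqueFactorizationMonoid.normalizedFactors h).prod = h := by
    rw [UniqueFactorizationMonoid.prod_normalizedFactors_eq h0, hm.normalize_eq_self]
  have hmon : ∀ P ∈ UniqueFactorizationMonoid.normalizedFactors h, P.Monic := by
    intro P hP
    have h1 := UniqueFactorizationMonoid.normalize_normalized_factor P hP
    rw [← h1]
    exact monic_normalize (UniqueFactorizationMonoid.irreducible_of_normalized_factor P hP).ne_zero
  have hdeg : n = ((UniqueFactorizationMonoid.normalizedFactors h).map natDegree).sum := by
    rw [← natDegree_multiset_prod_of_monic _ hmon, hprod, hd]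
  have hmap : ∀ P ∈ (UniqueFactorizationMonoid.normalizedFactors h).toFinset,
      P ∈ (Finset.Icc 1 n).biUnion (Ir K) := by
    intro P hP
    rw [Multiset.mem_toFinset] at hP
    have hPi := UniqueFactorizationMonoid.irreducible_of_normalized_factor P hP
    rw [Finset.mem_biUnion]
    refine ⟨P.natDegree, Finset.mem_Icc.2 ⟨hPi.natDegree_pos, ?_⟩, mem_Ir.2 ⟨hmon P hP, rfl, hPi⟩⟩
    rw [← hd]
    exact natDegree_le_of_dvd (UniqueFactorizationMonoid.dvd_of_mem_normalizedFactors hP) h0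
  conv_lhs => rw [hdeg, Finset.sum_multiset_map_count, Finset.sum_subset hmap (by
    intro P _ hP
    rw [Multiset.mem_toFinset] at hP
    simp [Multiset.count_eq_zero_of_notMem hP])]
  rw [Finset.sum_biUnion]
  · refine Finset.sum_congr rfl fun d _ => Finset.sum_congr rfl fun P hP => ?_
    rw [(mem_Ir.1 hP).2.1, smul_eq_mul]
  · intro d _ d' _ hne
    rw [Function.onFun, Finset.disjoint_left]
    intro P h1 h2
    exact hne ((mem_Ir.1 h1).2.1.symm.trans (mem_Ir.1 h2).2.1)

open Classical in
lemma sum_dvd (ψ : AddChar K ℂ) (b : K) {n m : ℕ} {R : K[X]} (hR : R ∈ Mo K m) :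
    (∑ h ∈ Mo K n, if R ∣ h then Lam ψ b h else 0) =
      if m ≤ n then Lam ψ b R * LA ψ b (n - m) else 0 := by
  obtain ⟨hRm, hRd⟩ := mem_Mo.1 hR
  split_ifs with hmn
  · rw [← Finset.sum_filter, LA, Finset.mul_sum]
    symm
    apply Finset.sum_bij (fun f _ => R * f)
    · intro f hf
      obtain ⟨hfm, hfd⟩ := mem_Mo.1 hf
      rw [Finset.mem_filter, mem_Mo]
      refine ⟨⟨hRm.mul hfm, ?_⟩, dvd_mul_right _ _⟩
      rw [hRm.natDegree_mul hfm, hRd, hfd]; omega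
    · intro f _ g _ hfg
      exact mul_left_cancel₀ hRm.ne_zero hfg
    · intro f hf
      rw [Finset.mem_filter, mem_Mo] at hf
      obtain ⟨⟨hfm, hfd⟩, g, rfl⟩ := hf
      have hgm := hRm.of_mul_monic_left hfm
      refine ⟨g, mem_Mo.2 ⟨hgm, ?_⟩, rfl⟩
      rw [hRm.natDegree_mul hgm, hRd] at hfd
      omega
    · intro f hf
      rw [Lam_mul ψ b hRm (mem_Mo.1 hf).1]
  · apply Finset.sum_eq_zero
    intro h hh
    rw [if_neg]
    intro hd
    obtain ⟨hm, hd'⟩ := mem_Mo.1 hh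
    have := natDegree_le_of_dvd hd hm.ne_zero
    omega

lemma newton (ψ : AddChar K ℂ) (b : K) (n : ℕ) :
    (n : ℂ) * LA ψ b n = ∑ j ∈ Finset.Icc 1 n, LT ψ b j * LA ψ b (n - j) := by
  classical
  calc (n : ℂ) * LA ψ b n = ∑ h ∈ Mo K n, Lam ψ b h * (∑ d ∈ Finset.Icc 1 n, ∑ P ∈ Ir K d,
        ∑ e ∈ Finset.Icc 1 n, if P ^ e ∣ h then (d : ℂ) else 0) := by
        rw [LA, Finset.mul_sum]
        refine Finset.sum_congr rfl fun h hh => ?_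
        rw [mul_comm]
        congr 1
        have := congrArg (Nat.cast : ℕ → ℂ) (deg_formula hh)
        rw [this]
        push_cast
        rfl
    _ = ∑ d ∈ Finset.Icc 1 n, ∑ P ∈ Ir K d, ∑ e ∈ Finset.Icc 1 n, (d : ℂ) *
          ∑ h ∈ Mo K n, if P ^ e ∣ h then Lam ψ b h else 0 := by
        simp only [Finset.mul_sum]
        rw [Finset.sum_comm]
        refine Finset.sum_congr rfl fun d _ => ?_
        rw [Finset.sum_comm]
        refine Finset.sum_congr rfl fun P _ => ?_
        rw [Finset.sum_comm]
        refine Finset.sum_congr rfl fun e _ => ?_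
        refine Finset.sum_congr rfl fun h _ => ?_
        split_ifs <;> ring
    _ = ∑ d ∈ Finset.Icc 1 n, ∑ P ∈ Ir K d, ∑ e ∈ Finset.Icc 1 n,
          ∑ j ∈ Finset.Icc 1 n, if e * d = j then (d : ℂ) * Lam ψ b P ^ e * LA ψ b (n - j) else 0 := by
        refine Finset.sum_congr rfl fun d hd => ?_
        refine Finset.sum_congr rfl fun P hP => ?_
        refine Finset.sum_congr rfl fun e he => ?_
        obtain ⟨hPm, hPd, hPi⟩ := mem_Ir.1 hP
        rw [sum_dvd ψ b (m := e * d) (mem_Mo.2 ⟨hPm.pow e, by rw [hPm.natDegree_pow, hPd]⟩),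
          Lam_pow ψ b hPm, Finset.sum_ite_eq]
        have : 1 ≤ e * d := Nat.mul_pos (Finset.mem_Icc.1 he).1 (Finset.mem_Icc.1 hd).1
        simp only [Finset.mem_Icc, this, true_and]
        split_ifs <;> ring
    _ = ∑ j ∈ Finset.Icc 1 n, ∑ d ∈ Finset.Icc 1 n, ∑ P ∈ Ir K d, ∑ e ∈ Finset.Icc 1 n,
          if e * d = j then (d : ℂ) * Lam ψ b P ^ e * LA ψ b (n - j) else 0 := by
        symm
        rw [Finset.sum_comm]
        refine Finset.sum_congr rfl fun d _ => ?_
        rw [Finset.sum_comm]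
        refine Finset.sum_congr rfl fun P _ => ?_
        exact Finset.sum_comm
    _ = _ := by
        refine Finset.sum_congr rfl fun j hj => ?_
        rw [Finset.mem_Icc] at hj
        rw [LT, Finset.sum_mul]
        symm
        have hsub : j.divisors ⊆ Finset.Icc 1 n := by
          intro d hd
          exact Finset.mem_Icc.2 ⟨Nat.pos_of_mem_divisors hd, (Nat.divisor_le hd).trans hj.2⟩
        rw [← Finset.sum_subset hsub]
        · refine Finset.sum_congr rfl fun d hd => ?_
          rw [Finset.sum_mul]
          refine Finset.sum_congr rfl fun P _ => ?_
          obtain ⟨e, rfl⟩ := (Nat.mem_divisors.1 hd).1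
          have hd0 := Nat.pos_of_mem_divisors hd
          rw [Finset.sum_eq_single e]
          · rw [if_pos (mul_comm _ _), Nat.mul_div_cancel_left _ hd0]
          · intro e' _ hne
            rw [if_neg]
            intro h
            rw [mul_comm] at h
            exact hne (Nat.eq_of_mul_eq_mul_left hd0 h)
          · intro he
            exfalso
            apply he
            rw [Finset.mem_Icc]
            constructor
            · exact Nat.pos_of_ne_zero (by rintro rfl; omega)
            · nlinarith
        · intro d _ hd
          apply Finset.sum_eq_zero
          intro P _
          apply Finset.sum_eq_zero
          intro e _
          rw [if_neg]
          rintro rfl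
          exact hd (Nat.mem_divisors.2 ⟨dvd_mul_left _ _, by omega⟩)

end Weil

end PartA1

section PartA2

open Polynomial

namespace Weil

set_option linter.unusedSectionVars false
set_option linter.unusedDecidableInType false
set_option linter.unusedFintypeInType false

variable {K : Type*} [Field K] [Fintype K] [DecidableEq K]

lemma LA_zero (ψ : AddChar K ℂ) (b : K) : LA ψ b 0 = 1 := by
  have : Mo K 0 = {1} := by
    ext h
    rw [mem_Mo, Finset.mem_singleton]
    constructor
    · rintro ⟨a, b⟩
      exact a.natDegree_eq_zero.1 b
    · rintro rfl
      simp
  rw [LA, this, Finset.sum_singleton, Lam_one]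

lemma LA_one (ψ : AddChar K ℂ) (b : K) : LA ψ b 1 = LT ψ b 1 := by
  have := newton ψ b 1
  simpa [LA_zero] using this

lemma LA_big {ψ : AddChar K ℂ} (hψ : ψ ≠ 1) (b : K) {n : ℕ} (hn : 3 ≤ n) : LA ψ b n = 0 := by
  obtain ⟨t, ht⟩ : ∃ t, ψ t ≠ 1 := AddChar.ne_one_iff.1 hψ
  have key : LA ψ b n = ψ t * LA ψ b n := by
    rw [LA, Finset.mul_sum]
    symm
    have hdt : (C t * X ^ (n - 1)).natDegree < n := by
      refine lt_of_le_of_lt (natDegree_C_mul_X_pow_le _ _) (by omega)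
    have hmo : ∀ s : K, ∀ h ∈ Mo K n, h - C s * X ^ (n - 1) ∈ Mo K n := by
      intro s h hh
      obtain ⟨hm, hd⟩ := mem_Mo.1 hh
      have hds : (C s * X ^ (n - 1)).natDegree < h.natDegree := by
        rw [hd]
        refine lt_of_le_of_lt (natDegree_C_mul_X_pow_le _ _) (by omega)
      exact mem_Mo.2 ⟨hm.sub_of_left (degree_lt_degree hds), by
        rw [natDegree_sub_eq_left_of_natDegree_lt hds, hd]⟩
    refine Finset.sum_nbij' (fun h => h - C t * X ^ (n - 1)) (fun h => h - C (-t) * X ^ (n - 1))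
      (hmo t) (hmo (-t)) (fun h _ => by simp) (fun h _ => by simp) ?_
    intro h hh
    obtain ⟨hm, hd⟩ := mem_Mo.1 hh
    obtain ⟨hm', hd'⟩ := mem_Mo.1 (hmo t h hh)
    have c0 : (h - C t * X ^ (n - 1)).coeff 0 = h.coeff 0 := by
      rw [coeff_sub, coeff_C_mul_X_pow, if_neg (by omega), sub_zero]
    have c1 : (h - C t * X ^ (n - 1)).coeff 1 = h.coeff 1 := by
      rw [coeff_sub, coeff_C_mul_X_pow, if_neg (by omega), sub_zero]
    have cn : (h - C t * X ^ (n - 1)).nextCoeff = h.nextCoeff - t := by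
      rw [nextCoeff_of_natDegree_pos (by omega), nextCoeff_of_natDegree_pos (by omega), hd', hd,
        coeff_sub, coeff_C_mul_X_pow, if_pos rfl]
    unfold Lam
    rw [c0, c1, cn]
    split_ifs
    · simp
    · rw [← AddChar.map_add_eq_mul]
      congr 1
      ring
  have : (ψ t - 1) * LA ψ b n = 0 := by rw [sub_mul, one_mul, ← key, sub_self]
  rcases mul_eq_zero.1 this with h | h
  · exact absurd (sub_eq_zero.1 h) ht
  · exact h

lemma LA_two {ψ : AddChar K ℂ} (hψ : ψ ≠ 1) {b : K} (hb : b ≠ 0) :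
    LA ψ b 2 = Fintype.card K := by
  have e1 : LA ψ b 2 = ∑ x : K × K, Lam ψ b (X ^ 2 + C x.1 * X + C x.2) := by
    symm
    rw [LA]
    have hc : ∀ x : K × K, (X ^ 2 + C x.1 * X + C x.2 : K[X]) = C 1 * X ^ 2 + C x.1 * X + C x.2 := by
      intro x; simp
    refine Finset.sum_nbij' (fun x => (X ^ 2 + C x.1 * X + C x.2 : K[X]))
      (fun h => (h.coeff 1, h.coeff 0)) ?_ ?_ ?_ ?_ ?_
    · intro x _
      rw [mem_Mo, hc]
      exact ⟨leadingCoeff_quadratic one_ne_zero, natDegree_quadratic one_ne_zero⟩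
    · simp
    · intro x _
      simp [coeff_X, coeff_C, coeff_X_pow]
    · intro h hh
      obtain ⟨hm, hd⟩ := mem_Mo.1 hh
      have := h.as_sum_range_C_mul_X_pow
      rw [hd, Finset.sum_range_succ, Finset.sum_range_succ, Finset.sum_range_one] at this
      have h2 : h.coeff 2 = 1 := by rw [← hd]; exact hm
      rw [h2] at this
      conv_rhs => rw [this]
      simp; ring
    · intro x _; rfl
  rw [e1, Fintype.sum_prod_type_right]
  have e2 : ∀ d : K, ∑ c : K, Lam ψ b (X ^ 2 + C c * X + C d) =
      if d = -b then (Fintype.card K : ℂ) else 0 := by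
    intro d
    have hl : ∀ c : K, Lam ψ b (X ^ 2 + C c * X + C d) =
        if d = 0 then 0 else ψ (c * (-(1 + b / d))) := by
      intro c
      have hc : (X ^ 2 + C c * X + C d : K[X]) = C 1 * X ^ 2 + C c * X + C d := by simp
      have hn : (C 1 * X ^ 2 + C c * X + C d : K[X]).natDegree = 2 := natDegree_quadratic one_ne_zero
      rw [hc]
      unfold Lam
      rw [nextCoeff_of_natDegree_pos (by omega), hn]
      simp only [coeff_add, coeff_C_mul, coeff_X_pow, coeff_X, coeff_C]
      norm_num
      congr 2
      ring
    simp only [hl]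
    by_cases hd0 : d = 0
    · subst hd0
      simp [hb, eq_comm]
    simp only [hd0, if_false]
    split_ifs with h
    · subst h
      have : (1 + b / -b) = 0 := by field_simp; ring
      simp [this]
    · have hne : -(1 + b / d) ≠ 0 := by
        intro h0
        apply h
        field_simp at h0
        linear_combination -h0
      rw [← AddChar.sum_eq_zero_of_ne_one hψ]
      exact Fintype.sum_equiv (Equiv.mulRight₀ _ hne) _ _ (fun c => rfl)
  rw [Finset.sum_congr rfl fun d _ => e2 d]
  simp

lemma LT_two {ψ : AddChar K ℂ} (hψ : ψ ≠ 1) {b : K} (hb : b ≠ 0) :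
    LT ψ b 2 = 2 * Fintype.card K - LT ψ b 1 ^ 2 := by
  have := newton ψ b 2
  rw [LA_two hψ hb, Finset.sum_Icc_succ_top (by norm_num)] at this
  simp [LA_zero, LA_one] at this
  linear_combination -this

lemma LT_rec {ψ : AddChar K ℂ} (hψ : ψ ≠ 1) {b : K} (hb : b ≠ 0) (n : ℕ) :
    LT ψ b (n + 3) = - LT ψ b 1 * LT ψ b (n + 2) - Fintype.card K * LT ψ b (n + 1) := by
  have := newton ψ b (n + 3)
  rw [LA_big hψ b (by omega), Finset.sum_Icc_succ_top (by omega), Finset.sum_Icc_succ_top (by omega),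
    Finset.sum_Icc_succ_top (by omega), Finset.sum_eq_zero] at this
  · have h1 : n + 3 - (n + 1) = 2 := by omega
    have h2 : n + 3 - (n + 1 + 1) = 1 := by omega
    have h3 : n + 3 - (n + 2 + 1) = 0 := by omega
    rw [h1, h2, h3, LA_zero, LA_one, LA_two hψ hb] at this
    linear_combination -this
  · intro j hj
    rw [Finset.mem_Icc] at hj
    rw [LA_big hψ b (n := n + 3 - j) (by omega), mul_zero]

section ext

variable {E : Type*} [Field E] [Fintype E] [Algebra K E]

lemma minpoly_dvd_reverse (x : E) (hx : x ≠ 0) : minpoly K x⁻¹ ∣ (minpoly K x).reverse := by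
  apply minpoly.dvd
  let _ : Invertible x := invertibleOfNonzero hx
  have := (eval₂_reverse_eq_zero_iff (algebraMap K E) x (minpoly K x)).2 (minpoly.aeval K x)
  rwa [invOf_eq_inv] at this

lemma nextCoeff_minpoly_inv (x : E) (hx : x ≠ 0) :
    (minpoly K x).coeff 0 ≠ 0 ∧
    (minpoly K x⁻¹).natDegree = (minpoly K x).natDegree ∧
    (minpoly K x⁻¹).nextCoeff = (minpoly K x).coeff 1 / (minpoly K x).coeff 0 := by
  have hintg : ∀ y : E, IsIntegral K y := fun y => IsIntegral.of_finite K y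
  have hm : (minpoly K x).Monic := minpoly.monic (hintg x)
  have hm' : (minpoly K x⁻¹).Monic := minpoly.monic (hintg _)
  have hle : ∀ y : E, y ≠ 0 → (minpoly K y⁻¹).natDegree ≤ (minpoly K y).natDegree := by
    intro y hy
    refine (natDegree_le_of_dvd (minpoly_dvd_reverse y hy) ?_).trans (reverse_natDegree_le _)
    rw [Ne, reverse_eq_zero]
    exact (minpoly.monic (hintg y)).ne_zero
  have hdeq : (minpoly K x⁻¹).natDegree = (minpoly K x).natDegree := by
    apply le_antisymm (hle x hx)
    have := hle x⁻¹ (inv_ne_zero hx)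
    rwa [inv_inv] at this
  have h1 := minpoly_dvd_reverse (K := K) x⁻¹ (inv_ne_zero hx)
  rw [inv_inv] at h1
  obtain ⟨c, hc⟩ := h1
  have hr0 : (minpoly K x⁻¹).reverse ≠ 0 := by
    rw [Ne, reverse_eq_zero]; exact hm'.ne_zero
  have hcd : c.natDegree = 0 := by
    have hc0 : c ≠ 0 := by rintro rfl; simp at hc; exact hm'.ne_zero hc
    have := congrArg natDegree hc
    rw [natDegree_mul hm.ne_zero hc0] at this
    have h2 := reverse_natDegree_le (minpoly K x⁻¹)
    omega
  rw [eq_C_of_natDegree_eq_zero hcd] at hc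
  have c0 := congrArg (fun P => coeff P 0) hc
  have c1 := congrArg (fun P => coeff P 1) hc
  simp only [coeff_zero_reverse, coeff_one_reverse, coeff_mul_C, hm'.leadingCoeff] at c0 c1
  have hne : (minpoly K x).coeff 0 ≠ 0 := by
    intro h0
    rw [h0, zero_mul] at c0
    exact one_ne_zero c0
  refine ⟨hne, hdeq, ?_⟩
  rw [c1, eq_div_iff hne]
  linear_combination (-(minpoly K x).coeff 1) * c0

lemma trace_eq (x : E) : Algebra.trace K E x =
    (Module.finrank K E / (minpoly K x).natDegree : ℕ) * -(minpoly K x).nextCoeff := by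
  rw [trace_eq_finrank_mul_minpoly_nextCoeff]
  congr 2
  have h1 := Module.finrank_mul_finrank K (IntermediateField.adjoin K {x}) E
  have h2 := IntermediateField.adjoin.finrank (IsIntegral.of_finite K x)
  have h3 := minpoly.natDegree_pos (IsIntegral.of_finite K x)
  rw [← h1, h2, Nat.mul_div_cancel_left _ h3]

lemma Lam_minpoly (ψ : AddChar K ℂ) (b : K) (x : E) (hx : x ≠ 0) :
    Lam ψ b (minpoly K x) ^ (Module.finrank K E / (minpoly K x).natDegree) =
      ψ (Algebra.trace K E (x + algebraMap K E b * x⁻¹)) := by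
  obtain ⟨h0, hd, hn⟩ := nextCoeff_minpoly_inv (K := K) x hx
  rw [map_add, ← Algebra.smul_def, map_smul, trace_eq x, trace_eq x⁻¹, hd, hn, Lam, if_neg h0,
    ← AddChar.map_nsmul_eq_pow]
  congr 1
  rw [nsmul_eq_mul, smul_eq_mul]
  ring

lemma root_count {P : K[X]} (hi : Irreducible P) (hm : P.Monic)
    (hd : P.natDegree ∣ Module.finrank K E) :
    ∃ s : Finset E, s.card = P.natDegree ∧ ∀ x, x ∈ s ↔ minpoly K x = P := by
  classical
  have hsep : P.Separable := PerfectField.separable_of_irreducible hi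
  have hdv := hi.natDegree_dvd_iff_dvd_X_pow_card_pow_sub_X.1 hd
  have hcard : Nat.card K ^ Module.finrank K E = Fintype.card E := by
    rw [← Nat.card_eq_fintype_card]
    exact (Module.natCard_eq_pow_finrank (K := K) (V := E)).symm
  rw [hcard] at hdv
  have hspl : (P.map (algebraMap K E)).Splits := by
    have h2 := map_dvd (mapRingHom (algebraMap K E)) hdv
    simp only [coe_mapRingHom, Polynomial.map_sub, Polynomial.map_pow, map_X] at h2
    refine Splits.of_dvd ?_ ?_ h2
    · rw [splits_iff_card_roots, FiniteField.roots_X_pow_card_sub_X,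
        FiniteField.X_pow_card_sub_X_natDegree_eq _ Fintype.one_lt_card]
      simp
    · exact FiniteField.X_pow_card_sub_X_ne_zero _ Fintype.one_lt_card
  refine ⟨(P.aroots E).toFinset, ?_, ?_⟩
  · rw [Multiset.toFinset_card_of_nodup (nodup_roots hsep.map), ← hspl.natDegree_eq_card_roots,
      natDegree_map]
  · intro x
    rw [Multiset.mem_toFinset, mem_aroots]
    constructor
    · rintro ⟨_, h⟩
      exact (minpoly.eq_of_irreducible_of_monic hi h hm).symm
    · rintro rfl
      exact ⟨hm.ne_zero, minpoly.aeval K x⟩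

lemma LT_eq (ψ : AddChar K ℂ) (b : K) [DecidableEq E] :
    LT ψ b (Module.finrank K E) = ∑ x : E, if x = 0 then 0 else
      ψ (Algebra.trace K E (x + algebraMap K E b * x⁻¹)) := by
  classical
  set j := Module.finrank K E with hj
  have hj0 : j ≠ 0 := Module.finrank_pos.ne'
  have e1 : ∀ x : E, (if x = 0 then 0 else ψ (Algebra.trace K E (x + algebraMap K E b * x⁻¹))) =
      Lam ψ b (minpoly K x) ^ (j / (minpoly K x).natDegree) := by
    intro x
    split_ifs with h
    · subst h
      have : minpoly K (0 : E) = X := minpoly.zero K E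
      rw [this, Lam, if_pos (by simp), natDegree_X, Nat.div_one, zero_pow hj0]
    · rw [Lam_minpoly ψ b x h]
  simp only [e1]
  rw [LT]
  have hmaps : ∀ x ∈ (Finset.univ : Finset E), minpoly K x ∈ j.divisors.biUnion (Ir K) := by
    intro x _
    rw [Finset.mem_biUnion]
    refine ⟨(minpoly K x).natDegree, ?_, ?_⟩
    · rw [Nat.mem_divisors]
      exact ⟨minpoly.degree_dvd (IsIntegral.of_finite K x), hj0⟩
    · exact mem_Ir.2 ⟨minpoly.monic (IsIntegral.of_finite K x), rfl,
        minpoly.irreducible (IsIntegral.of_finite K x)⟩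
  rw [← Finset.sum_fiberwise_of_maps_to hmaps, Finset.sum_biUnion]
  · refine Finset.sum_congr rfl fun d hd => Finset.sum_congr rfl fun P hP => ?_
    obtain ⟨hPm, hPd, hPi⟩ := mem_Ir.1 hP
    obtain ⟨s, hs, hs'⟩ := root_count (E := E) hPi hPm (by rw [hPd]; exact (Nat.mem_divisors.1 hd).1)
    have : (Finset.univ.filter fun x : E => minpoly K x = P) = s := by
      ext x; simp [hs']
    rw [this, Finset.sum_congr rfl (g := fun _ => Lam ψ b P ^ (j / d)), Finset.sum_const, hs, hPd,
      nsmul_eq_mul]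
    intro x hx
    rw [(hs' x).1 hx, hPd]
  · intro d _ d' _ hne
    rw [Function.onFun, Finset.disjoint_left]
    intro P h1 h2
    exact hne ((mem_Ir.1 h1).2.1.symm.trans (mem_Ir.1 h2).2.1)

end ext

end Weil

end PartA2

section PartA3

open Polynomial

namespace Weil

lemma sq_ne {K : Type*} [Field K] {F A B : K[X]} {c : K} (hc : c ≠ 0) (hF : Squarefree F)
    (hu : ¬ IsUnit F) (h : A ^ 2 = C c * F * B ^ 2) : A = 0 ∧ B = 0 := by
  have hF0 : F ≠ 0 := hF.ne_zero
  by_cases hB : B = 0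
  · subst hB
    simpa using h
  have hA : A ≠ 0 := by
    rintro rfl
    have : C c * F * B ^ 2 ≠ 0 := by simp [hc, hF0, hB]
    exact this (by simpa using h.symm)
  obtain ⟨P, hP, hPF⟩ := WfDvdMonoid.exists_irreducible_factor hu hF0
  have hPp : Prime P := hP.prime
  have e1 : emultiplicity P (A^2) = emultiplicity P (C c * F * B^2) := by rw [h]
  rw [emultiplicity_pow hPp, emultiplicity_mul hPp, emultiplicity_mul hPp,
    emultiplicity_pow hPp] at e1
  have hcu : emultiplicity P (C c) = 0 := by
    rw [emultiplicity_eq_zero]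
    intro hd
    exact hP.not_isUnit (isUnit_of_dvd_unit hd (by simpa using hc))
  have hFm : emultiplicity P F = 1 := by
    apply le_antisymm
    · by_contra hlt
      push Not at hlt
      have : P ^ 2 ∣ F := pow_dvd_of_le_emultiplicity (by
        have := Order.add_one_le_of_lt hlt
        simpa [one_add_one_eq_two] using this)
      exact hP.not_isUnit (hF P (by simpa [sq] using this))
    · have := le_emultiplicity_of_pow_dvd (k := 1) (by simpa using hPF)
      simpa using this
  rw [hcu, hFm] at e1
  have fA : FiniteMultiplicity P A := FiniteMultiplicity.of_prime_left hPp hA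
  have fB : FiniteMultiplicity P B := FiniteMultiplicity.of_prime_left hPp hB
  rw [fA.emultiplicity_eq_multiplicity, fB.emultiplicity_eq_multiplicity] at e1
  exfalso
  have : 2 * multiplicity P A = 0 + 1 + 2 * multiplicity P B := by exact_mod_cast e1
  omega

lemma nonvanish {K : Type*} [Field K] {p : ℕ} [Fact p.Prime] [CharP K p] {m Q r L e : ℕ}
    (hQ : Q = p ^ m) (hr : 2 * r = Q + 1) (hL : 2 * L < Q) {F : K[X]}
    (hF : Squarefree F) (hu : ¬ IsUnit F) (hF0 : F.eval 0 ≠ 0) (hFe : F.natDegree ≤ 2 * e)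
    (A B : ℕ → K[X]) (n : ℕ) (hA : ∀ i, (A i).natDegree ≤ L)
    (hB : ∀ i, (B i) = 0 ∨ (B i).natDegree + e ≤ L)
    (h : ∑ i ∈ Finset.range n, A i * X ^ (i * Q) +
      F ^ r * ∑ i ∈ Finset.range n, B i * X ^ (i * Q) = 0) :
    ∀ i < n, A i = 0 ∧ B i = 0 := by
  have hcp : CharP K[X] p := inferInstance
  intro i
  induction i using Nat.strong_induction_on with
  | _ i ih =>
  intro hi
  have key : X ^ Q ∣ A i + F ^ r * B i := by
    have h1 : ∑ j ∈ Finset.range n, (A j + F ^ r * B j) * X ^ (j * Q) = 0 := by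
      rw [← h, Finset.mul_sum, ← Finset.sum_add_distrib]
      exact Finset.sum_congr rfl fun j _ => by ring
    rw [← Finset.add_sum_erase _ _ (Finset.mem_range.2 hi)] at h1
    have h2 : X ^ ((i + 1) * Q) ∣
        ∑ j ∈ (Finset.range n).erase i, (A j + F ^ r * B j) * X ^ (j * Q) := by
      apply Finset.dvd_sum
      intro j hj
      rw [Finset.mem_erase, Finset.mem_range] at hj
      rcases lt_or_gt_of_ne hj.1 with hlt | hgt
      · obtain ⟨a, b⟩ := ih j hlt hj.2
        simp [a, b]
      · exact Dvd.dvd.mul_left (pow_dvd_pow _ (Nat.mul_le_mul_right _ hgt)) _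
    have h3 : X ^ ((i + 1) * Q) ∣ (A i + F ^ r * B i) * X ^ (i * Q) := by
      rw [eq_neg_of_add_eq_zero_left h1]
      exact (dvd_neg).2 h2
    rw [add_mul, one_mul, pow_add, mul_comm] at h3
    exact (mul_dvd_mul_iff_right (pow_ne_zero _ X_ne_zero)).1 h3
  set c := (F.eval 0) ^ Q with hc
  have hFQ : X ^ Q ∣ F ^ Q - C c := by
    have h1 : F ^ Q - C c = (F - C (F.eval 0)) ^ Q := by
      rw [hQ, sub_pow_char_pow, hc, hQ, C_pow]
    rw [h1]
    apply pow_dvd_pow_of_dvd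
    rw [X_dvd_iff]
    simp [coeff_zero_eq_eval_zero]
  have h4 : X ^ Q ∣ (A i)^2 - C c * F * (B i)^2 := by
    have e1 : (A i)^2 - C c * F * (B i)^2 =
        (A i + F ^ r * B i) * (A i - F ^ r * B i) + (F ^ Q - C c) * (F * (B i)^2) := by
      have : F ^ r * F ^ r = F ^ Q * F := by
        rw [← pow_add, ← pow_succ]; congr 1; omega
      linear_combination ((B i)^2) * this
    rw [e1]
    exact dvd_add (Dvd.dvd.mul_right key _) (Dvd.dvd.mul_right hFQ _)
  have h5 : (A i)^2 - C c * F * (B i)^2 = 0 := by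
    by_contra hne
    have := natDegree_le_of_dvd h4 hne
    rw [natDegree_X_pow] at this
    have d1 : ((A i)^2).natDegree ≤ 2 * L := by
      rw [natDegree_pow]; exact Nat.mul_le_mul_left _ (hA i)
    have d2 : (C c * F * (B i)^2).natDegree ≤ 2 * L := by
      rcases hB i with hb | hb
      · simp [hb]
      · calc _ ≤ (C c * F).natDegree + ((B i)^2).natDegree := natDegree_mul_le
          _ ≤ 2 * e + 2 * (B i).natDegree := by
            gcongr
            · exact (natDegree_C_mul_le _ _).trans hFe
            · rw [natDegree_pow]
          _ ≤ _ := by omega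
    have := natDegree_sub_le_of_le d1 d2
    omega
  exact sq_ne (pow_ne_zero _ hF0) hF hu (sub_eq_zero.1 h5)

/-- The linear map used in Stepanov's method. -/
noncomputable def stepMap {K : Type*} [Field K] (Q L e r : ℕ) (F : K[X]) :
    ((Fin (L + e + 1) × Fin (L + 1) → K) × (Fin (L + 1) × Fin (L - e + 1) → K)) →ₗ[K] K[X] where
  toFun := fun v => (∑ x : Fin (L + e + 1) × Fin (L + 1), C (v.1 x) * X ^ (Q * x.2.1 + x.1.1)) -
        F ^ r * ∑ x : Fin (L + 1) × Fin (L - e + 1), C (v.2 x) * X ^ (Q * x.2.1 + x.1.1)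
  map_add' := by
    intro v w
    simp only [Prod.fst_add, Prod.snd_add, Pi.add_apply, C_add, add_mul, Finset.sum_add_distrib]
    ring
  map_smul' := by
    intro a v
    simp only [Prod.smul_fst, Prod.smul_snd, Pi.smul_apply, smul_eq_mul, C_mul, mul_assoc,
      ← Finset.mul_sum, RingHom.id_apply, smul_eq_C_mul]
    ring

lemma stepMap_apply {K : Type*} [Field K] (Q L e r : ℕ) (F : K[X]) (v) :
    stepMap Q L e r F v = (∑ x : Fin (L + e + 1) × Fin (L + 1), C (v.1 x) * X ^ (Q * x.2.1 + x.1.1)) -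
        F ^ r * ∑ x : Fin (L + 1) × Fin (L - e + 1), C (v.2 x) * X ^ (Q * x.2.1 + x.1.1) := rfl

lemma stepMap_natDegree {K : Type*} [Field K] {Q L e r : ℕ} (hr : 2 * r = Q + 1)
    (heL : e ≤ L) {F : K[X]} (hFe : F.natDegree ≤ 2 * e) (v) :
    (stepMap Q L e r F v).natDegree ≤ Q * L + L + e := by
  rw [stepMap_apply]
  have hx2 : ∀ x : Fin (L + 1) × Fin (L - e + 1), Q * x.2.1 + x.1.1 ≤ Q * (L - e) + L := by
    intro x
    have h1 := x.1.2
    have h2 := x.2.2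
    have := Nat.mul_le_mul_left Q (Nat.le_of_lt_succ h2)
    omega
  refine (natDegree_sub_le _ _).trans (max_le ?_ ?_)
  · apply natDegree_sum_le_of_forall_le
    intro x _
    refine (natDegree_C_mul_X_pow_le _ _).trans ?_
    have h1 := x.1.2
    have h2 := x.2.2
    have := Nat.mul_le_mul_left Q (Nat.le_of_lt_succ h2)
    omega
  · refine natDegree_mul_le.trans ?_
    have h1 : (F ^ r).natDegree ≤ e * (Q + 1) := by
      rw [natDegree_pow, ← hr]
      calc r * F.natDegree ≤ r * (2 * e) := Nat.mul_le_mul_left _ hFe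
        _ = _ := by ring
    have h2 : (∑ x : Fin (L + 1) × Fin (L - e + 1), C (v.2 x) * X ^ (Q * x.2.1 + x.1.1)).natDegree
        ≤ Q * (L - e) + L := by
      apply natDegree_sum_le_of_forall_le
      intro x _
      exact (natDegree_C_mul_X_pow_le _ _).trans (hx2 x)
    have h3 : Q * (L - e) + Q * e = Q * L := by rw [← mul_add]; congr 1; omega
    nlinarith

lemma stepMap_ker {K : Type*} [Field K] {Q L e r : ℕ} (hr : 2 * r = Q + 1) (hL : 2 * L + 1 = Q)
    (heL : e ≤ L) {F : K[X]} (hFe : F.natDegree ≤ 2 * e) :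
    ∃ v, stepMap Q L e r F v = 0 ∧ v ≠ 0 := by
  have hmem : ∀ v, stepMap Q L e r F v ∈ degreeLT K (Q * L + L + e + 1) := by
    intro v
    rw [mem_degreeLT]
    refine lt_of_le_of_lt degree_le_natDegree ?_
    have := stepMap_natDegree hr heL hFe v
    exact_mod_cast Nat.lt_succ_of_le this
  have hfin : Module.finrank K (degreeLT K (Q * L + L + e + 1)) < Module.finrank K
      ((Fin (L + e + 1) × Fin (L + 1) → K) × (Fin (L + 1) × Fin (L - e + 1) → K)) := by
    have e1 : Module.finrank K (degreeLT K (Q * L + L + e + 1)) = Q * L + L + e + 1 := by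
      rw [LinearEquiv.finrank_eq (degreeLTEquiv K _)]; simp
    rw [e1]
    simp only [Module.finrank_prod, Module.finrank_pi, Fintype.card_prod, Fintype.card_fin]
    obtain ⟨t, rfl⟩ := Nat.exists_eq_add_of_le heL
    rw [← hL, Nat.add_sub_cancel_left]
    nlinarith
  obtain ⟨v, hv, hv0⟩ := Submodule.exists_mem_ne_zero_of_ne_bot
    (LinearMap.ker_ne_bot_of_finrank_lt (f := (stepMap Q L e r F).codRestrict _ hmem) hfin)
  refine ⟨v, ?_, hv0⟩
  have := LinearMap.mem_ker.1 hv
  exact congrArg Subtype.val this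

set_option maxHeartbeats 1000000 in
/-- Stepanov's bound. -/
lemma stepanov {K : Type*} [Field K] [Fintype K] [DecidableEq K] {p : ℕ} [Fact p.Prime] [CharP K p]
    {m Q r L e : ℕ}
    (hQ : Q = p ^ m) (hcard : Fintype.card K = Q ^ 2) (hr : 2 * r = Q + 1) (hL : 2 * L + 1 = Q)
    (heL : e ≤ L) {F : K[X]}
    (hF : Squarefree F) (hu : ¬ IsUnit F) (hF0 : F.eval 0 ≠ 0) (hFe : F.natDegree ≤ 2 * e) :
    (Finset.univ.filter (fun y : K => F.eval y ^ ((Q ^ 2 - 1) / 2) = -1)).card ≤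
      L + (L + e) * Q := by
  classical
  have hcp : CharP K[X] p := inferInstance
  have hQ0 : 0 < Q := by omega
  obtain ⟨v, hΦ, hv0⟩ := stepMap_ker hr hL heL hFe
  let A : ℕ → K[X] := fun i => if hi : i < L + e + 1 then
    ∑ j : Fin (L + 1), C ((v.1 (⟨i, hi⟩, j)) ^ Q) * X ^ j.1 else 0
  let B : ℕ → K[X] := fun i => if hi : i < L + 1 then
    ∑ j : Fin (L - e + 1), C ((v.2 (⟨i, hi⟩, j)) ^ Q) * X ^ j.1 else 0
  have hAd : ∀ i, (A i).natDegree ≤ L := by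
    intro i
    simp only [A]
    split_ifs with hi
    · apply natDegree_sum_le_of_forall_le
      intro x _
      exact (natDegree_C_mul_X_pow_le _ _).trans (Nat.le_of_lt_succ x.2)
    · simp
  have hBd : ∀ i, (B i).natDegree ≤ L - e := by
    intro i
    simp only [B]
    split_ifs with hi
    · apply natDegree_sum_le_of_forall_le
      intro x _
      exact (natDegree_C_mul_X_pow_le _ _).trans (Nat.le_of_lt_succ x.2)
    · simp
  have hB0 : ∀ i, ¬ i < L + 1 → B i = 0 := by
    intro i hi
    simp only [B]
    rw [dif_neg hi]
  set h : K[X] := ∑ i ∈ Finset.range (L + e + 1), A i * X ^ (i * Q) +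
      F ^ r * ∑ i ∈ Finset.range (L + e + 1), B i * X ^ (i * Q) with hh
  have hne : h ≠ 0 := by
    intro h0
    have := nonvanish hQ hr (by omega) hF hu hF0 hFe A B (L + e + 1) hAd
      (fun i => Or.inr (by have := hBd i; omega)) h0
    apply hv0
    have pz : ∀ {n : ℕ} (c : Fin n → K), ∑ j : Fin n, C ((c j) ^ Q) * X ^ j.1 = 0 → ∀ j, c j = 0 := by
      intro n c hc j
      have := congrArg (fun P => coeff P j.1) hc
      simp only [finsetSum_coeff, coeff_C_mul_X_pow, coeff_zero, Fin.val_inj] at this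
      simpa [hQ0.ne'] using this
    ext x
    · obtain ⟨i, j⟩ := x
      have h1 := (this i.1 i.2).1
      simp only [A, i.2, dite_true] at h1
      exact pz _ h1 j
    · obtain ⟨i, j⟩ := x
      have h1 := (this i.1 (by omega)).2
      simp only [B, i.2, dite_true] at h1
      exact pz _ h1 j
  have hdeg : h.natDegree ≤ L + (L + e) * Q := by
    apply natDegree_add_le_of_degree_le
    · apply natDegree_sum_le_of_forall_le
      intro i hi
      refine natDegree_mul_le.trans ?_
      rw [natDegree_X_pow]
      have := Nat.mul_le_mul_right Q (Nat.le_of_lt_succ (Finset.mem_range.1 hi))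
      exact add_le_add (hAd i) this
    · refine natDegree_mul_le.trans ?_
      have h1 : (F ^ r).natDegree ≤ e * (Q + 1) := by
        rw [natDegree_pow, ← hr]
        calc r * F.natDegree ≤ r * (2 * e) := Nat.mul_le_mul_left _ hFe
          _ = _ := by ring
      have h2 : (∑ i ∈ Finset.range (L + e + 1), B i * X ^ (i * Q)).natDegree ≤ (L - e) + L * Q := by
        apply natDegree_sum_le_of_forall_le
        intro i hi
        by_cases hi' : i < L + 1
        · refine natDegree_mul_le.trans ?_
          rw [natDegree_X_pow]
          exact add_le_add (hBd i) (Nat.mul_le_mul_right Q (Nat.le_of_lt_succ hi'))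
        · simp [hB0 i hi']
      have h3 : (L - e) + e = L := by omega
      nlinarith
  have hroot : ∀ y ∈ (Finset.univ.filter (fun y : K => F.eval y ^ ((Q ^ 2 - 1) / 2) = -1)),
      y ∈ h.roots.toFinset := by
    intro y hy
    simp only [Finset.mem_filter, Finset.mem_univ, true_and] at hy
    rw [Multiset.mem_toFinset, mem_roots hne, IsRoot]
    have hq : ∀ z : K, (z ^ Q) ^ Q = z := by
      intro z
      rw [← pow_mul, ← sq, ← hcard, FiniteField.pow_card]
    have hpow : h.eval y ^ Q = (stepMap Q L e r F v).eval y := by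
      have hFr : (F.eval y ^ r) ^ Q = - F.eval y ^ r := by
        rw [← pow_mul]
        have : r * Q = (Q^2-1)/2 + r := by
          have : Q^2 - 1 = 2 * ((r-1) * Q + r - 1) := by
            obtain ⟨r', rfl⟩ : ∃ r', r = r' + 1 := ⟨r - 1, by omega⟩
            have : Q = 2 * r' + 1 := by omega
            subst this
            simp only [Nat.add_sub_cancel]
            have : (2 * r' + 1)^2 = 2 * (r' * (2 * r' + 1) + r') + 1 := by ring
            omega
          rw [this, Nat.mul_div_cancel_left _ (by norm_num)]
          obtain ⟨r', rfl⟩ : ∃ r', r = r' + 1 := ⟨r - 1, by omega⟩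
          simp only [Nat.add_sub_cancel]
          have : Q = 2 * r' + 1 := by omega
          have : (r' + 1) * Q = r' * Q + Q := by ring
          omega
        rw [this, pow_add, hy]; ring
      have sA : (∑ i ∈ Finset.range (L + e + 1), A i * X ^ (i * Q)).eval y ^ Q =
          (∑ x : Fin (L + e + 1) × Fin (L + 1), C (v.1 x) * X ^ (Q * x.2.1 + x.1.1)).eval y := by
        rw [Finset.sum_range]
        simp only [A, Fin.is_lt, dite_true, eval_finsetSum, eval_mul, eval_C, eval_pow, eval_X]
        rw [Fintype.sum_prod_type]
        conv_lhs => rw [hQ, sum_pow_char_pow]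
        simp only [← hQ, mul_pow, ← pow_mul]
        refine Finset.sum_congr rfl fun i _ => ?_
        conv_lhs => rw [hQ, sum_pow_char_pow]
        simp only [← hQ, mul_pow]
        rw [Finset.sum_mul]
        refine Finset.sum_congr rfl fun j _ => ?_
        rw [hq, mul_assoc (i.1), ← sq, mul_comm i.1, pow_mul y (Q^2), ← hcard, FiniteField.pow_card,
          ← pow_mul, pow_add, mul_assoc, mul_comm Q]
      have sB : (∑ i ∈ Finset.range (L + e + 1), B i * X ^ (i * Q)).eval y ^ Q =
          (∑ x : Fin (L + 1) × Fin (L - e + 1), C (v.2 x) * X ^ (Q * x.2.1 + x.1.1)).eval y := by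
        have : ∑ i ∈ Finset.range (L + e + 1), B i * X ^ (i * Q) =
            ∑ i ∈ Finset.range (L + 1), B i * X ^ (i * Q) := by
          symm
          apply Finset.sum_subset
          · intro i; simp only [Finset.mem_range]; omega
          · intro i _ hi
            have : ¬ i < L + 1 := by simpa using hi
            simp [hB0 i this]
        rw [this, Finset.sum_range]
        simp only [B, Fin.is_lt, dite_true, eval_finsetSum, eval_mul, eval_C, eval_pow, eval_X]
        rw [Fintype.sum_prod_type]
        conv_lhs => rw [hQ, sum_pow_char_pow]
        simp only [← hQ, mul_pow, ← pow_mul]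
        refine Finset.sum_congr rfl fun i _ => ?_
        conv_lhs => rw [hQ, sum_pow_char_pow]
        simp only [← hQ, mul_pow]
        rw [Finset.sum_mul]
        refine Finset.sum_congr rfl fun j _ => ?_
        rw [hq, mul_assoc (i.1), ← sq, mul_comm i.1, pow_mul y (Q^2), ← hcard, FiniteField.pow_card,
          ← pow_mul, pow_add, mul_assoc, mul_comm Q]
      rw [hh, eval_add, eval_mul, eval_pow]
      conv_lhs => rw [hQ, add_pow_char_pow]
      rw [← hQ, mul_pow, sA, sB, hFr]
      rw [stepMap_apply]
      rw [eval_sub, eval_mul, eval_pow]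
      ring
    rw [hΦ, eval_zero] at hpow
    exact pow_eq_zero_iff hQ0.ne' |>.1 hpow
  calc _ ≤ h.roots.toFinset.card := Finset.card_le_card hroot
    _ ≤ Multiset.card h.roots := Multiset.toFinset_card_le _
    _ ≤ h.natDegree := card_roots' h
    _ ≤ _ := hdeg

end Weil

end PartA3

section PartA4

open Polynomial

namespace Weil

lemma seq_bound {s P : ℝ} (hP : 0 < P) {t : ℕ → ℝ} (h1 : t 1 = s) (h2 : t 2 = 2 * P - s ^ 2)
    (h3 : ∀ n, t (n + 3) = -s * t (n + 2) - P * t (n + 1)) :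
    (∀ m, 1 ≤ m → t (2 * m) ≤ 2 * P ^ m) ∧
    (4 * P < s ^ 2 → ∃ ρ, P < ρ ∧ ∀ m, 1 ≤ m → t (2 * m) ≤ - ρ ^ m) := by
  have key : ∀ α β : ℂ, α + β = -s → α * β = P → ∀ n, ((t (n + 1) : ℝ) : ℂ) = -(α ^ (n + 1) + β ^ (n + 1)) ∧
      ((t (n + 2) : ℝ) : ℂ) = -(α ^ (n + 2) + β ^ (n + 2)) := by
    intro α β ha hb n
    have hs : (s : ℂ) = -(α + β) := by rw [ha]; ring
    induction n with
    | zero =>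
      constructor
      · rw [h1, hs]; ring
      · rw [h2]; push_cast; rw [← hb, hs]; ring
    | succ n ih =>
      refine ⟨ih.2, ?_⟩
      rw [show n + 1 + 2 = n + 3 by ring, h3]
      push_cast
      rw [ih.1, ih.2, ← hb, hs]
      ring
  rcases le_or_gt (s ^ 2) (4 * P) with hle | hgt
  · refine ⟨?_, fun h => absurd h (not_lt.2 hle)⟩
    set d := Real.sqrt (4 * P - s ^ 2) with hd
    have hd2 : d ^ 2 = 4 * P - s ^ 2 := Real.sq_sqrt (by linarith)
    have hd2c : (d : ℂ) ^ 2 = 4 * P - s ^ 2 := by exact_mod_cast hd2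
    set α : ℂ := ⟨-s / 2, d / 2⟩ with hα
    set β : ℂ := ⟨-s / 2, -(d / 2)⟩ with hβ
    have n1 : ‖α‖ ^ 2 = P := by
      rw [Complex.sq_norm, Complex.normSq_apply]; simp [hα]; nlinarith
    have n2 : ‖β‖ ^ 2 = P := by
      rw [Complex.sq_norm, Complex.normSq_apply]; simp [hβ]; nlinarith
    intro m hm
    obtain ⟨n, hn⟩ : ∃ n, 2 * m = n + 2 := ⟨2 * m - 2, by omega⟩
    have := (key α β (by apply Complex.ext <;> simp [hα, hβ])
      (by apply Complex.ext <;> simp [hα, hβ] <;> nlinarith) n).2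
    rw [← hn] at this
    calc t (2 * m) ≤ ‖((t (2 * m) : ℝ) : ℂ)‖ := by
          rw [Complex.norm_real]; exact le_abs_self _
      _ ≤ ‖α ^ (2 * m)‖ + ‖β ^ (2 * m)‖ := by rw [this, norm_neg]; exact norm_add_le _ _
      _ = 2 * P ^ m := by rw [norm_pow, norm_pow, pow_mul, pow_mul, n1, n2]; ring
  · set d := Real.sqrt (s ^ 2 - 4 * P) with hd
    have hd2 : d ^ 2 = s ^ 2 - 4 * P := Real.sq_sqrt (by linarith)
    have hd0 : 0 < d := Real.sqrt_pos.2 (by linarith)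
    set α : ℝ := (-s + d) / 2 with hα
    set β : ℝ := (-s - d) / 2 with hβ
    have hE : ∀ m, 1 ≤ m → t (2 * m) = -((α ^ 2) ^ m + (β ^ 2) ^ m) := by
      intro m hm
      obtain ⟨n, hn⟩ : ∃ n, 2 * m = n + 2 := ⟨2 * m - 2, by omega⟩
      have := (key α β (by rw [hα, hβ]; push_cast; ring)
        (by norm_cast; rw [hα, hβ]; linarith [hd2]) n).2
      rw [← hn] at this
      rw [← pow_mul, ← pow_mul]
      exact_mod_cast this
    have hmul : α * β = P := by rw [hα, hβ]; linarith [hd2]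
    refine ⟨?_, fun _ => ?_⟩
    · intro m hm
      rw [hE m hm]
      have a1 : 0 ≤ (α ^ 2) ^ m := by positivity
      have a2 : 0 ≤ (β ^ 2) ^ m := by positivity
      have a3 : 0 < P ^ m := by positivity
      linarith
    · have hne : α ≠ β := by rw [hα, hβ]; intro h; linarith
      have hp2 : α ^ 2 * β ^ 2 = P ^ 2 := by rw [← hmul]; ring
      have hb2 : 0 < β ^ 2 := by
        have : β ≠ 0 := by rintro h; rw [h] at hmul; linarith
        positivity
      have ha2 : 0 < α ^ 2 := by
        have : α ≠ 0 := by rintro h; rw [h] at hmul; linarith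
        positivity
      by_cases hc : P < α ^ 2
      · refine ⟨α ^ 2, hc, fun m hm => ?_⟩
        rw [hE m hm]
        have a2 : 0 ≤ (β ^ 2) ^ m := by positivity
        linarith
      · refine ⟨β ^ 2, ?_, fun m hm => ?_⟩
        · push Not at hc
          by_contra hc'
          push Not at hc'
          have : α ^ 2 + β ^ 2 ≤ 2 * P := by linarith
          have h5 : 0 < (α - β) ^ 2 := by
            have : α - β ≠ 0 := sub_ne_zero.2 hne
            positivity
          nlinarith
        · rw [hE m hm]
          have a2 : 0 ≤ (α ^ 2) ^ m := by positivity
          linarith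

section count

variable {p : ℕ} [Fact p.Prime] {E : Type*} [Field E] [Fintype E] [DecidableEq E] [CharP E p]

lemma count_lower {m : ℕ} (hp : 3 ≤ p) (hm : 2 ≤ m) (hcard : Fintype.card E = (p ^ m) ^ 2) (b : E)
    (hb : b ≠ 0) :
    ((p : ℤ) ^ m) ^ 2 - 2 * p * (p : ℤ) ^ m - 2 * p ≤
      ∑ y : E, ((Finset.univ.filter (fun x : E => x ^ 2 - (y ^ p - y) * x + b = 0)).card : ℤ) := by
  have hpp : p.Prime := Fact.out
  have hodd : p % 2 = 1 := by
    rcases hpp.eq_two_or_odd with h | h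
    · omega
    · exact h
  have hrc : ringChar E ≠ 2 := by
    rw [ringChar.eq E p]; omega
  have h2 : (2 : E) ≠ 0 := Ring.two_ne_zero hrc
  set Q := p ^ m with hQ
  have hQodd : Q % 2 = 1 := by
    rw [hQ, Nat.pow_mod, hodd]; simp
  have hQbig : 2 * p + 1 ≤ Q := by
    have : p ^ 2 ≤ p ^ m := Nat.pow_le_pow_right (by omega) hm
    nlinarith
  obtain ⟨L, hL⟩ : ∃ L, 2 * L + 1 = Q := ⟨Q / 2, by omega⟩
  set w : E[X] := X ^ p - X with hw
  set F : E[X] := w ^ 2 - C (4 * b) with hF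
  have hwd : w.natDegree = p := FiniteField.X_pow_card_sub_X_natDegree_eq E hpp.one_lt
  have hFd : F.natDegree = 2 * p := by
    rw [hF, natDegree_sub_C, natDegree_pow, hwd]
  have h4b : 4 * b ≠ 0 := by
    have : (4 : E) = 2 * 2 := by norm_num
    rw [this]; simp [h2, hb]
  have hcop : F.Separable := by
    rw [Separable]
    have hd : derivative F = -2 * w := by
      rw [hF, derivative_sub, derivative_C, derivative_pow, hw, derivative_sub, derivative_X_pow,
        derivative_X]
      simp
      left
      exact map_ofNat C 2
    rw [hd]
    refine ⟨-C ((4 * b)⁻¹), - C ((4 * b)⁻¹) * C (2⁻¹) * w, ?_⟩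
    have e1 : C ((4 * b)⁻¹) * C (4 * b) = 1 := by rw [← C_mul, inv_mul_cancel₀ h4b, C_1]
    have e2 : C (2⁻¹ : E) * 2 = 1 := by
      have : (2 : E[X]) = C 2 := (map_ofNat C 2).symm
      rw [this, ← C_mul, inv_mul_cancel₀ h2, C_1]
    rw [hF]
    linear_combination e1 + C ((4 * b)⁻¹) * w ^ 2 * e2
  have hF0 : F.eval 0 ≠ 0 := by
    have : F.eval 0 = -(4 * b) := by simp [hF, hw, hpp.ne_zero]
    rw [this]; exact neg_ne_zero.2 h4b
  have hu : ¬ IsUnit F := by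
    intro h
    have := natDegree_eq_zero_of_isUnit h
    have := hpp.pos
    omega
  have hst := stepanov (p := p) hQ hcard (r := L + 1) (by omega) hL (e := p) (by omega) hcop.squarefree hu hF0 hFd.le
  have hev : ∀ y : E, F.eval y = (y ^ p - y) ^ 2 - 4 * b := by
    intro y; simp [hF, hw]
  -- count
  have hcnt : ∀ y : E, ((Finset.univ.filter (fun x : E => x ^ 2 - (y ^ p - y) * x + b = 0)).card : ℤ) =
      quadraticChar E (F.eval y) + 1 := by
    intro y
    rw [← quadraticChar_card_sqrts hrc]
    norm_cast
    apply Finset.card_bij' (fun x _ => 2 * x - (y ^ p - y)) (fun z _ => (z + (y ^ p - y)) / 2)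
    · intro x hx
      simp only [Finset.mem_filter, Finset.mem_univ, true_and, Set.mem_toFinset, Set.mem_ofPred_eq] at hx ⊢
      rw [hev]
      linear_combination 4 * hx
    · intro z hz
      simp only [Finset.mem_filter, Finset.mem_univ, true_and, Set.mem_toFinset, Set.mem_ofPred_eq] at hz ⊢
      rw [hev] at hz
      field_simp
      linear_combination hz
    · intro x _
      field_simp
      ring
    · intro z _
      field_simp
      ring
  have hlow : ∀ y : E, (2 : ℤ) - 2 * (if F.eval y ^ ((Q ^ 2 - 1) / 2) = -1 then 1 else 0) -
      (if F.eval y = 0 then 1 else 0) ≤ quadraticChar E (F.eval y) + 1 := by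
    intro y
    have hq2 : Fintype.card E / 2 = (Q ^ 2 - 1) / 2 := by
      rw [hcard]
      have : Q ^ 2 % 2 = 1 := by rw [Nat.pow_mod, hQodd]
      omega
    by_cases h0 : F.eval y = 0
    · rw [h0, quadraticChar_zero, if_pos rfl]
      split_ifs <;> norm_num
    · rw [if_neg h0]
      rcases quadraticChar_dichotomy h0 with h | h
      · rw [h]; split_ifs <;> norm_num
      · rw [h, if_pos]
        · norm_num
        · have := quadraticChar_eq_pow_of_char_ne_two' hrc (F.eval y)
          rw [h, hq2] at this
          rw [← this]; simp
  have hz : (Finset.univ.filter (fun y : E => F.eval y = 0)).card ≤ 2 * p := by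
    have hFne : F ≠ 0 := hcop.ne_zero
    calc _ ≤ F.roots.toFinset.card := by
          apply Finset.card_le_card
          intro y hy
          simp only [Finset.mem_filter, Finset.mem_univ, true_and] at hy
          rw [Multiset.mem_toFinset, mem_roots hFne]; exact hy
      _ ≤ Multiset.card F.roots := Multiset.toFinset_card_le _
      _ ≤ F.natDegree := card_roots' F
      _ = _ := hFd
  have hQc : ((p : ℤ) ^ m) = ((Q : ℕ) : ℤ) := by rw [hQ]; push_cast; rfl
  rw [hQc]
  calc ((Q : ℕ) : ℤ) ^ 2 - 2 * p * (Q : ℕ) - 2 * p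
      ≤ ∑ y : E, ((2 : ℤ) - 2 * (if F.eval y ^ ((Q ^ 2 - 1) / 2) = -1 then 1 else 0) -
      (if F.eval y = 0 then 1 else 0)) := by
        rw [Finset.sum_sub_distrib, Finset.sum_sub_distrib, ← Finset.mul_sum, Finset.sum_boole,
          Finset.sum_boole, Finset.sum_const, Finset.card_univ, hcard]
        have h1 : ((Finset.univ.filter (fun y : E => F.eval y ^ ((Q ^ 2 - 1) / 2) = -1)).card : ℤ) ≤
          L + (L + p) * Q := by exact_mod_cast hst
        have h2 : ((Finset.univ.filter (fun y : E => F.eval y = 0)).card : ℤ) ≤ 2 * p := by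
          exact_mod_cast hz
        have h3 : (2 : ℤ) * L + 1 = Q := by exact_mod_cast hL
        simp only [nsmul_eq_mul]
        push_cast
        nlinarith
    _ ≤ _ := by
        apply Finset.sum_le_sum
        intro y _
        rw [hcnt]
        exact hlow y

end count

end Weil

end PartA4

section PartA4b

open Polynomial

namespace Weil

variable {p : ℕ} [Fact p.Prime]

lemma LT_one_eq (ψ : AddChar (ZMod p) ℂ) (b : ZMod p) :
    LT ψ b 1 = ∑ x : ZMod p, if x = 0 then 0 else ψ (x + b * x⁻¹) := by
  have := LT_eq (E := ZMod p) ψ b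
  rw [Module.finrank_self] at this
  rw [this]
  simp

lemma LT_one_im (ψ : AddChar (ZMod p) ℂ) (b : ZMod p) : (LT ψ b 1).im = 0 := by
  rw [← Complex.conj_eq_iff_im, LT_one_eq, map_sum]
  refine Fintype.sum_equiv (Equiv.neg _) _ _ (fun x => ?_)
  by_cases h : x = 0
  · simp [h]
  · simp only [h, if_false, Equiv.neg_apply, neg_eq_zero]
    rw [← AddChar.map_neg_eq_conj, neg_add, inv_neg, mul_neg]

lemma LT_im {ψ : AddChar (ZMod p) ℂ} (hψ : ψ ≠ 1) {b : ZMod p} (hb : b ≠ 0) (n : ℕ) :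
    (LT ψ b (n + 1)).im = 0 ∧ (LT ψ b (n + 2)).im = 0 := by
  induction n with
  | zero =>
    refine ⟨LT_one_im ψ b, ?_⟩
    rw [LT_two hψ hb]
    simp [sq, LT_one_im ψ b, ZMod.card]
  | succ n ih =>
    refine ⟨ih.2, ?_⟩
    rw [show n + 1 + 2 = n + 3 by ring, LT_rec hψ hb]
    simp [LT_one_im ψ b, ih.1, ih.2]

lemma LT_seq {ψ : AddChar (ZMod p) ℂ} (hψ : ψ ≠ 1) {b : ZMod p} (hb : b ≠ 0) :
    (∀ m, 1 ≤ m → (LT ψ b (2 * m)).re ≤ 2 * (p : ℝ) ^ m) ∧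
    (4 * (p : ℝ) < (LT ψ b 1).re ^ 2 → ∃ ρ, (p : ℝ) < ρ ∧ ∀ m, 1 ≤ m → (LT ψ b (2 * m)).re ≤ - ρ ^ m) := by
  have hp : (0 : ℝ) < p := by exact_mod_cast (Fact.out : p.Prime).pos
  apply seq_bound (t := fun n => (LT ψ b n).re) hp rfl
  · rw [LT_two hψ hb]
    simp [sq, LT_one_im ψ b, ZMod.card]
  · intro n
    rw [LT_rec hψ hb]
    simp [LT_one_im ψ b, ZMod.card]

lemma trace_frob {E : Type*} [Field E] [Fintype E] [Algebra (ZMod p) E] (y : E) :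
    Algebra.trace (ZMod p) E (y ^ p) = Algebra.trace (ZMod p) E y := by
  have hc : CharP E p := charP_of_injective_algebraMap (algebraMap (ZMod p) E).injective p
  have := Algebra.trace_eq_of_algEquiv (FiniteField.frobeniusAlgEquivOfAlgebraic (ZMod p) E) y
  simpa [ZMod.card] using this

lemma sum_LT_aux {E : Type*} [Field E] [Fintype E] [Algebra (ZMod p) E] {m : ℕ}
    (hfr : Module.finrank (ZMod p) E = 2 * m) (hcard : Fintype.card E = (p ^ m) ^ 2)
    (hp : 3 ≤ p) (hm : 2 ≤ m) {ψ : AddChar (ZMod p) ℂ} (hψ : ψ ≠ 1) {b : ZMod p}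
    (hb : b ≠ 0) :
    -(4 * (p : ℝ) * (p : ℝ) ^ m) ≤ ∑ c ∈ (Finset.univ : Finset (ZMod p)).erase 0,
      (LT (ψ.mulShift c) b (2 * m)).re := by
  classical
  have hpp : p.Prime := Fact.out
  have hcp : CharP E p := charP_of_injective_algebraMap (algebraMap (ZMod p) E).injective p
  set bE : E := algebraMap (ZMod p) E b with hbE
  have hbE0 : bE ≠ 0 := by simpa [hbE] using hb
  set T : E → ZMod p := fun x => Algebra.trace (ZMod p) E (x + bE * x⁻¹) with hT
  have hLT : ∀ c, LT (ψ.mulShift c) b (2 * m) = ∑ x : E, if x = 0 then 0 else ψ (c * T x) := by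
    intro c
    rw [← hfr, LT_eq (E := E)]
    rfl
  set N0 := (Finset.univ.filter (fun x : E => x ≠ 0 ∧ T x = 0)).card with hN0
  have hprim : ψ.IsPrimitive := AddChar.IsPrimitive.of_ne_one hψ
  have hsum : ∑ c : ZMod p, LT (ψ.mulShift c) b (2 * m) = p * N0 := by
    simp only [hLT]
    rw [Finset.sum_comm]
    have : ∀ x : E, (∑ c : ZMod p, if x = 0 then 0 else ψ (c * T x)) =
        if x ≠ 0 ∧ T x = 0 then (p : ℂ) else 0 := by
      intro x
      by_cases hx : x = 0
      · simp [hx]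
      · simp only [hx, if_false, ne_eq, not_false_eq_true, true_and]
        rw [AddChar.sum_mulShift _ hprim, ZMod.card]
        split_ifs <;> simp
    simp only [this]
    rw [← Finset.sum_filter, Finset.sum_const, nsmul_eq_mul, mul_comm]
  have h0 : LT (ψ.mulShift 0) b (2 * m) = ((p : ℂ) ^ m) ^ 2 - 1 := by
    rw [hLT]
    simp only [zero_mul, AddChar.map_zero_eq_one]
    have : ∀ x : E, (if x = 0 then (0 : ℂ) else 1) = 1 - if x = 0 then 1 else 0 := by
      intro x; split_ifs <;> simp
    simp only [this]
    rw [Finset.sum_sub_distrib]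
    simp [hcard]
  -- combinatorial bound
  have hcomb : (∑ y : E, ((Finset.univ.filter (fun x : E => x ^ 2 - (y ^ p - y) * x + bE = 0)).card)) ≤
      p * N0 := by
    have h1 : ∀ y : E, (Finset.univ.filter (fun x : E => x ^ 2 - (y ^ p - y) * x + bE = 0)).card =
        ∑ x : E, if x ^ 2 - (y ^ p - y) * x + bE = 0 then 1 else 0 := by
      intro y; rw [Finset.card_filter]
    simp only [h1]
    rw [Finset.sum_comm]
    have h2 : ∀ x : E, (∑ y : E, if x ^ 2 - (y ^ p - y) * x + bE = 0 then 1 else 0) ≤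
        if x ≠ 0 ∧ T x = 0 then p else 0 := by
      intro x
      rw [← Finset.card_filter]
      have hx : ∀ y : E, x ^ 2 - (y ^ p - y) * x + bE = 0 → x ≠ 0 ∧ y ^ p - y = x + bE * x⁻¹ := by
        intro y hy
        have hx0 : x ≠ 0 := by
          rintro rfl
          apply hbE0
          simpa using hy
        refine ⟨hx0, ?_⟩
        field_simp
        linear_combination -hy
      split_ifs with hc
      · set w : E[X] := X ^ p - X - C (x + bE * x⁻¹) with hw
        have hwd : w.natDegree = p := by
          rw [hw, natDegree_sub_C]
          exact FiniteField.X_pow_card_sub_X_natDegree_eq E hpp.one_lt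
        have hw0 : w ≠ 0 := by
          intro h; rw [h, natDegree_zero] at hwd; omega
        calc _ ≤ w.roots.toFinset.card := by
              apply Finset.card_le_card
              intro y hy
              simp only [Finset.mem_filter, Finset.mem_univ, true_and] at hy
              rw [Multiset.mem_toFinset, mem_roots hw0, IsRoot, hw]
              simp only [eval_sub, eval_pow, eval_X, eval_C]
              rw [(hx y hy).2, sub_self]
          _ ≤ Multiset.card w.roots := Multiset.toFinset_card_le _
          _ ≤ w.natDegree := card_roots' w
          _ = _ := hwd
      · rw [Nat.le_zero, Finset.card_eq_zero, Finset.filter_eq_empty_iff]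
        intro y _ hy
        apply hc
        refine ⟨(hx y hy).1, ?_⟩
        rw [hT]
        simp only
        rw [← (hx y hy).2, map_sub, trace_frob, sub_self]
    refine (Finset.sum_le_sum fun x _ => h2 x).trans ?_
    rw [← Finset.sum_filter, Finset.sum_const, smul_eq_mul, mul_comm]
  have hlow := count_lower (E := E) hp hm hcard bE hbE0
  have hlow2 : ((p : ℝ) ^ m) ^ 2 - 2 * p * (p : ℝ) ^ m - 2 * p ≤ p * N0 := by
    have : ((p : ℤ) ^ m) ^ 2 - 2 * p * (p : ℤ) ^ m - 2 * p ≤ p * N0 := by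
      refine hlow.trans ?_
      exact_mod_cast hcomb
    exact_mod_cast this
  have hre : ∑ c ∈ (Finset.univ : Finset (ZMod p)).erase 0, (LT (ψ.mulShift c) b (2 * m)).re =
      p * N0 - (((p : ℝ) ^ m) ^ 2 - 1) := by
    have h1 := congrArg Complex.re hsum
    rw [Complex.re_sum, ← Finset.add_sum_erase _ _ (Finset.mem_univ (0 : ZMod p)), h0] at h1
    have h2 : (((p : ℂ) ^ m) ^ 2 - 1).re = ((p : ℝ) ^ m) ^ 2 - 1 := by
      have : ((p : ℂ) ^ m) ^ 2 - 1 = ((((p : ℝ) ^ m) ^ 2 - 1 : ℝ) : ℂ) := by push_cast; rfl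
      rw [this, Complex.ofReal_re]
    have h3 : ((p : ℂ) * N0).re = (p : ℝ) * N0 := by
      have : (p : ℂ) * N0 = (((p : ℝ) * N0 : ℝ) : ℂ) := by push_cast; rfl
      rw [this, Complex.ofReal_re]
    rw [h2, h3] at h1
    linarith
  rw [hre]
  have hp1 : (1 : ℝ) ≤ p := by exact_mod_cast hpp.one_le
  have : (1 : ℝ) ≤ (p : ℝ) ^ m := one_le_pow₀ hp1
  nlinarith

lemma sum_LT {m : ℕ} (hp : 3 ≤ p) (hm : 2 ≤ m) {ψ : AddChar (ZMod p) ℂ} (hψ : ψ ≠ 1) {b : ZMod p}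
    (hb : b ≠ 0) :
    -(4 * (p : ℝ) * (p : ℝ) ^ m) ≤ ∑ c ∈ (Finset.univ : Finset (ZMod p)).erase 0,
      (LT (ψ.mulShift c) b (2 * m)).re := by
  let _ : Fintype (GaloisField p (2 * m)) := Fintype.ofFinite _
  refine sum_LT_aux (E := GaloisField p (2 * m)) (GaloisField.finrank p (by omega)) ?_ hp hm hψ hb
  rw [← Nat.card_eq_fintype_card, GaloisField.card p _ (by omega), ← pow_mul, mul_comm]

lemma weil_sq (hp : 3 ≤ p) {ψ : AddChar (ZMod p) ℂ} (hψ : ψ ≠ 1) {b : ZMod p} (hb : b ≠ 0) :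
    (LT ψ b 1).re ^ 2 ≤ 4 * p := by
  by_contra hcon
  push Not at hcon
  obtain ⟨ρ, hρ, hρ2⟩ := (LT_seq hψ hb).2 hcon
  have hpp : p.Prime := Fact.out
  have hp0 : (0 : ℝ) < p := by exact_mod_cast hpp.pos
  have hprim : ψ.IsPrimitive := AddChar.IsPrimitive.of_ne_one hψ
  have hbound : ∀ m, 2 ≤ m → ρ ^ m ≤ 6 * p * (p : ℝ) ^ m := by
    intro m hm
    have h1 := sum_LT hp hm hψ hb
    have hmem : (1 : ZMod p) ∈ (Finset.univ : Finset (ZMod p)).erase 0 := by simp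
    rw [← Finset.add_sum_erase _ _ hmem, AddChar.mulShift_one] at h1
    have h2 := hρ2 m (by omega)
    have h3 : ∑ c ∈ ((Finset.univ : Finset (ZMod p)).erase 0).erase 1,
        (LT (ψ.mulShift c) b (2 * m)).re ≤ p * (2 * (p : ℝ) ^ m) := by
      refine (Finset.sum_le_sum (g := fun _ => 2 * (p : ℝ) ^ m) ?_).trans ?_
      · intro c hc
        have hc0 : c ≠ 0 := by simp at hc; exact hc.2
        exact (LT_seq (hprim hc0) hb).1 m (by omega)
      · rw [Finset.sum_const, nsmul_eq_mul]
        gcongr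
        have := Finset.card_le_univ (((Finset.univ : Finset (ZMod p)).erase 0).erase 1)
        rwa [ZMod.card] at this
    linarith
  have hr : 1 < ρ / p := by rwa [one_lt_div hp0]
  obtain ⟨m, hm⟩ := pow_unbounded_of_one_lt (6 * (p : ℝ)) hr
  have h1 := hbound (m + 2) (by omega)
  have h2 : (ρ / p) ^ m ≤ (ρ / p) ^ (m + 2) := pow_le_pow_right₀ hr.le (by omega)
  have h3 : (ρ / p) ^ (m + 2) ≤ 6 * p := by
    rw [div_pow, div_le_iff₀ (by positivity)]
    exact h1
  linarith

lemma weil {ψ : AddChar (ZMod p) ℂ} (hψ : ψ ≠ 1) {b : ZMod p} (hb : b ≠ 0) :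
    ‖∑ x : ZMod p, if x = 0 then 0 else ψ (x + b * x⁻¹)‖ ≤ 2 * Real.sqrt p := by
  have hpp : p.Prime := Fact.out
  rcases Nat.lt_or_ge p 3 with h | h
  · have hp2 : p = 2 := by have := hpp.two_le; omega
    subst hp2
    refine (norm_sum_le _ _).trans ?_
    have : ∀ x : ZMod 2, ‖if x = 0 then 0 else ψ (x + b * x⁻¹)‖ ≤ 1 := by
      intro x; split_ifs <;> simp
    refine (Finset.sum_le_sum fun x _ => this x).trans ?_
    simp only [Finset.sum_const, Finset.card_univ, ZMod.card, nsmul_eq_mul]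
    have : (1 : ℝ) ≤ Real.sqrt (2 : ℕ) := by
      rw [Real.one_le_sqrt]; norm_num
    push_cast at *
    linarith
  · rw [← LT_one_eq]
    have h1 := weil_sq h hψ hb
    have h2 : LT ψ b 1 = (((LT ψ b 1).re : ℝ) : ℂ) := by
      apply Complex.ext <;> simp [LT_one_im]
    rw [h2, Complex.norm_real, Real.norm_eq_abs]
    apply abs_le_of_sq_le_sq
    · rw [mul_pow, Real.sq_sqrt (by positivity)]; linarith
    · positivity

end Weil

end PartA4b

section PartA5

namespace Weil

/-- Kloosterman sum for a general additive character. -/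
noncomputable def KS {R : Type*} [CommRing R] [Fintype Rˣ] (ψ : AddChar R ℂ) (b : R) : ℂ :=
  ∑ u : Rˣ, ψ (u + b * (u⁻¹ : Rˣ))

lemma KS_prime {p : ℕ} [Fact p.Prime] {ψ : AddChar (ZMod p) ℂ} (hψ : ψ ≠ 1) {b : ZMod p} (hb : b ≠ 0) :
    ‖KS ψ b‖ ≤ 2 * Real.sqrt p := by
  have : KS ψ b = ∑ x : ZMod p, if x = 0 then 0 else ψ (x + b * x⁻¹) := by
    rw [KS]
    have h1 : (∑ x : ZMod p, if x = 0 then 0 else ψ (x + b * x⁻¹)) =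
        ∑ x ∈ Finset.univ.filter (fun x : ZMod p => x ≠ 0), ψ (x + b * x⁻¹) := by
      rw [Finset.sum_filter]
      refine Finset.sum_congr rfl fun x _ => ?_
      by_cases h : x = 0 <;> simp [h]
    rw [h1]
    refine Finset.sum_bij (fun u _ => (u : ZMod p)) ?_ ?_ ?_ ?_
    · intro u _; simp
    · intro u _ v _ h; exact Units.ext h
    · intro x hx
      simp only [Finset.mem_filter, Finset.mem_univ, true_and] at hx
      exact ⟨Units.mk0 x hx, Finset.mem_univ _, rfl⟩
    · intro u _
      rw [Units.val_inv_eq_inv_val]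
  rw [this]
  exact weil hψ hb

lemma KS_mul {p m : ℕ} [NeZero p] [NeZero m] (hc : p.Coprime m) [NeZero (p * m)]
    {ψ : AddChar (ZMod (p * m)) ℂ} (hψ : ψ.IsPrimitive) {b : ZMod (p * m)} (hb : IsUnit b) :
    ∃ (ψ₁ : AddChar (ZMod p) ℂ) (ψ₂ : AddChar (ZMod m) ℂ) (b₁ : ZMod p) (b₂ : ZMod m),
      ψ₁.IsPrimitive ∧ ψ₂.IsPrimitive ∧ IsUnit b₁ ∧ IsUnit b₂ ∧ KS ψ b = KS ψ₁ b₁ * KS ψ₂ b₂ := by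
  set e := ZMod.chineseRemainder hc with he
  set ψ₁ : AddChar (ZMod p) ℂ :=
    { toFun := fun x => ψ (e.symm (x, 0))
      map_zero_eq_one' := by
        rw [show ((0 : ZMod p), (0 : ZMod m)) = 0 from rfl, map_zero, AddChar.map_zero_eq_one]
      map_add_eq_mul' := by
        intro x y
        rw [← AddChar.map_add_eq_mul, ← map_add]; simp } with hψ₁
  set ψ₂ : AddChar (ZMod m) ℂ :=
    { toFun := fun x => ψ (e.symm (0, x))
      map_zero_eq_one' := by
        rw [show ((0 : ZMod p), (0 : ZMod m)) = 0 from rfl, map_zero, AddChar.map_zero_eq_one]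
      map_add_eq_mul' := by
        intro x y
        rw [← AddChar.map_add_eq_mul, ← map_add]; simp } with hψ₂
  have h1 : ∀ x, ψ₁ x = ψ (e.symm (x, 0)) := fun x => rfl
  have h2 : ∀ x, ψ₂ x = ψ (e.symm (0, x)) := fun x => rfl
  have h12 : ∀ x, ψ x = ψ₁ (e x).1 * ψ₂ (e x).2 := by
    intro x
    rw [h1, h2, ← AddChar.map_add_eq_mul, ← map_add]
    simp
  refine ⟨ψ₁, ψ₂, (e b).1, (e b).2, ?_, ?_, ?_, ?_, ?_⟩
  · intro a ha h
    have hne : e.symm (a, 0) ≠ 0 := by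
      intro h0
      rw [EmbeddingLike.map_eq_zero_iff] at h0
      exact ha (congrArg Prod.fst h0)
    apply hψ hne
    ext z
    have := DFunLike.congr_fun h (e z).1
    rw [AddChar.mulShift_apply, h1, AddChar.one_apply] at this
    rw [AddChar.mulShift_apply, AddChar.one_apply, ← this]
    congr 1
    apply e.injective
    simp [Prod.ext_iff]
  · intro a ha h
    have hne : e.symm (0, a) ≠ 0 := by
      intro h0
      rw [EmbeddingLike.map_eq_zero_iff] at h0
      exact ha (congrArg Prod.snd h0)
    apply hψ hne
    ext z
    have := DFunLike.congr_fun h (e z).2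
    rw [AddChar.mulShift_apply, h2, AddChar.one_apply] at this
    rw [AddChar.mulShift_apply, AddChar.one_apply, ← this]
    congr 1
    apply e.injective
    simp [Prod.ext_iff]
  · exact (hb.map e).map (RingHom.fst _ _)
  · exact (hb.map e).map (RingHom.snd _ _)
  · rw [KS, KS, KS, Finset.sum_mul_sum, ← Fintype.sum_prod_type']
    refine Fintype.sum_equiv ((Units.mapEquiv e.toMulEquiv).trans MulEquiv.prodUnits).toEquiv _ _ ?_
    intro u
    rw [h12]
    simp [map_add, map_mul]
    rfl

lemma KS_bound : ∀ (c : ℕ) [NeZero c] (_ : Squarefree c) {ψ : AddChar (ZMod c) ℂ} (_ : ψ.IsPrimitive)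
    {b : ZMod c} (_ : IsUnit b), ‖KS ψ b‖ ≤ 2 ^ c.primeFactors.card * Real.sqrt c := by
  intro c
  induction c using Nat.strong_induction_on with
  | _ c ih =>
  intro _ hc ψ hψ b hb
  rcases eq_or_ne c 1 with rfl | h1
  · have h : ‖KS ψ b‖ ≤ ∑ u : (ZMod 1)ˣ, 1 := by
      refine (norm_sum_le _ _).trans (Finset.sum_le_sum fun u _ => ?_)
      simp
    simpa using h
  · obtain ⟨p, hp, m, rfl⟩ := Nat.exists_prime_and_dvd h1
    have hcop : p.Coprime m := Nat.coprime_of_squarefree_mul hc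
    have : Fact p.Prime := ⟨hp⟩
    have hm0 : m ≠ 0 := by rintro rfl; simp at hc
    have : NeZero m := ⟨hm0⟩
    obtain ⟨ψ₁, ψ₂, b₁, b₂, p1, p2, u1, u2, heq⟩ := KS_mul hcop hψ hb
    have hlt : m < p * m := by
      have := hp.two_le
      have := Nat.pos_of_ne_zero hm0
      nlinarith
    have i2 := ih m hlt (hc.of_mul_right) p2 u2
    have i1 : ‖KS ψ₁ b₁‖ ≤ 2 * Real.sqrt p := by
      apply KS_prime
      · have := p1 (one_ne_zero)
        rwa [AddChar.mulShift_one] at this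
      · exact u1.ne_zero
    rw [heq, norm_mul, Nat.Coprime.primeFactors_mul hcop, Finset.card_union_of_disjoint (Nat.Coprime.disjoint_primeFactors hcop), hp.primeFactors, Finset.card_singleton]
    calc _ ≤ (2 * Real.sqrt p) * (2 ^ m.primeFactors.card * Real.sqrt m) := by gcongr
      _ = _ := by
        push_cast
        rw [Real.sqrt_mul (by positivity)]
        ring

lemma Kloosterman_eq (n : ℕ) [NeZero n] :
    Kloosterman 1 1 n = (KS (ZMod.stdAddChar (N := n)) 1).re := by
  rw [Kloosterman, KS, Complex.re_sum]
  symm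
  refine Finset.sum_bij (fun u _ => (u : ZMod n).val) ?_ ?_ ?_ ?_
  · intro u _
    simp only [Finset.mem_filter, Finset.mem_range]
    exact ⟨ZMod.val_lt _, ZMod.val_coe_unit_coprime u⟩
  · intro u _ v _ h
    exact Units.ext (ZMod.val_injective n h)
  · intro a ha
    simp only [Finset.mem_filter, Finset.mem_range] at ha
    refine ⟨ZMod.unitOfCoprime a ha.2, Finset.mem_univ _, ?_⟩
    rw [ZMod.coe_unitOfCoprime, ZMod.val_natCast, Nat.mod_eq_of_lt ha.1]
  · intro u _
    have : (u : ZMod n) + 1 * ((u⁻¹ : (ZMod n)ˣ) : ZMod n) =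
        (((1 : ℤ) * ((u : ZMod n).val : ℕ) + 1 * ((((((u : ZMod n).val : ℕ) : ZMod n)⁻¹).val : ℕ) : ℤ) : ℤ) : ZMod n) := by
      push_cast
      simp
    rw [this, ZMod.stdAddChar_coe]
    congr 2
    ring

theorem Kloosterman_le (n : ℕ) (hn : Squarefree n) :
    |Kloosterman 1 1 n| ≤ 2 ^ n.primeFactors.card * Real.sqrt n := by
  have : NeZero n := ⟨hn.ne_zero⟩
  rw [Kloosterman_eq]
  refine (Complex.abs_re_le_norm _).trans ?_
  exact KS_bound n hn (ZMod.isPrimitive_stdAddChar n) isUnit_one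

end Weil

end PartA5

section PartB1

namespace Zb
open Complex

lemma cpow_hasDeriv {s : ℂ} {x : ℝ} (hx : 0 < x) :
    HasDerivAt (fun y : ℝ => (y : ℂ) ^ (-s)) (-s * (x : ℂ) ^ (-s - 1)) x := by
  have h := (hasDerivAt_id (x : ℂ)).cpow_const (c := -s) (by simp [Complex.slitPlane, hx])
  simpa using h.comp_ofReal

lemma cpow_norm {s : ℂ} {a x : ℝ} (ha : 0 < a) (hx : a ≤ x) (hs : 0 ≤ s.re) :
    ‖(x : ℂ) ^ (-s)‖ ≤ a ^ (-s.re) := by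
  rw [Complex.norm_cpow_eq_rpow_re_of_pos (ha.trans_le hx), Complex.neg_re]
  exact Real.rpow_le_rpow_of_nonpos ha hx (by linarith)

lemma cpow_diff1 {s : ℂ} {a x : ℝ} (ha : 0 < a) (hx : x ∈ Set.Icc a (a+1)) (hs : 0 ≤ s.re) :
    ‖(a : ℂ) ^ (-s) - (x : ℂ) ^ (-s)‖ ≤ 2 * a ^ (-s.re) := by
  have h1 := cpow_norm (s := s) ha hx.1 hs
  have h2 := cpow_norm (s := s) ha le_rfl hs
  have := norm_sub_le ((a : ℂ) ^ (-s)) ((x : ℂ) ^ (-s))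
  linarith

lemma cpow_diff2 {s : ℂ} {a x : ℝ} (ha : 0 < a) (hx : x ∈ Set.Icc a (a+1)) (hs : 0 ≤ s.re) :
    ‖(a : ℂ) ^ (-s) - (x : ℂ) ^ (-s)‖ ≤ ‖s‖ * a ^ (-s.re - 1) := by
  rw [norm_sub_rev]
  have := norm_image_sub_le_of_norm_deriv_le_segment' (f := fun y : ℝ => (y : ℂ) ^ (-s))
    (f' := fun y : ℝ => -s * (y : ℂ) ^ (-s - 1)) (C := ‖s‖ * a ^ (-s.re - 1)) (a := a) (b := a + 1)
    (fun y hy => (cpow_hasDeriv (ha.trans_le hy.1)).hasDerivWithinAt) (by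
      intro y hy
      rw [norm_mul, norm_neg]
      gcongr
      have := cpow_norm (s := s + 1) ha hy.1 (by simp; linarith)
      simpa [neg_add_rev, sub_eq_add_neg, add_comm] using this) x hx
  refine this.trans ?_
  have : x - a ≤ 1 := by linarith [hx.2]
  have h0 : 0 ≤ ‖s‖ * a ^ (-s.re - 1) := by positivity
  nlinarith

/-- interpolation -/
lemma cpow_diff {s : ℂ} {a x θ : ℝ} (ha : 0 < a) (hx : x ∈ Set.Icc a (a+1)) (hs : 0 ≤ s.re)
    (h0 : 0 ≤ θ) (h1 : θ ≤ 1) :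
    ‖(a : ℂ) ^ (-s) - (x : ℂ) ^ (-s)‖ ≤ 2 * ‖s‖ ^ θ * a ^ (-s.re - θ) := by
  have e : 2 * ‖s‖ ^ θ * a ^ (-s.re - θ) = 2 * a ^ (-s.re) * (‖s‖ / a) ^ θ := by
    rw [Real.div_rpow (norm_nonneg _) ha.le, Real.rpow_sub ha]
    ring
  rw [e]
  have hA : 0 < a ^ (-s.re) := by positivity
  rcases le_total 1 (‖s‖ / a) with h | h
  · refine (cpow_diff1 ha hx hs).trans ?_
    have := Real.one_le_rpow h h0
    nlinarith
  · refine (cpow_diff2 ha hx hs).trans ?_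
    rw [Real.rpow_sub ha, Real.rpow_one]
    have h2 : ‖s‖ / a ≤ (‖s‖ / a) ^ θ := by
      have h3 : 0 ≤ ‖s‖ / a := by positivity
      rcases h3.eq_or_lt with h4 | h4
      · rw [← h4]; exact Real.rpow_nonneg le_rfl _
      · simpa using Real.rpow_le_rpow_of_exponent_ge h4 h h1
    have h3 : 0 ≤ ‖s‖ / a := by positivity
    calc ‖s‖ * (a ^ (-s.re) / a) = a ^ (-s.re) * (‖s‖ / a) := by ring
      _ ≤ _ := by nlinarith

noncomputable def tt (n : ℕ) (s : ℂ) : ℂ :=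
  (s - 1) * ((n + 1 : ℝ) : ℂ) ^ (-s) + ((n + 1 + 1 : ℝ) : ℂ) ^ (1 - s) - ((n + 1 : ℝ) : ℂ) ^ (1 - s)

lemma tt_bound (n : ℕ) {s : ℂ} {θ : ℝ} (hs : 0 ≤ s.re) (h0 : 0 ≤ θ) (h1 : θ ≤ 1) :
    ‖tt n s‖ ≤ ‖s - 1‖ * (2 * ‖s‖ ^ θ * (n + 1 : ℝ) ^ (-s.re - θ)) := by
  have ha : (0 : ℝ) < n + 1 := by positivity
  set a : ℝ := n + 1 with hadef
  have hd : ∀ y ∈ Set.Icc a (a+1), HasDerivWithinAt (fun y : ℝ => (s - 1) * (a : ℂ) ^ (-s) * (y - a) + (y : ℂ) ^ (1 - s))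
      ((s - 1) * ((a : ℂ) ^ (-s) - (y : ℂ) ^ (-s))) (Set.Icc a (a+1)) y := by
    intro y hy
    have h2 := cpow_hasDeriv (s := s - 1) (ha.trans_le hy.1)
    have h3 : HasDerivAt (fun y : ℝ => (s - 1) * (a : ℂ) ^ (-s) * ((y : ℂ) - a)) ((s - 1) * (a : ℂ) ^ (-s) * 1) y :=
      (((hasDerivAt_id (y : ℂ)).comp_ofReal).sub_const _).const_mul _
    have h4 := (h3.add h2).hasDerivWithinAt (s := Set.Icc a (a+1))
    have e1 : -(s - 1) - 1 = -s := by ring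
    have e2 : -(s - 1) = 1 - s := by ring
    rw [e1, e2] at h4
    have e3 : (s - 1) * ((a : ℂ) ^ (-s) - (y : ℂ) ^ (-s)) = (s - 1) * (a : ℂ) ^ (-s) * 1 + (1 - s) * (y : ℂ) ^ (-s) := by
      ring
    rw [e3]
    exact h4
  have := norm_image_sub_le_of_norm_deriv_le_segment' hd
    (C := ‖s - 1‖ * (2 * ‖s‖ ^ θ * a ^ (-s.re - θ))) (by
      intro y hy
      rw [norm_mul]
      gcongr
      exact cpow_diff ha ⟨hy.1, hy.2.le⟩ hs h0 h1) (a + 1) (by simp)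
  convert this using 1
  · rw [tt, ← hadef]; push_cast; congr 1; ring
  · ring

lemma summable_rpow {e : ℝ} (he : e < -1) : Summable (fun n : ℕ => ((n : ℝ) + 1) ^ e) := by
  have := (summable_nat_add_iff 1).mpr (Real.summable_nat_rpow.mpr he)
  simpa using this

lemma tt_summable {s : ℂ} (hs : 0 < s.re) : Summable (fun n => tt n s) := by
  refine Summable.of_norm_bounded (g := fun n : ℕ => ‖s - 1‖ * (2 * ‖s‖ ^ (1:ℝ) * (n + 1 : ℝ) ^ (-s.re - 1))) ?_
    (fun n => tt_bound n hs.le zero_le_one le_rfl)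
  exact ((summable_rpow (by linarith)).mul_left _).mul_left _

lemma tt_tsum_of_one_lt {s : ℂ} (hs : 1 < s.re) : ∑' n, tt n s = riemannZeta₁ s - 1 := by
  have hs1 : s ≠ 1 := by rintro rfl; simp at hs
  have h1 : HasSum (fun n : ℕ => (s - 1) * ((n + 1 : ℝ) : ℂ) ^ (-s)) ((s - 1) * riemannZeta s) := by
    apply HasSum.mul_left
    rw [zeta_eq_tsum_one_div_nat_add_one_cpow hs]
    have : Summable (fun n : ℕ => 1 / ((n : ℂ) + 1) ^ s) := by
      have := (summable_nat_add_iff 1).mpr (Complex.summable_one_div_nat_cpow.mpr hs)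
      simpa using this
    have e : (fun n : ℕ => ((n + 1 : ℝ) : ℂ) ^ (-s)) = (fun n : ℕ => 1 / ((n : ℂ) + 1) ^ s) := by
      ext n
      push_cast
      rw [Complex.cpow_neg, one_div]
    rw [e]
    exact this.hasSum
  have h2 := (tt_summable (s := s) (by linarith)).sub h1.summable
  have h3 := h2.hasSum.tendsto_sum_nat
  have h4 : ∀ n : ℕ, ∑ i ∈ Finset.range n, (tt i s - (s - 1) * ((i + 1 : ℝ) : ℂ) ^ (-s)) =
      ((n + 1 : ℝ) : ℂ) ^ (1 - s) - 1 := by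
    intro n
    have := Finset.sum_range_sub (fun i : ℕ => ((i + 1 : ℝ) : ℂ) ^ (1 - s)) n
    simp only [Nat.cast_zero, zero_add, Complex.ofReal_one, Complex.one_cpow] at this
    rw [← this]
    refine Finset.sum_congr rfl fun i _ => ?_
    rw [tt]; push_cast; ring
  have h5 : Filter.Tendsto (fun n : ℕ => ((n + 1 : ℝ) : ℂ) ^ (1 - s)) Filter.atTop (nhds 0) := by
    rw [tendsto_zero_iff_norm_tendsto_zero]
    have : ∀ n : ℕ, ‖((n + 1 : ℝ) : ℂ) ^ (1 - s)‖ = ((n : ℝ) + 1) ^ (-(s.re - 1)) := by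
      intro n
      rw [Complex.norm_cpow_eq_rpow_re_of_pos (by positivity)]
      congr 1
      simp
    simp_rw [this]
    exact (tendsto_rpow_neg_atTop (by linarith)).comp (Filter.tendsto_atTop_add_const_right _ _ tendsto_natCast_atTop_atTop)
  have h6 : ∑' n, (tt n s - (s - 1) * ((n + 1 : ℝ) : ℂ) ^ (-s)) = -1 := by
    simp_rw [h4] at h3
    have := h5.sub_const 1
    rw [zero_sub] at this
    exact tendsto_nhds_unique h3 this
  rw [Summable.tsum_sub (tt_summable (by linarith)) h1.summable, h1.tsum_eq] at h6
  have h7 := riemannZeta_eq_inv_sub_mul hs1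
  have h8 : riemannZeta₁ s = (s - 1) * riemannZeta s := by
    rw [h7]; field_simp [sub_ne_zero.mpr hs1]
  rw [h8]; linear_combination h6

lemma tt_tsum {s : ℂ} (hs : 0 < s.re) : ∑' n, tt n s = riemannZeta₁ s - 1 := by
  set σ := min s.re 1 / 2 with hσ
  have hσ0 : 0 < σ := by positivity
  have hσ1 : σ < s.re := by have := min_le_left s.re 1; have := lt_min hs one_pos; linarith
  have hσ2 : σ < 2 := by have := min_le_right s.re 1; linarith
  set U : Set ℂ := {z | σ < z.re} ∩ Metric.ball 0 (‖s‖ + 3) with hU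
  have hUo : IsOpen U := (isOpen_lt continuous_const Complex.continuous_re).inter Metric.isOpen_ball
  have hUc : Convex ℝ U := (convex_halfSpace_re_gt σ).inter (convex_ball _ _)
  have hsU : s ∈ U := ⟨hσ1, by simp⟩
  have h2U : (2 : ℂ) ∈ U := ⟨by simpa using hσ2, by simp; linarith [norm_nonneg s]⟩
  have hd : DifferentiableOn ℂ (fun z => ∑' n, tt n z) U := by
    refine differentiableOn_tsum_of_summable_norm
      (u := fun n : ℕ => (‖s‖ + 4) * (2 * (‖s‖ + 3) ^ (1:ℝ) * (n + 1 : ℝ) ^ (-σ - 1))) ?_ ?_ hUo ?_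
    · exact ((summable_rpow (by linarith)).mul_left _).mul_left _
    · intro n z _
      apply DifferentiableAt.differentiableWithinAt
      unfold tt
      have h1 : ((n + 1 : ℝ) : ℂ) ≠ 0 := by exact_mod_cast (by positivity : (n + 1 : ℝ) ≠ 0)
      have h2 : ((n + 1 + 1 : ℝ) : ℂ) ≠ 0 := by exact_mod_cast (by positivity : (n + 1 + 1 : ℝ) ≠ 0)
      refine (((differentiableAt_id.sub_const _).mul ?_).add ?_).sub ?_
      · exact (differentiableAt_id.neg).const_cpow (Or.inl h1)
      · exact (differentiableAt_id.const_sub _).const_cpow (Or.inl h2)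
      · exact (differentiableAt_id.const_sub _).const_cpow (Or.inl h1)
    · intro n z hz
      have hz1 : σ < z.re := hz.1
      have hz2 : ‖z‖ < ‖s‖ + 3 := by simpa using hz.2
      refine (tt_bound n (θ := 1) (by linarith) zero_le_one le_rfl).trans ?_
      have : ‖z - 1‖ ≤ ‖s‖ + 4 := (norm_sub_le _ _).trans (by simp; linarith)
      gcongr
      · linarith
  have ha : AnalyticOnNhd ℂ (fun z => ∑' n, tt n z) U := hd.analyticOnNhd hUo
  have hb : AnalyticOnNhd ℂ (fun z => riemannZeta₁ z - 1) U :=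
    ((differentiable_riemannZeta₁.sub_const 1).differentiableOn).analyticOnNhd hUo
  refine ha.eqOn_of_preconnected_of_eventuallyEq hb hUc.isPreconnected h2U ?_ hsU
  have : ∀ᶠ z : ℂ in nhds 2, 1 < z.re :=
    (isOpen_lt continuous_const Complex.continuous_re).mem_nhds (by simp)
  filter_upwards [this] with z hz using tt_tsum_of_one_lt hz

/-- main upper bound -/
lemma zeta_sub (δ : ℝ) (h0 : 0 < δ) (h1 : δ < 1/2) : ∃ C : ℝ, 0 < C ∧ ∀ s : ℂ, 1 - δ ≤ s.re → s ≠ 1 →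
    ‖riemannZeta s - 1 / (s - 1)‖ ≤ C * ‖s‖ ^ (2 * δ) := by
  have hsum := summable_rpow (e := -1 - δ) (by linarith)
  refine ⟨2 * ∑' n : ℕ, ((n : ℝ) + 1) ^ (-1 - δ), ?_, ?_⟩
  · have := hsum.tsum_pos (fun n => by positivity) 0 (by positivity)
    positivity
  intro s hs hs1
  have hne : s - 1 ≠ 0 := sub_ne_zero.mpr hs1
  have e : riemannZeta s - 1 / (s - 1) = (s - 1)⁻¹ * ∑' n, tt n s := by
    rw [tt_tsum (by linarith), riemannZeta_eq_inv_sub_mul hs1]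
    field_simp
  rw [e, norm_mul, norm_inv]
  have hb : ∀ n, ‖tt n s‖ ≤ ‖s - 1‖ * (2 * ‖s‖ ^ (2 * δ)) * ((n : ℝ) + 1) ^ (-1 - δ) := by
    intro n
    refine (tt_bound n (θ := 2 * δ) (by linarith) (by linarith) (by linarith)).trans ?_
    rw [mul_assoc ‖s - 1‖]
    gcongr ?_ * ?_
    refine mul_le_mul_of_nonneg_left ?_ (by positivity)
    exact Real.rpow_le_rpow_of_exponent_le (by linarith [(Nat.cast_nonneg n : (0:ℝ) ≤ n)]) (by linarith)
  have h2 := tsum_of_norm_bounded (hsum.mul_left _).hasSum hb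
  rw [tsum_mul_left] at h2
  calc _ ≤ ‖s - 1‖⁻¹ * (‖s - 1‖ * (2 * ‖s‖ ^ (2 * δ)) * ∑' n : ℕ, ((n : ℝ) + 1) ^ (-1 - δ)) := by gcongr
    _ = _ := by
      have : ‖s - 1‖ ≠ 0 := norm_ne_zero_iff.mpr hne
      field_simp

end Zb

end PartB1

section PartB1b

namespace Zb
open Complex

lemma zeta_upper : ∃ C : ℝ, 0 < C ∧ ∀ z : ℂ, 0 < z.re →
    ‖riemannZeta (1 + z)‖ ≤ C * (1 / ‖z‖ + (1 + ‖z‖) ^ (1/4 : ℝ)) := by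
  obtain ⟨C, hC, h⟩ := zeta_sub (1/8) (by norm_num) (by norm_num)
  refine ⟨C + 1, by positivity, fun z hz => ?_⟩
  have hz0 : z ≠ 0 := by rintro rfl; simp at hz
  have h1 := h (1 + z) (by simp; linarith) (by simpa using hz0)
  have h2 : ‖(1 : ℂ) + z‖ ^ (2 * (1 / 8 : ℝ)) ≤ (1 + ‖z‖) ^ (1/4 : ℝ) := by
    have : ‖(1 : ℂ) + z‖ ≤ 1 + ‖z‖ := (norm_add_le _ _).trans (by simp)
    norm_num
    gcongr
  rw [add_sub_cancel_left] at h1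
  have h3 : ‖riemannZeta (1 + z)‖ ≤ ‖riemannZeta (1 + z) - 1 / z‖ + 1 / ‖z‖ := by
    have := norm_add_le (riemannZeta (1 + z) - 1 / z) (1 / z)
    simpa using this
  have h4 : 0 ≤ 1 / ‖z‖ := by positivity
  have h5 : 0 ≤ (1 + ‖z‖) ^ (1/4 : ℝ) := by positivity
  have h6 := mul_le_mul_of_nonneg_left h2 hC.le
  nlinarith [mul_nonneg hC.le h4]

/-- bound in a neighbourhood for |t| >= 1/2 -/
lemma zeta_t : ∃ C : ℝ, 0 < C ∧ ∀ s : ℂ, 1 - 1/32 ≤ s.re → s.re ≤ 3 → 1/2 ≤ |s.im| →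
    ‖riemannZeta s‖ ≤ C * |s.im| ^ (1/16 : ℝ) := by
  obtain ⟨C, hC, h⟩ := zeta_sub (1/32) (by norm_num) (by norm_num)
  refine ⟨7 * C + 4, by positivity, fun s hs hs2 ht => ?_⟩
  have hs1 : s ≠ 1 := by rintro rfl; norm_num at ht
  have h1 := h s hs hs1
  have ha : |s.im| ≤ ‖s - 1‖ := by simpa using Complex.abs_im_le_norm (s - 1)
  have hb : 1 / ‖s - 1‖ ≤ 2 := by
    rw [div_le_iff₀ (by linarith)]; linarith
  have hc : ‖s‖ ≤ 7 * |s.im| := by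
    have h1 := Complex.norm_le_abs_re_add_abs_im s
    have h2 : |s.re| ≤ 3 := abs_le.mpr ⟨by linarith, hs2⟩
    linarith
  have hd : ‖s‖ ^ (2 * (1 / 32) : ℝ) ≤ 7 * |s.im| ^ (1/16 : ℝ) := by
    calc ‖s‖ ^ (2 * (1 / 32) : ℝ) ≤ (7 * |s.im|) ^ (2 * (1 / 32) : ℝ) := by gcongr
      _ = 7 ^ (1/16 : ℝ) * |s.im| ^ (1/16 : ℝ) := by
        rw [Real.mul_rpow (by norm_num) (by positivity)]; norm_num
      _ ≤ 7 ^ (1 : ℝ) * |s.im| ^ (1/16 : ℝ) := by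
        gcongr <;> norm_num
      _ = _ := by norm_num
  have he : 1/2 ≤ |s.im| ^ (1/16 : ℝ) := by
    calc (1/2 : ℝ) = (1/2) ^ (1 : ℝ) := by norm_num
      _ ≤ (1/2) ^ (1/16 : ℝ) := Real.rpow_le_rpow_of_exponent_ge (by norm_num) (by norm_num) (by norm_num)
      _ ≤ _ := by gcongr
  have h3 : ‖riemannZeta s‖ ≤ ‖riemannZeta s - 1 / (s - 1)‖ + 1 / ‖s - 1‖ := by
    have := norm_add_le (riemannZeta s - 1 / (s - 1)) (1 / (s - 1))
    simpa using this
  have h6 := mul_le_mul_of_nonneg_left hd hC.le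
  nlinarith

lemma zeta_deriv : ∃ C : ℝ, 0 < C ∧ ∀ s : ℂ, 1 ≤ s.re → s.re ≤ 2 → 1 ≤ |s.im| →
    ‖deriv riemannZeta s‖ ≤ C * |s.im| ^ (1/16 : ℝ) := by
  obtain ⟨C, hC, h⟩ := zeta_t
  refine ⟨64 * C, by positivity, fun s hs hs2 ht => ?_⟩
  have key := Complex.norm_deriv_le_of_forall_mem_sphere_norm_le (c := s) (R := 1/32) (f := riemannZeta)
    (C := C * (2 * |s.im| ^ (1/16 : ℝ))) (by norm_num) ?_ ?_
  · refine key.trans (le_of_eq ?_); ring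
  · apply DifferentiableOn.diffContOnCl
    rw [closure_ball _ (by norm_num)]
    intro z hz
    apply DifferentiableAt.differentiableWithinAt
    apply differentiableAt_riemannZeta
    rintro rfl
    have := Complex.abs_im_le_norm (1 - s)
    rw [mem_closedBall_iff_norm] at hz
    simp at this
    linarith
  · intro z hz
    rw [mem_sphere_iff_norm] at hz
    have h1 := Complex.abs_im_le_norm (z - s)
    have h2 := Complex.abs_re_le_norm (z - s)
    rw [hz] at h1 h2
    simp only [Complex.sub_im, Complex.sub_re] at h1 h2
    rw [abs_le] at h2
    have h3 : |s.im| - 1/32 ≤ |z.im| := by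
      have := abs_sub_abs_le_abs_sub s.im z.im
      rw [abs_sub_comm] at this; linarith
    have h4 : |z.im| ≤ 2 * |s.im| := by
      have := abs_sub_abs_le_abs_sub z.im s.im
      linarith
    refine (h z (by linarith) (by linarith) (by linarith)).trans ?_
    gcongr
    calc |z.im| ^ (1/16 : ℝ) ≤ (2 * |s.im|) ^ (1/16 : ℝ) := by gcongr
      _ = 2 ^ (1/16 : ℝ) * |s.im| ^ (1/16 : ℝ) := Real.mul_rpow (by norm_num) (by positivity)
      _ ≤ 2 ^ (1 : ℝ) * |s.im| ^ (1/16 : ℝ) := by gcongr <;> norm_num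
      _ = _ := by norm_num

lemma three_four_one {x : ℝ} (hx : 0 < x) (y : ℝ) :
    1 ≤ ‖riemannZeta (1 + x)‖ ^ 3 * ‖riemannZeta (1 + x + I * y)‖ ^ 4 * ‖riemannZeta (1 + x + 2 * I * y)‖ := by
  have := DirichletCharacter.norm_LSeries_product_ge_one (1 : DirichletCharacter ℂ 1) hx y
  rw [one_pow] at this
  have e : ∀ s : ℂ, 1 < s.re → LSeries (fun n : ℕ => (1 : DirichletCharacter ℂ 1) n) s = riemannZeta s := by
    intro s hs
    rw [← LSeries_one_eq_riemannZeta hs]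
    congr 1
    ext n
    simp [Subsingleton.elim (n : ZMod 1) 1]
  rw [e _ (by simp [hx]), e _ (by simp [hx]), e _ (by simp [hx]), norm_mul, norm_mul, norm_pow, norm_pow] at this
  exact this

lemma zeta_low1 : ∃ c : ℝ, 0 < c ∧ ∀ x t : ℝ, 0 < x → x ≤ 1 → 1 ≤ |t| →
    c * x ^ (3/4 : ℝ) * |t| ^ (-(1/64) : ℝ) ≤ ‖riemannZeta (1 + x + I * t)‖ := by
  obtain ⟨C, hC, h⟩ := zeta_t
  obtain ⟨D, hD, h'⟩ := zeta_upper
  set K : ℝ := (3 * D) ^ 3 * (2 * C) with hK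
  have hK0 : 0 < K := by positivity
  refine ⟨K ^ (-(1/4) : ℝ), by positivity, fun x t hx hx1 ht => ?_⟩
  have h0 := three_four_one hx t
  have ht0 : 0 < |t| := by linarith
  have h1 : ‖riemannZeta (1 + x)‖ ≤ 3 * D * x⁻¹ := by
    refine (h' (x : ℂ) (by simpa using hx)).trans ?_
    rw [Complex.norm_real, Real.norm_of_nonneg hx.le]
    have : (1 + x) ^ (1/4 : ℝ) ≤ 2 := by
      calc (1 + x) ^ (1/4 : ℝ) ≤ (1 + x) ^ (1 : ℝ) := Real.rpow_le_rpow_of_exponent_le (by linarith) (by norm_num)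
        _ ≤ 2 := by rw [Real.rpow_one]; linarith
    have h3 : 1 ≤ x⁻¹ := (one_le_inv₀ hx).mpr hx1
    have : 1 / x + (1 + x) ^ (1/4 : ℝ) ≤ 3 * x⁻¹ := by rw [one_div]; linarith
    nlinarith
  have h2 : ‖riemannZeta (1 + x + 2 * I * t)‖ ≤ 2 * C * |t| ^ (1/16 : ℝ) := by
    have hi : (1 + x + 2 * I * t : ℂ).im = 2 * t := by simp
    have hr : (1 + x + 2 * I * t : ℂ).re = 1 + x := by simp
    have ha : |2 * t| = 2 * |t| := by rw [abs_mul]; norm_num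
    refine (h _ (by rw [hr]; linarith) (by rw [hr]; linarith) (by rw [hi, ha]; linarith)).trans ?_
    rw [hi, ha, Real.mul_rpow (by norm_num) (by positivity)]
    have : (2:ℝ) ^ (1/16 : ℝ) ≤ 2 ^ (1 : ℝ) := by gcongr <;> norm_num
    rw [Real.rpow_one] at this
    have h4 : 0 ≤ C * |t| ^ (1/16 : ℝ) := by positivity
    nlinarith
  set Z := ‖riemannZeta (1 + x + I * t)‖ with hZ
  have h3 : 1 ≤ (K * (x⁻¹ ^ 3 * |t| ^ (1/16 : ℝ))) * Z ^ 4 := by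
    calc 1 ≤ _ := h0
      _ ≤ (3 * D * x⁻¹) ^ 3 * Z ^ 4 * (2 * C * |t| ^ (1/16 : ℝ)) := by gcongr
      _ = _ := by rw [hK]; ring
  set A := K ^ (-(1/4) : ℝ) * x ^ (3/4 : ℝ) * |t| ^ (-(1/64) : ℝ) with hA
  have h4 : A ^ 4 = (K * (x⁻¹ ^ 3 * |t| ^ (1/16 : ℝ)))⁻¹ := by
    clear_value K
    rw [hA, mul_pow, mul_pow, ← Real.rpow_natCast, ← Real.rpow_natCast (x ^ (3/4 : ℝ)), ← Real.rpow_natCast (|t| ^ (-(1/64) : ℝ)),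
      ← Real.rpow_mul hK0.le, ← Real.rpow_mul hx.le, ← Real.rpow_mul ht0.le]
    rw [mul_inv, mul_inv, ← Real.rpow_neg ht0.le, inv_pow, inv_inv, ← Real.rpow_natCast x, ← Real.rpow_neg_one K, mul_assoc]
    norm_num
  have h5 : A ^ 4 ≤ Z ^ 4 := by
    rw [h4]
    rw [inv_le_iff_one_le_mul₀' (by positivity)]
    exact h3
  exact le_of_pow_le_pow_left₀ (by norm_num) (norm_nonneg _) h5

lemma zeta_low2 : ∃ c : ℝ, 0 < c ∧ ∀ x t : ℝ, 0 < x → x ≤ 1 → 1 ≤ |t| →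
    c * |t| ^ (-(1/4) : ℝ) ≤ ‖riemannZeta (1 + x + I * t)‖ := by
  obtain ⟨c, hc, h⟩ := zeta_low1
  obtain ⟨C, hC, h'⟩ := zeta_deriv
  -- ε with c ε^{3/4} = 2 C ε
  set ε : ℝ := min 1 ((c / (2 * C)) ^ (4:ℕ)) with hε
  have hε0 : 0 < ε := by positivity
  have hε1 : ε ≤ 1 := min_le_left _ _
  have hε2 : C * ε ≤ c * ε ^ (3/4 : ℝ) / 2 := by
    have h1 : ε = ε ^ (3/4 : ℝ) * ε ^ (1/4 : ℝ) := by rw [← Real.rpow_add hε0]; norm_num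
    have h2 : ε ^ (1/4 : ℝ) ≤ c / (2 * C) := by
      calc ε ^ (1/4 : ℝ) ≤ ((c / (2 * C)) ^ (4:ℕ)) ^ (1/4 : ℝ) := by
            gcongr; exact min_le_right _ _
        _ = c / (2 * C) := by
          rw [← Real.rpow_natCast, ← Real.rpow_mul (by positivity)]; norm_num
    rw [le_div_iff₀ (by positivity)] at h2
    have h3 : 0 < ε ^ (3/4 : ℝ) := by positivity
    calc C * ε = C * (ε ^ (3/4 : ℝ) * ε ^ (1/4 : ℝ)) := by rw [← h1]
      _ ≤ _ := by nlinarith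
  refine ⟨c * ε ^ (3/4 : ℝ) / 2, by positivity, fun x t hx hx1 ht => ?_⟩
  have ht0 : 0 < |t| := by linarith
  set η : ℝ := ε * |t| ^ (-(5/16) : ℝ) with hη
  have hη0 : 0 < η := by positivity
  have hη1 : η ≤ 1 := by
    have : |t| ^ (-(5/16) : ℝ) ≤ 1 := Real.rpow_le_one_of_one_le_of_nonpos ht (by norm_num)
    have h2 : 0 < |t| ^ (-(5/16) : ℝ) := by positivity
    rw [hη]; nlinarith
  have hη2 : c * η ^ (3/4 : ℝ) * |t| ^ (-(1/64) : ℝ) = c * ε ^ (3/4 : ℝ) * |t| ^ (-(1/4) : ℝ) := by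
    rw [hη, Real.mul_rpow hε0.le (by positivity), ← Real.rpow_mul ht0.le, mul_assoc, mul_assoc, mul_assoc, ← Real.rpow_add ht0]
    norm_num
  rcases le_total η x with hle | hle
  · refine le_trans ?_ (h x t hx hx1 ht)
    have h1 : η ^ (3/4 : ℝ) ≤ x ^ (3/4 : ℝ) := by gcongr
    have h2 : c * η ^ (3/4 : ℝ) * |t| ^ (-(1/64) : ℝ) ≤ c * x ^ (3/4 : ℝ) * |t| ^ (-(1/64) : ℝ) := by gcongr
    have h3 : 0 < c * ε ^ (3/4 : ℝ) * |t| ^ (-(1/4) : ℝ) := by positivity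
    rw [hη2] at h2
    linarith
  · have h1 := h η t hη0 hη1 ht
    rw [hη2] at h1
    have h2 : ‖riemannZeta (1 + η + I * t) - riemannZeta (1 + x + I * t)‖ ≤ (C * |t| ^ (1/16 : ℝ)) * η := by
      set S : Set ℂ := {z | 1 ≤ z.re ∧ z.re ≤ 2 ∧ z.im = t} with hS
      have hconv : Convex ℝ S := by
        have : S = {z : ℂ | 1 ≤ z.re} ∩ ({z : ℂ | z.re ≤ 2} ∩ ({z : ℂ | z.im ≤ t} ∩ {z : ℂ | t ≤ z.im})) := by
          ext z; simp [hS, le_antisymm_iff]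
        rw [this]
        exact (convex_halfSpace_re_ge _).inter ((convex_halfSpace_re_le _).inter ((convex_halfSpace_im_le _).inter (convex_halfSpace_im_ge _)))
      have hm := hconv.norm_image_sub_le_of_norm_deriv_le (f := riemannZeta) (C := C * |t| ^ (1/16 : ℝ))
        (x := 1 + x + I * t) (y := 1 + η + I * t) ?_ ?_ ?_ ?_
      · refine hm.trans ?_
        have : (1 + η + I * t - (1 + x + I * t) : ℂ) = ((η - x : ℝ) : ℂ) := by push_cast; ring
        rw [this, Complex.norm_real, Real.norm_of_nonneg (by linarith)]
        gcongr; linarith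
      · rintro z ⟨_, _, hz⟩
        apply differentiableAt_riemannZeta
        rintro rfl
        simp at hz; rw [← hz] at ht0; simp at ht0
      · rintro z ⟨hz1, hz2, hz⟩
        have := h' z hz1 hz2 (by rw [hz]; exact ht)
        rwa [hz] at this
      · refine ⟨?_, ?_, ?_⟩ <;> simp <;> linarith
      · refine ⟨?_, ?_, ?_⟩ <;> simp <;> linarith
    have h3 : (C * |t| ^ (1/16 : ℝ)) * η = C * ε * |t| ^ (-(1/4) : ℝ) := by
      rw [hη]
      have : |t| ^ (-(1/4) : ℝ) = |t| ^ (1/16 : ℝ) * |t| ^ (-(5/16) : ℝ) := by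
        rw [← Real.rpow_add ht0]; norm_num
      rw [this]; ring
    rw [h3] at h2
    have h4 : 0 < |t| ^ (-(1/4) : ℝ) := by positivity
    have h5 := mul_le_mul_of_nonneg_right hε2 h4.le
    have h6 := norm_sub_norm_le (riemannZeta (1 + η + I * t)) (riemannZeta (1 + x + I * t))
    nlinarith

lemma zeta_low3 : ∃ c : ℝ, 0 < c ∧ ∀ z : ℂ, 0 < z.re → z.re ≤ 1 → |z.im| ≤ 1 →
    c ≤ ‖z‖ * ‖riemannZeta (1 + z)‖ := by
  set K : Set ℂ := Set.Icc 0 1 ×ℂ Set.Icc (-1) 1 with hK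
  have hKc : IsCompact K := isCompact_Icc.reProdIm isCompact_Icc
  have hne : K.Nonempty := ⟨0, by simp [hK, Complex.mem_reProdIm]⟩
  obtain ⟨z0, hz0, hmin⟩ := hKc.exists_isMinOn hne (f := fun z => ‖riemannZeta₁ (1 + z)‖)
    (by
      apply Continuous.continuousOn
      exact (differentiable_riemannZeta₁.continuous.comp (continuous_const.add continuous_id)).norm)
  have hz1 : ∀ z : ℂ, z ≠ 0 → riemannZeta₁ (1 + z) = z * riemannZeta (1 + z) := by
    intro z hz
    rw [riemannZeta_eq_inv_sub_mul (by simpa using hz), add_sub_cancel_left, ← mul_assoc]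
    field_simp
  refine ⟨‖riemannZeta₁ (1 + z0)‖, ?_, ?_⟩
  · rw [norm_pos_iff]
    rcases eq_or_ne z0 0 with rfl | h
    · simp [riemannZeta₁_one]
    · rw [hz1 _ h]
      apply mul_ne_zero h
      apply riemannZeta_ne_zero_of_one_le_re
      simp [hK, Complex.mem_reProdIm] at hz0
      simp [hz0.1.1]
  · intro z h1 h2 h3
    rw [← norm_mul, ← hz1 z (by rintro rfl; simp at h1)]
    apply hmin
    simp [hK, Complex.mem_reProdIm, h1.le, h2, abs_le.mp h3]

lemma zeta_lower : ∃ C : ℝ, 0 < C ∧ ∀ z : ℂ, 0 < z.re → z.re ≤ 1 →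
    ‖(riemannZeta (1 + z))⁻¹‖ ≤ C * (‖z‖ * (1 + ‖z‖) ^ (-(3/4) : ℝ)) := by
  obtain ⟨c, hc, h⟩ := zeta_low2
  obtain ⟨c', hc', h'⟩ := zeta_low3
  refine ⟨4 / c' + 4 / c, by positivity, fun z hz hz1 => ?_⟩
  have hz0 : 0 < ‖z‖ := by rw [norm_pos_iff]; rintro rfl; simp at hz
  rw [norm_inv]
  have hbd := Complex.norm_le_abs_re_add_abs_im z
  have hbd2 : |z.re| ≤ 1 := abs_le.mpr ⟨by linarith, hz1⟩
  have him := Complex.abs_im_le_norm z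
  rcases le_total |z.im| 1 with ht | ht
  · have h1 := h' z hz hz1 ht
    have h2 : (1/4 : ℝ) ≤ (1 + ‖z‖) ^ (-(3/4) : ℝ) := by
      calc (1/4 : ℝ) ≤ 4 ^ (-1 : ℝ) := by rw [Real.rpow_neg_one]; norm_num
        _ ≤ 4 ^ (-(3/4) : ℝ) := by gcongr <;> norm_num
        _ ≤ _ := Real.rpow_le_rpow_of_nonpos (by positivity) (by linarith) (by norm_num)
    have hζ : 0 < ‖riemannZeta (1 + z)‖ := by
      by_contra hh
      have : ‖riemannZeta (1 + z)‖ = 0 := le_antisymm (not_lt.mp hh) (norm_nonneg _)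
      rw [this] at h1; linarith
    calc ‖riemannZeta (1 + z)‖⁻¹ ≤ ‖z‖ / c' := by
          rw [inv_le_iff_one_le_mul₀ hζ, div_mul_eq_mul_div, le_div_iff₀ hc']; linarith
      _ = 4 / c' * (‖z‖ * (1/4)) := by ring
      _ ≤ (4 / c' + 4 / c) * (‖z‖ * (1 + ‖z‖) ^ (-(3/4) : ℝ)) := by
        gcongr
        have : 0 < 4 / c := by positivity
        linarith
  · have h1 := h z.re z.im hz hz1 ht
    have e : (1 + z.re + I * z.im : ℂ) = 1 + z := by
      rw [add_assoc]; congr 1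
      rw [mul_comm]; exact Complex.re_add_im z
    rw [e] at h1
    have hi0 : 0 < |z.im| := by linarith
    have h2 : 0 < c * |z.im| ^ (-(1/4) : ℝ) := by positivity
    calc ‖riemannZeta (1 + z)‖⁻¹ ≤ (c * |z.im| ^ (-(1/4) : ℝ))⁻¹ := by gcongr
      _ = c⁻¹ * |z.im| ^ (1/4 : ℝ) := by rw [mul_inv, ← Real.rpow_neg hi0.le]; norm_num
      _ ≤ c⁻¹ * (1 + ‖z‖) ^ (1/4 : ℝ) := by gcongr; linarith
      _ = c⁻¹ * ((1 + ‖z‖) * (1 + ‖z‖) ^ (-(3/4) : ℝ)) := by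
        congr 1
        rw [← Real.rpow_one_add' (by positivity) (by norm_num)]; norm_num
      _ ≤ c⁻¹ * ((4 * ‖z‖) * (1 + ‖z‖) ^ (-(3/4) : ℝ)) := by gcongr; linarith
      _ = 4 / c * (‖z‖ * (1 + ‖z‖) ^ (-(3/4) : ℝ)) := by ring
      _ ≤ _ := by
        gcongr
        have : 0 < 4 / c' := by positivity
        linarith

end Zb

end PartB1b

section PartB2

namespace Lap
open MeasureTheory Complex Set
open scoped FourierTransform

/-- the point on the vertical line -/
noncomputable def vl (c ξ : ℝ) : ℂ := (c : ℂ) + ξ * I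

@[simp] lemma vl_re (c ξ : ℝ) : (vl c ξ).re = c := by simp [vl]
@[simp] lemma vl_im (c ξ : ℝ) : (vl c ξ).im = ξ := by simp [vl]
lemma vl_cont (c : ℝ) : Continuous (vl c) := by unfold vl; fun_prop

lemma vl_ne {c : ℝ} (hc : 0 < c) (ξ : ℝ) : vl c ξ ≠ 0 := by
  intro h; have := congrArg Complex.re h; simp at this; linarith

/-- Laplace inversion -/
lemma laplace_inv (φ : ℝ → ℂ) (c : ℝ) (F : ℝ → ℂ)
    (hintg : Integrable (fun x : ℝ => cexp (-(c * x)) * φ x))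
    (hF : ∀ ξ, F ξ = ∫ x : ℝ, cexp (-(vl c ξ * x)) * φ x) (hFi : Integrable F) (x : ℝ) (hx : ContinuousAt φ x) :
    ∫ ξ : ℝ, cexp (x * vl c ξ) * F ξ = 2 * Real.pi * φ x := by
  set f : ℝ → ℂ := fun x : ℝ => cexp (-(c * x)) * φ x with hf
  have h1 : ∀ w : ℝ, 𝓕 f w = F (2 * Real.pi * w) := by
    intro w
    rw [Real.fourier_real_eq_integral_exp_smul, hF]
    congr 1; ext y
    rw [hf, smul_eq_mul, ← mul_assoc, ← Complex.exp_add]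
    congr 2
    rw [vl]; push_cast; ring
  have hpi : (2 * Real.pi) ≠ 0 := by positivity
  have h2 : Integrable (𝓕 f) := by
    have : 𝓕 f = fun w => F (2 * Real.pi * w) := funext h1
    rw [this]
    exact hFi.comp_mul_left' hpi
  have h3 := hintg.fourierInv_fourier_eq h2 (v := x) (by
    rw [hf]
    exact ContinuousAt.mul (by fun_prop) hx)
  rw [Real.fourierInv_eq'] at h3
  have h4 : (∫ v : ℝ, cexp (↑(2 * Real.pi * inner ℝ v x) * I) • 𝓕 f v) =
      ∫ v : ℝ, (fun ξ : ℝ => cexp (x * ξ * I) * F ξ) (2 * Real.pi * v) := by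
    congr 1; ext v
    rw [h1, smul_eq_mul]
    congr 2
    simp; ring
  rw [h4, MeasureTheory.Measure.integral_comp_mul_left (fun ξ : ℝ => cexp (x * ξ * I) * F ξ)] at h3
  have h5 : (∫ ξ : ℝ, cexp (x * vl c ξ) * F ξ) = cexp (c * x) * ∫ ξ : ℝ, cexp (x * ξ * I) * F ξ := by
    rw [← integral_const_mul]
    congr 1; ext ξ
    rw [← mul_assoc, ← Complex.exp_add]
    congr 2
    rw [vl]; ring
  rw [h5]
  rw [abs_of_pos (by positivity)] at h3
  have h6 : (∫ ξ : ℝ, cexp (x * ξ * I) * F ξ) = 2 * Real.pi * (cexp (-(c * x)) * φ x) := by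
    rw [hf] at h3
    simp only at h3
    rw [← h3]
    rw [Complex.real_smul]
    push_cast
    have : (Real.pi : ℂ) ≠ 0 := by exact_mod_cast Real.pi_ne_zero
    generalize (∫ ξ : ℝ, cexp (x * ξ * I) * F ξ) = J
    field_simp
  rw [h6]
  have : cexp (c * x) * cexp (-(c * x)) = 1 := by rw [← Complex.exp_add]; simp
  linear_combination (2 * Real.pi * φ x) * this

lemma exp_int {V : ℂ} (hV : 0 < V.re) (m : ℕ) :
    IntegrableOn (fun t : ℝ => cexp (-(V * t)) * ((t : ℂ) ^ m / m.factorial)) (Ioi 0) := by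
  have h1 : IntegrableOn (fun t : ℝ => t ^ (m : ℝ) * Real.exp (- V.re * t)) (Ioi 0) :=
    integrableOn_rpow_mul_exp_neg_mul_rpow (p := 1) (s := m) (by
      have : (0:ℝ) ≤ m := by positivity
      linarith) one_pos hV |>.congr_fun (fun x _ => by simp) measurableSet_Ioi
  refine Integrable.mono' (h1.const_mul ((m.factorial : ℝ)⁻¹)) ?_ ?_
  · apply Continuous.aestronglyMeasurable
    fun_prop
  · refine (ae_restrict_iff' measurableSet_Ioi).mpr (Filter.Eventually.of_forall fun t ht => ?_)
    have ht0 : (0:ℝ) < t := ht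
    rw [norm_mul, norm_div, norm_pow, Complex.norm_exp, Complex.norm_real, Real.norm_of_nonneg ht0.le]
    simp
    rw [div_eq_inv_mul]
    nlinarith

lemma conv {ρ : ℝ → ℂ} {V : ℂ} (hV : 0 < V.re) (m : ℕ)
    (hρ : IntegrableOn (fun t : ℝ => cexp (-(V * t)) * ρ t) (Ioi 0)) :
    IntegrableOn (fun x : ℝ => cexp (-(V * x)) * ∫ r in (0:ℝ)..x, ((x - r : ℝ) : ℂ) ^ m / m.factorial * ρ r) (Ioi 0) ∧
    ∫ x in Ioi (0:ℝ), cexp (-(V * x)) * ∫ r in (0:ℝ)..x, ((x - r : ℝ) : ℂ) ^ m / m.factorial * ρ r =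
     (∫ t in Ioi (0:ℝ), cexp (-(V * t)) * ρ t) * (∫ t in Ioi (0:ℝ), cexp (-(V * t)) * ((t : ℂ) ^ m / m.factorial)) := by
  have hg := exp_int hV m
  have e : ∀ x : ℝ, cexp (-(V * x)) * ∫ r in (0:ℝ)..x, ((x - r : ℝ) : ℂ) ^ m / m.factorial * ρ r =
      ∫ t in (0:ℝ)..x, (ContinuousLinearMap.mul ℝ ℂ) (cexp (-(V * t)) * ρ t) (cexp (-(V * (x - t : ℝ))) * (((x - t : ℝ) : ℂ) ^ m / m.factorial)) := by
    intro x
    rw [← intervalIntegral.integral_const_mul]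
    congr 1; ext r
    rw [ContinuousLinearMap.mul_apply']
    have : cexp (-(V * x)) = cexp (-(V * r)) * cexp (-(V * (x - r : ℝ))) := by
      rw [← Complex.exp_add]; congr 1; push_cast; ring
    rw [this]; ring
  have h1 := integral_posConvolution hρ hg (ContinuousLinearMap.mul ℝ ℂ) (μ := volume) (ν := volume)
  have h2 := integrable_posConvolution hρ hg (ContinuousLinearMap.mul ℝ ℂ) (μ := volume) (ν := volume)
  refine ⟨?_, ?_⟩
  · rw [posConvolution, integrable_indicator_iff measurableSet_Ioi] at h2
    exact h2.congr_fun (fun x _ => (e x).symm) measurableSet_Ioi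
  · rw [ContinuousLinearMap.mul_apply'] at h1
    rw [← h1]
    refine setIntegral_congr_fun measurableSet_Ioi fun x _ => e x

lemma lap_pow {V : ℂ} (hV : 0 < V.re) (m : ℕ) :
    ∫ t in Ioi (0:ℝ), cexp (-(V * t)) * ((t : ℂ) ^ m / m.factorial) = (V ^ (m + 1))⁻¹ := by
  have h0 : ∫ t in Ioi (0:ℝ), cexp (-(V * t)) * ((t : ℂ) ^ 0 / (0 : ℕ).factorial) = V⁻¹ := by
    have := integral_exp_mul_complex_Ioi (a := -V) (by simpa using hV) 0
    simp at this ⊢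
    exact this
  induction m with
  | zero => rw [h0]; simp
  | succ m ih =>
    have h := (conv (ρ := fun t => ((t : ℂ) ^ m / m.factorial)) hV 0 (exp_int hV m)).2
    rw [ih, h0] at h
    rw [pow_succ, mul_inv, ← h]
    refine setIntegral_congr_fun measurableSet_Ioi fun x _ => ?_
    congr 1
    simp only [pow_zero, Nat.factorial_zero, Nat.cast_one, div_one, one_mul]
    have : (∫ r in (0:ℝ)..x, (r : ℂ) ^ m / m.factorial) = ∫ r in (0:ℝ)..x, (((r ^ m / m.factorial : ℝ)) : ℂ) := by
      congr 1; ext r; push_cast; rfl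
    rw [this, intervalIntegral.integral_ofReal, intervalIntegral.integral_div, integral_pow, Nat.factorial_succ]
    push_cast
    have h1 : (m.factorial : ℂ) ≠ 0 := by exact_mod_cast m.factorial_ne_zero
    have h2 : (m + 1 : ℂ) ≠ 0 := by exact_mod_cast m.succ_ne_zero
    field_simp
    simp

lemma prim_cont (ρ : ℝ → ℂ) (hρ : ∀ a b, IntervalIntegrable ρ volume a b) (m : ℕ) :
    Continuous (fun x : ℝ => ∫ r in (0:ℝ)..x, ((x - r : ℝ) : ℂ) ^ m / m.factorial * ρ r) := by
  have e : ∀ x : ℝ, (∫ r in (0:ℝ)..x, ((x - r : ℝ) : ℂ) ^ m / m.factorial * ρ r) =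
      ∑ i ∈ Finset.range (m + 1), (x : ℂ) ^ i * ∫ r in (0:ℝ)..x, ((-(r:ℂ)) ^ (m - i) * (m.choose i) / m.factorial) * ρ r := by
    intro x
    simp_rw [← intervalIntegral.integral_const_mul]
    rw [← intervalIntegral.integral_finsetSum]
    · congr 1; ext r
      push_cast
      rw [sub_eq_add_neg, add_pow, Finset.sum_div, Finset.sum_mul]
      refine Finset.sum_congr rfl fun i _ => ?_
      ring
    · intro i _
      apply IntervalIntegrable.const_mul
      exact (hρ 0 x).continuousOn_mul (by fun_prop)
  simp_rw [e]
  refine continuous_finsetSum _ fun i _ => ?_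
  refine Continuous.mul (by fun_prop) ?_
  apply intervalIntegral.continuous_primitive
  intro a b
  exact (hρ a b).continuousOn_mul (by fun_prop)

/-- Lemma L -/
lemma lemL (ρ : ℝ → ℂ) (c : ℝ) (hc : 0 < c) (m : ℕ)
    (hρ : ∀ a b, IntervalIntegrable ρ volume a b) (hρ0 : ∀ r < 0, ρ r = 0)
    (hρi : IntegrableOn (fun t : ℝ => cexp (-(c * t)) * ρ t) (Ioi 0))
    (hFi : Integrable (fun ξ : ℝ => (vl c ξ ^ (m + 1))⁻¹ * ∫ t in Ioi (0:ℝ), cexp (-(vl c ξ * t)) * ρ t)) (x : ℝ) :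
    ∫ ξ : ℝ, cexp (x * vl c ξ) * ((vl c ξ ^ (m + 1))⁻¹ * ∫ t in Ioi (0:ℝ), cexp (-(vl c ξ * t)) * ρ t) =
      2 * Real.pi * ∫ r in (0:ℝ)..x, ((x - r : ℝ) : ℂ) ^ m / m.factorial * ρ r := by
  set φ : ℝ → ℂ := fun x => ∫ r in (0:ℝ)..x, ((x - r : ℝ) : ℂ) ^ m / m.factorial * ρ r with hφ
  have hφ0 : ∀ x ≤ 0, φ x = 0 := by
    intro x hx
    rw [hφ]; simp only
    rw [intervalIntegral.integral_symm, intervalIntegral.integral_of_le hx, integral_Ioc_eq_integral_Ioo,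
      setIntegral_congr_fun measurableSet_Ioo (g := fun _ => (0:ℂ))]
    · simp
    · intro r hr
      simp [hρ0 r hr.2]
  have hρV : ∀ ξ, IntegrableOn (fun t : ℝ => cexp (-(vl c ξ * t)) * ρ t) (Ioi 0) := by
    intro ξ
    have : (fun t : ℝ => cexp (-(vl c ξ * t)) * ρ t) = fun t : ℝ => cexp (-(ξ * t * I)) * (cexp (-(c * t)) * ρ t) := by
      ext t
      rw [← mul_assoc, ← Complex.exp_add]; congr 2; rw [vl]; ring
    rw [this]
    refine Integrable.bdd_mul (c := 1) hρi (by
      apply Continuous.aestronglyMeasurable; fun_prop) (Filter.Eventually.of_forall fun t => ?_)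
    rw [Complex.norm_exp]; simp
  have hsupp : ∀ V : ℂ, (∫ x : ℝ, cexp (-(V * x)) * φ x) = ∫ x in Ioi (0:ℝ), cexp (-(V * x)) * φ x := by
    intro V
    rw [setIntegral_eq_integral_of_forall_compl_eq_zero]
    intro x hx
    rw [hφ0 x (not_lt.mp hx), mul_zero]
  refine laplace_inv φ c _ ?_ ?_ hFi x (prim_cont ρ hρ m).continuousAt
  · have h := (conv (V := c) (by simpa using hc) m hρi).1
    rw [← integrable_indicator_iff measurableSet_Ioi] at h
    refine h.congr (Filter.Eventually.of_forall fun x => ?_)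
    by_cases hx : x ∈ Ioi (0:ℝ)
    · simp only [indicator_of_mem hx]; rfl
    · simp only [indicator_of_notMem hx]
      rw [hφ0 x (not_lt.mp hx), mul_zero]
  · intro ξ
    have h := (conv (V := vl c ξ) (by simpa using hc) m (hρV ξ)).2
    rw [lap_pow (by simpa using hc)] at h
    rw [hsupp, mul_comm]
    exact h.symm

lemma vl_norm_sq (c ξ : ℝ) : ‖vl c ξ‖ ^ 2 = c ^ 2 + ξ ^ 2 := by
  rw [← Complex.normSq_eq_norm_sq, Complex.normSq_apply]; simp; ring

lemma vl_one_le {c : ℝ} (hc : 1 ≤ c) (ξ : ℝ) : 1 ≤ ‖vl c ξ‖ := by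
  have := Complex.abs_re_le_norm (vl c ξ)
  rw [vl_re] at this
  exact (hc.trans (le_abs_self c)).trans this

lemma vl_inv_int {c : ℝ} (hc : 1 ≤ c) (k : ℕ) (hk : 1 ≤ k) : Integrable (fun ξ : ℝ => (vl c ξ ^ (k + 1))⁻¹) := by
  refine Integrable.mono' integrable_inv_one_add_sq ?_ (Filter.Eventually.of_forall fun ξ => ?_)
  · apply Continuous.aestronglyMeasurable
    refine Continuous.inv₀ ((vl_cont c).pow _) fun ξ => pow_ne_zero _ (vl_ne (by linarith) ξ)
  · rw [norm_inv, norm_pow]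
    apply inv_anti₀ (by positivity)
    calc 1 + ξ ^ 2 ≤ c ^ 2 + ξ ^ 2 := by nlinarith
      _ = ‖vl c ξ‖ ^ 2 := (vl_norm_sq c ξ).symm
      _ ≤ _ := pow_le_pow_right₀ (vl_one_le hc ξ) (by omega)

lemma perron {c : ℝ} (hc : 1 ≤ c) (k : ℕ) (hk : 1 ≤ k) (x : ℝ) :
    ∫ ξ : ℝ, cexp (x * vl c ξ) * (vl c ξ ^ (k + 1))⁻¹ = 2 * Real.pi * (((max x 0) ^ k / k.factorial : ℝ) : ℂ) := by
  have hφ0 : ∀ x : ℝ, x ≤ 0 → ((((max x 0) ^ k / k.factorial : ℝ)) : ℂ) = 0 := by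
    intro x hx
    rw [max_eq_right hx, zero_pow (by omega)]; simp
  have hs : ∀ V : ℂ, 0 < V.re → Integrable (fun x : ℝ => cexp (-(V * x)) * (((max x 0) ^ k / k.factorial : ℝ) : ℂ)) ∧
      (∫ x : ℝ, cexp (-(V * x)) * (((max x 0) ^ k / k.factorial : ℝ) : ℂ)) = (V ^ (k + 1))⁻¹ := by
    intro V hV
    have h := exp_int hV k
    have e : (fun x : ℝ => cexp (-(V * x)) * (((max x 0) ^ k / k.factorial : ℝ) : ℂ)) =
        (Ioi (0:ℝ)).indicator (fun t : ℝ => cexp (-(V * t)) * ((t : ℂ) ^ k / k.factorial)) := by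
      ext x
      by_cases hx : x ∈ Ioi (0:ℝ)
      · rw [indicator_of_mem hx, max_eq_left (le_of_lt hx)]; push_cast; rfl
      · rw [indicator_of_notMem hx, hφ0 x (not_lt.mp hx), mul_zero]
    rw [e]
    refine ⟨(integrable_indicator_iff measurableSet_Ioi).mpr h, ?_⟩
    rw [integral_indicator measurableSet_Ioi, lap_pow hV]
  refine laplace_inv (fun x => (((max x 0) ^ k / k.factorial : ℝ) : ℂ)) c _ ?_ ?_ (vl_inv_int hc k hk) x (by fun_prop)
  · exact (hs c (by simp; linarith)).1
  · intro ξ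
    exact (hs (vl c ξ) (by simp; linarith)).2.symm

end Lap

end PartB2

section PartB3

namespace Loc
open Filter Topology

noncomputable def ff (k : ℕ) (x : ℂ) : ℂ := 1 - (1 - x) ^ k
noncomputable def EE (k : ℕ) (x a b : ℂ) : ℂ := 1 - ff k x * (a + b - a * b)
noncomputable def hh (k : ℕ) (x a b : ℂ) : ℂ :=
  EE k x a b * (1 - x * a * b) ^ k * ((1 - x * a) ^ k)⁻¹ * ((1 - x * b) ^ k)⁻¹

lemma ff_norm (k : ℕ) (x : ℂ) (hx : ‖x‖ ≤ 1) : ‖ff k x‖ ≤ (k * 2 ^ k) * ‖x‖ := by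
  have h := mul_neg_geom_sum (1 - x) k
  have e : ff k x = x * ∑ i ∈ Finset.range k, (1 - x) ^ i := by
    rw [ff, ← h]; ring
  rw [e, norm_mul, mul_comm]
  gcongr
  refine (norm_sum_le _ _).trans ?_
  calc ∑ i ∈ Finset.range k, ‖(1 - x) ^ i‖ ≤ ∑ i ∈ Finset.range k, (2:ℝ) ^ k := by
        refine Finset.sum_le_sum fun i hi => ?_
        rw [norm_pow]
        have h1 : ‖1 - x‖ ≤ 2 := (norm_sub_le _ _).trans (by simp; linarith)
        calc ‖1 - x‖ ^ i ≤ 2 ^ i := by gcongr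
          _ ≤ 2 ^ k := pow_le_pow_right₀ (by norm_num) (Finset.mem_range.mp hi).le
    _ = _ := by simp

lemma pow_exp (k : ℕ) : ∃ R : ℂ → ℂ, Continuous R ∧ ∀ y, (1 - y) ^ k = 1 - k * y + y ^ 2 * R y := by
  induction k with
  | zero => exact ⟨fun _ => 0, by fun_prop, by simp⟩
  | succ k ih =>
    obtain ⟨R, hR, h⟩ := ih
    refine ⟨fun y => k + (1 - y) * R y, by fun_prop, fun y => ?_⟩
    rw [pow_succ, h]; push_cast; ring

lemma den_ne {x a : ℂ} (hx : ‖x‖ ≤ 3 / 5) (ha : ‖a‖ ≤ 1) : 1 - x * a ≠ 0 := by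
  intro h
  have h1 : x * a = 1 := (sub_eq_zero.mp h).symm
  have h2 := congrArg norm h1
  rw [norm_mul, norm_one] at h2
  nlinarith [norm_nonneg x, norm_nonneg a]

lemma hh_bound (k : ℕ) : ∃ C > 0, ∀ x a b : ℂ, ‖x‖ ≤ 3 / 5 → ‖a‖ ≤ 1 → ‖b‖ ≤ 1 →
    ‖hh k x a b - 1‖ ≤ C * ‖x‖ ^ 2 := by
  obtain ⟨R, hR, h⟩ := pow_exp k
  let P : ℂ × ℂ × ℂ → ℂ := fun q =>
    let x := q.1; let a := q.2.1; let b := q.2.2; let c := a + b - a * b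
    (R x * c + (k * c - x * R x * c) * (k * a * b) + (1 - ff k x * c) * ((a * b) ^ 2 * R (x * a * b))
      - (k ^ 2 * a * b + a ^ 2 * R (x * a) * (1 - x * b) ^ k + b ^ 2 * R (x * b) * (1 - k * (x * a)))) *
      ((1 - x * a) ^ k)⁻¹ * ((1 - x * b) ^ k)⁻¹
  let K : Set (ℂ × ℂ × ℂ) := Metric.closedBall 0 (3/5) ×ˢ (Metric.closedBall 0 1 ×ˢ Metric.closedBall 0 1)
  have hK : IsCompact K := (isCompact_closedBall _ _).prod ((isCompact_closedBall _ _).prod (isCompact_closedBall _ _))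
  have hP : ContinuousOn P K := by
    intro q hq
    obtain ⟨h1, h2, h3⟩ := hq
    simp only [mem_closedBall_zero_iff] at h1 h2 h3
    have e1 := den_ne h1 h2
    have e2 := den_ne h1 h3
    apply ContinuousAt.continuousWithinAt
    simp only [P, ff]
    refine ContinuousAt.mul (ContinuousAt.mul (by fun_prop) ?_) ?_
    · exact ContinuousAt.inv₀ (by fun_prop) (pow_ne_zero _ e1)
    · exact ContinuousAt.inv₀ (by fun_prop) (pow_ne_zero _ e2)
  obtain ⟨C, hC⟩ := hK.exists_bound_of_continuousOn hP
  refine ⟨max C 1, by positivity, fun x a b hx ha hb => ?_⟩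
  have e1 := pow_ne_zero k (den_ne hx ha)
  have e2 := pow_ne_zero k (den_ne hx hb)
  have key : hh k x a b - 1 = x ^ 2 * P (x, a, b) := by
    simp only [P, hh, EE]
    have i1 := h (x * a)
    have i2 := h (x * b)
    have i3 := h (x * a * b)
    have i0 := h x
    have i4 : ff k x = k * x - x ^ 2 * R x := by rw [ff, i0]; ring
    have num : (1 - ff k x * (a + b - a * b)) * (1 - x * a * b) ^ k - (1 - x * a) ^ k * (1 - x * b) ^ k =
        x ^ 2 * (R x * (a + b - a * b) + (k * (a + b - a * b) - x * R x * (a + b - a * b)) * (k * a * b) + (1 - ff k x * (a + b - a * b)) * ((a * b) ^ 2 * R (x * a * b))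
      - (k ^ 2 * a * b + a ^ 2 * R (x * a) * (1 - x * b) ^ k + b ^ 2 * R (x * b) * (1 - k * (x * a)))) := by
      rw [i1, i2, i3, i4]; ring
    have : ∀ A B n m : ℂ, A ≠ 0 → B ≠ 0 → n - A * B = m → n * A⁻¹ * B⁻¹ - 1 = m * A⁻¹ * B⁻¹ := by
      intro A B n m hA hB hm
      rw [← hm]; field_simp
    rw [this _ _ _ _ e1 e2 num]; ring
  rw [key, norm_mul, norm_pow, mul_comm]
  gcongr
  refine (hC (x, a, b) ⟨?_, ?_, ?_⟩).trans (le_max_left _ _) <;> simpa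

lemma hh_one (k : ℕ) {x : ℂ} (hx : ‖x‖ ≤ 3 / 5) : hh k x 1 1 = 1 := by
  have e := pow_ne_zero k (den_ne hx (by simp : ‖(1:ℂ)‖ ≤ 1))
  simp only [mul_one] at e
  simp only [hh, EE, ff]
  simp only [mul_one]
  field_simp
  ring

noncomputable def Hf (k : ℕ) (s u v : ℂ) (n : ℕ) : ℂ :=
  if n.Prime then hh k (n ^ (-s)) (n ^ (-u)) (n ^ (-v)) else 1

noncomputable def Hh (k : ℕ) (s u v : ℂ) : ℂ := ∏' n : ℕ, Hf k s u v n

lemma two_pow_le : (2:ℝ) ^ (-(9/10) : ℝ) ≤ 3 / 5 := by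
  rw [Real.rpow_neg (by norm_num), inv_le_comm₀ (by positivity) (by norm_num)]
  have : ((3/5:ℝ)⁻¹) ^ (10:ℕ) ≤ ((2:ℝ) ^ ((9/10) : ℝ)) ^ (10:ℕ) := by
    rw [← Real.rpow_natCast ((2:ℝ) ^ ((9/10) : ℝ)), ← Real.rpow_mul (by norm_num)]
    norm_num
  exact le_of_pow_le_pow_left₀ (by norm_num) (by positivity) this

lemma norm_x {s : ℂ} (hs : 9 / 10 ≤ s.re) {n : ℕ} (hn : 2 ≤ n) : ‖(n : ℂ) ^ (-s)‖ ≤ 3 / 5 ∧ ‖(n : ℂ) ^ (-s)‖ ≤ (n : ℝ) ^ (-(9/10) : ℝ) := by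
  have h2 : (2:ℝ) ≤ n := by exact_mod_cast hn
  rw [Complex.norm_natCast_cpow_of_pos (by omega)]
  have : (n : ℝ) ^ (-s).re ≤ (n : ℝ) ^ (-(9/10) : ℝ) :=
    Real.rpow_le_rpow_of_exponent_le (by linarith) (by simp; linarith)
  refine ⟨this.trans (le_trans ?_ two_pow_le), this⟩
  exact Real.rpow_le_rpow_of_nonpos (by norm_num) h2 (by norm_num)

lemma norm_a {u : ℂ} (hu : 0 ≤ u.re) {n : ℕ} (hn : 2 ≤ n) : ‖(n : ℂ) ^ (-u)‖ ≤ 1 := by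
  have h2 : (2:ℝ) ≤ n := by exact_mod_cast hn
  rw [Complex.norm_natCast_cpow_of_pos (by omega)]
  exact Real.rpow_le_one_of_one_le_of_nonpos (by linarith) (by simpa using hu)

lemma sum95 : Summable (fun n : ℕ => (n : ℝ) ^ (-(9/5) : ℝ)) := by
  rw [Real.summable_nat_rpow]; norm_num

lemma Hf_bound (k : ℕ) : ∃ C > 0, ∀ s u v : ℂ, 9 / 10 ≤ s.re → 0 ≤ u.re → 0 ≤ v.re → ∀ n,
    ‖Hf k s u v n - 1‖ ≤ C * (n : ℝ) ^ (-(9/5) : ℝ) := by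
  obtain ⟨C, hC0, hC⟩ := hh_bound k
  refine ⟨C, hC0, fun s u v hs hu hv n => ?_⟩
  rw [Hf]
  split_ifs with hn
  · refine (hC _ _ _ (norm_x hs hn.two_le).1 (norm_a hu hn.two_le) (norm_a hv hn.two_le)).trans ?_
    gcongr
    calc ‖(n : ℂ) ^ (-s)‖ ^ 2 ≤ ((n : ℝ) ^ (-(9/10) : ℝ)) ^ 2 := by
          gcongr; exact (norm_x hs hn.two_le).2
      _ = _ := by
          rw [← Real.rpow_natCast, ← Real.rpow_mul (by positivity)]; norm_num
  · simp; positivity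

lemma Hf_tendsto (k : ℕ) {s u v : ℂ} (hs : 9 / 10 ≤ s.re) (hu : 0 ≤ u.re) (hv : 0 ≤ v.re) :
    Tendsto (fun n => ∏ p ∈ Nat.primesBelow n, hh k (p ^ (-s)) (p ^ (-u)) (p ^ (-v))) atTop (𝓝 (Hh k s u v)) := by
  obtain ⟨C, hC0, hC⟩ := Hf_bound k
  have h1 : Summable fun n => ‖Hf k s u v n - 1‖ :=
    Summable.of_nonneg_of_le (fun _ => norm_nonneg _) (hC s u v hs hu hv) (sum95.mul_left C)
  have h2 := (multipliable_one_add_of_summable h1).hasProd.tendsto_prod_nat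
  simp only [add_sub_cancel] at h2
  refine h2.congr fun n => ?_
  rw [Nat.primesBelow, Finset.prod_filter]
  rfl

lemma Hh_sub_one (k : ℕ) {s u v : ℂ} (hs : 9 / 10 ≤ s.re) (hu : 0 ≤ u.re) (hv : 0 ≤ v.re) :
    ‖Hh k s u v - 1‖ ≤ Real.exp (∑' n, ‖Hf k s u v n - 1‖) - 1 := by
  obtain ⟨C, hC0, hC⟩ := Hf_bound k
  have h1 : Summable fun n => ‖Hf k s u v n - 1‖ :=
    Summable.of_nonneg_of_le (fun _ => norm_nonneg _) (hC s u v hs hu hv) (sum95.mul_left C)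
  have h2 := (multipliable_one_add_of_summable h1).hasProd.tendsto_prod_nat
  simp only [add_sub_cancel] at h2
  refine le_of_tendsto ((h2.sub_const 1).norm) (Eventually.of_forall fun n => ?_)
  have h3 := Finset.norm_prod_one_add_sub_one_le (Finset.range n) (fun i => Hf k s u v i - 1)
  simp only [add_sub_cancel] at h3
  refine h3.trans ?_
  gcongr
  exact h1.sum_le_tsum _ fun _ _ => norm_nonneg _

lemma Hh_bound (k : ℕ) : ∃ C > 0, ∀ s u v : ℂ, 9 / 10 ≤ s.re → 0 ≤ u.re → 0 ≤ v.re → ‖Hh k s u v‖ ≤ C := by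
  obtain ⟨C, hC0, hC⟩ := Hf_bound k
  refine ⟨Real.exp (∑' n : ℕ, C * (n : ℝ) ^ (-(9/5) : ℝ)), Real.exp_pos _, fun s u v hs hu hv => ?_⟩
  have h1 : Summable fun n => ‖Hf k s u v n - 1‖ :=
    Summable.of_nonneg_of_le (fun _ => norm_nonneg _) (hC s u v hs hu hv) (sum95.mul_left C)
  have h2 := Hh_sub_one k hs hu hv
  have h3 : Real.exp (∑' n, ‖Hf k s u v n - 1‖) ≤ Real.exp (∑' n : ℕ, C * (n : ℝ) ^ (-(9/5) : ℝ)) := by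
    gcongr
    · exact sum95.mul_left C
    · exact hC s u v hs hu hv _
  calc ‖Hh k s u v‖ = ‖(Hh k s u v - 1) + 1‖ := by ring_nf
    _ ≤ ‖Hh k s u v - 1‖ + ‖(1:ℂ)‖ := norm_add_le _ _
    _ ≤ _ := by rw [norm_one]; linarith

lemma Hh_tendsto_one (k : ℕ) {α : Type*} {l : Filter α} {s u v : α → ℂ}
    (hs : Tendsto s l (𝓝 1)) (hu : Tendsto u l (𝓝 0)) (hv : Tendsto v l (𝓝 0))
    (hs' : ∀ᶠ i in l, 9 / 10 ≤ (s i).re) (hu' : ∀ᶠ i in l, 0 ≤ (u i).re) (hv' : ∀ᶠ i in l, 0 ≤ (v i).re) :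
    Tendsto (fun i => Hh k (s i) (u i) (v i)) l (𝓝 1) := by
  obtain ⟨C, hC0, hC⟩ := Hf_bound k
  have h1 : Tendsto (fun i => ∑' n, ‖Hf k (s i) (u i) (v i) n - 1‖) l (𝓝 (∑' _ : ℕ, (0:ℝ))) := by
    refine tendsto_tsum_of_dominated_convergence (sum95.mul_left C) ?_ ?_
    · intro n
      by_cases hn : n.Prime
      · have hn0 : (n : ℂ) ≠ 0 := by exact_mod_cast hn.ne_zero
        have x1 : ‖(n : ℂ) ^ (-(1:ℂ))‖ ≤ 3 / 5 := (norm_x (by norm_num) hn.two_le).1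
        have t1 : Tendsto (fun i => (n : ℂ) ^ (-(s i))) l (𝓝 ((n : ℂ) ^ (-(1:ℂ)))) :=
          (hs.neg).const_cpow (Or.inl hn0)
        have t2 : Tendsto (fun i => (n : ℂ) ^ (-(u i))) l (𝓝 1) := by
          have := Filter.Tendsto.const_cpow (f := fun i => -u i) (a := (n : ℂ)) hu.neg (Or.inl hn0)
          simpa using this
        have t3 : Tendsto (fun i => (n : ℂ) ^ (-(v i))) l (𝓝 1) := by
          have := Filter.Tendsto.const_cpow (f := fun i => -v i) (a := (n : ℂ)) hv.neg (Or.inl hn0)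
          simpa using this
        have hd := pow_ne_zero k (den_ne x1 (by simp : ‖(1:ℂ)‖ ≤ 1))
        have t4 : Tendsto (fun i => Hf k (s i) (u i) (v i) n) l (𝓝 (hh k ((n : ℂ) ^ (-(1:ℂ))) 1 1)) := by
          simp only [Hf, if_pos hn, hh, EE, ff]
          refine Tendsto.mul (Tendsto.mul (Tendsto.mul ?_ ?_) ?_) ?_
          · exact tendsto_const_nhds.sub ((tendsto_const_nhds.sub ((tendsto_const_nhds.sub t1).pow k)).mul ((t2.add t3).sub (t2.mul t3)))
          · exact (tendsto_const_nhds.sub ((t1.mul t2).mul t3)).pow k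
          · exact ((tendsto_const_nhds.sub (t1.mul t2)).pow k).inv₀ hd
          · exact ((tendsto_const_nhds.sub (t1.mul t3)).pow k).inv₀ hd
        rw [hh_one k x1] at t4
        have := (t4.sub_const 1).norm
        simpa using this
      · simp only [Hf, if_neg hn, sub_self, norm_zero]; exact tendsto_const_nhds
    · filter_upwards [hs', hu', hv'] with i a b c n
      rw [norm_norm]
      exact hC _ _ _ a b c n
  rw [tsum_zero] at h1
  have h2 : Tendsto (fun i => Real.exp (∑' n, ‖Hf k (s i) (u i) (v i) n - 1‖) - 1) l (𝓝 0) := by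
    have := (Real.continuous_exp.tendsto 0).comp h1
    simpa using this.sub_const 1
  rw [tendsto_iff_norm_sub_tendsto_zero]
  refine squeeze_zero' (Eventually.of_forall fun _ => norm_nonneg _) ?_ h2
  filter_upwards [hs', hu', hv'] with i a b c
  exact Hh_sub_one k a b c

/-- Euler product for the double sum -/
lemma EE_tendsto (k : ℕ) {s u v : ℂ} (hs : 9 / 10 ≤ s.re) (hu : 0 ≤ u.re) (hv : 0 ≤ v.re)
    (h1 : 1 < (s + u).re) (h2 : 1 < (s + v).re) :
    Tendsto (fun n => ∏ p ∈ Nat.primesBelow n, EE k (p ^ (-s)) (p ^ (-u)) (p ^ (-v))) atTop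
      (𝓝 (riemannZeta (s + u + v) ^ k * (riemannZeta (s + u) ^ k)⁻¹ * (riemannZeta (s + v) ^ k)⁻¹ * Hh k s u v)) := by
  have z1 := (riemannZeta_eulerProduct h1).pow k
  have z2 := (riemannZeta_eulerProduct h2).pow k
  have z3 := (riemannZeta_eulerProduct (s := s + u + v) (by simp at h1 hv ⊢; linarith)).pow k
  have n1 := pow_ne_zero k (riemannZeta_ne_zero_of_one_le_re h1.le)
  have n2 := pow_ne_zero k (riemannZeta_ne_zero_of_one_le_re h2.le)
  refine (((z3.mul (z1.inv₀ n1)).mul (z2.inv₀ n2)).mul (Hf_tendsto k hs hu hv)).congr fun n => ?_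
  simp only [← Finset.prod_pow, ← Finset.prod_inv_distrib, ← Finset.prod_mul_distrib]
  refine Finset.prod_congr rfl fun p hp => ?_
  have hp := Nat.prime_of_mem_primesBelow hp
  have hp0 : (p : ℂ) ≠ 0 := by exact_mod_cast hp.ne_zero
  have x1 := (norm_x hs hp.two_le).1
  have a1 := norm_a hu hp.two_le
  have b1 := norm_a hv hp.two_le
  have e1 : (p : ℂ) ^ (-(s + u)) = p ^ (-s) * p ^ (-u) := by rw [← Complex.cpow_add _ _ hp0]; congr 1; ring
  have e2 : (p : ℂ) ^ (-(s + v)) = p ^ (-s) * p ^ (-v) := by rw [← Complex.cpow_add _ _ hp0]; congr 1; ring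
  have e3 : (p : ℂ) ^ (-(s + u + v)) = p ^ (-s) * p ^ (-u) * p ^ (-v) := by
    rw [← Complex.cpow_add _ _ hp0, ← Complex.cpow_add _ _ hp0]; congr 1; ring
  rw [e1, e2, e3, hh]
  have d1 := den_ne x1 a1
  have d2 := den_ne x1 b1
  have d3 : 1 - (p : ℂ) ^ (-s) * p ^ (-u) * p ^ (-v) ≠ 0 := by
    rw [mul_assoc]
    exact den_ne x1 (by rw [norm_mul]; exact mul_le_one₀ a1 (norm_nonneg _) b1)
  generalize (p : ℂ) ^ (-s) = x at *
  generalize (p : ℂ) ^ (-u) = a at *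
  generalize (p : ℂ) ^ (-v) = b at *
  generalize EE k x a b = E0
  simp only [inv_pow, inv_inv]
  field_simp

end Loc

end PartB3

section PartB4

namespace Sel
open Filter Topology Loc MeasureTheory

lemma comb {R : Type*} [CommRing R] (S : Finset ℕ) (f x y : ℕ → R) :
    ∑ A ∈ S.powerset, ∑ B ∈ S.powerset, (∏ p ∈ A ∪ B, f p) * (∏ p ∈ A, x p) * (∏ p ∈ B, y p) =
      ∏ p ∈ S, (1 + f p * (x p + y p + x p * y p)) := by
  induction S using Finset.induction_on with
  | empty => simp
  | insert q S hq ih =>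
    rw [Finset.prod_insert hq, ← ih, Finset.sum_powerset_insert hq]
    simp_rw [Finset.sum_powerset_insert hq]
    simp only [← Finset.sum_add_distrib, Finset.mul_sum]
    refine Finset.sum_congr rfl fun A hA => Finset.sum_congr rfl fun B hB => ?_
    have hA' : q ∉ A := fun h => hq (Finset.mem_powerset.mp hA h)
    have hB' : q ∉ B := fun h => hq (Finset.mem_powerset.mp hB h)
    have hAB : q ∉ A ∪ B := by simp [hA', hB']
    rw [Finset.insert_union, Finset.union_insert, Finset.insert_union, Finset.union_insert, Finset.insert_idem]
    rw [Finset.prod_insert hAB, Finset.prod_insert hA', Finset.prod_insert hB']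
    ring

lemma pf_prod {Y : ℕ} {A : Finset ℕ} (hA : A ∈ (Nat.primesBelow Y).powerset) : (∏ p ∈ A, p).primeFactors = A :=
  Nat.primeFactors_prod fun _ hp => Nat.prime_of_mem_primesBelow (Finset.mem_powerset.mp hA hp)

lemma sf_prod {Y : ℕ} {A : Finset ℕ} (hA : A ∈ (Nat.primesBelow Y).powerset) : Squarefree (∏ p ∈ A, p) := by
  refine Finset.squarefree_prod_of_pairwise_isCoprime ?_ ?_
  · intro p hp q hq hpq
    have h1 := Nat.prime_of_mem_primesBelow (Finset.mem_powerset.mp hA hp)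
    have h2 := Nat.prime_of_mem_primesBelow (Finset.mem_powerset.mp hA hq)
    exact Nat.coprime_iff_isRelPrime.mp ((Nat.coprime_primes h1 h2).mpr hpq)
  · intro p hp
    exact (Nat.prime_of_mem_primesBelow (Finset.mem_powerset.mp hA hp)).prime.squarefree

lemma conv {R : Type*} [AddCommMonoid R] (F : ℕ → R) (M Y : ℕ) (hF : ∀ d, F d ≠ 0 → Squarefree d ∧ d ≤ M) (hY : M < Y) :
    ∑ d ∈ Finset.Icc 1 M, F d = ∑ A ∈ (Nat.primesBelow Y).powerset, F (∏ p ∈ A, p) := by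
  have hinj : Set.InjOn (fun A : Finset ℕ => ∏ p ∈ A, p) ((Nat.primesBelow Y).powerset : Set (Finset ℕ)) := by
    intro A hA B hB h
    have := congrArg Nat.primeFactors h
    simp only at this
    rwa [pf_prod hA, pf_prod hB] at this
  rw [← Finset.sum_image (f := F) hinj]
  refine Finset.sum_congr_of_eq_on_inter ?_ ?_ (fun _ _ _ => rfl)
  · intro d hd hd'
    by_contra h
    obtain ⟨h1, h2⟩ := hF d h
    apply hd'
    rw [Finset.mem_image]
    refine ⟨d.primeFactors, ?_, Nat.prod_primeFactors_of_squarefree h1⟩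
    rw [Finset.mem_powerset]
    intro p hp
    rw [Nat.mem_primesBelow]
    exact ⟨lt_of_le_of_lt ((Nat.le_of_mem_primeFactors hp).trans h2) hY, Nat.prime_of_mem_primeFactors hp⟩
  · intro d hd hd'
    by_contra h
    obtain ⟨h1, h2⟩ := hF d h
    exact hd' (Finset.mem_Icc.mpr ⟨Nat.one_le_iff_ne_zero.mpr h1.ne_zero, h2⟩)

/-- Selberg weights with level `exp T`. -/
noncomputable def wt (k : ℕ) (T : ℝ) (d : ℕ) : ℝ := selbergWeight k (Real.exp T) d

lemma wt_eq {k : ℕ} (hk : 1 ≤ k) {T : ℝ} {d : ℕ} (hd : Squarefree d) :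
    wt k T d = (ArithmeticFunction.moebius d : ℤ) * (max (T - Real.log d) 0 / T) ^ k := by
  have hd0 : (0:ℝ) < d := by exact_mod_cast Nat.pos_of_ne_zero hd.ne_zero
  have e : (d : ℝ) ≤ Real.exp T ↔ Real.log d ≤ T := (Real.log_le_iff_le_exp hd0).symm
  rw [wt, selbergWeight]
  split_ifs with h
  · have h2 := e.mp h.2
    rw [Real.log_exp, Real.log_div (Real.exp_pos _).ne' hd0.ne', Real.log_exp, max_eq_left (by linarith)]
  · have h2 : ¬ Real.log d ≤ T := fun h' => h ⟨hd, e.mpr h'⟩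
    rw [max_eq_right (by linarith), zero_div, zero_pow (by omega), mul_zero]

lemma wt_ne {k : ℕ} {T : ℝ} {d : ℕ} (h : wt k T d ≠ 0) : Squarefree d ∧ d ≤ ⌊Real.exp T⌋₊ := by
  rw [wt, selbergWeight] at h
  split_ifs at h with h1
  · exact ⟨h1.1, Nat.le_floor h1.2⟩
  · exact absurd rfl h

noncomputable def QQ (k : ℕ) (T : ℝ) (s : ℂ) : ℂ :=
  ∑ d ∈ Finset.Icc 1 ⌊Real.exp T⌋₊, ∑ e ∈ Finset.Icc 1 ⌊Real.exp T⌋₊,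
    (wt k T d : ℂ) * (wt k T e : ℂ) * ∏ p ∈ d.primeFactors ∪ e.primeFactors, ff k ((p : ℂ) ^ (-s))

lemma QQ_eq (k : ℕ) (T : ℝ) (s : ℂ) (Y : ℕ) (hY : ⌊Real.exp T⌋₊ < Y) :
    QQ k T s = ∑ A ∈ (Nat.primesBelow Y).powerset, ∑ B ∈ (Nat.primesBelow Y).powerset,
      (wt k T (∏ p ∈ A, p) : ℂ) * (wt k T (∏ p ∈ B, p) : ℂ) * ∏ p ∈ A ∪ B, ff k ((p : ℂ) ^ (-s)) := by
  rw [QQ, conv _ _ Y ?_ hY]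
  · refine Finset.sum_congr rfl fun A hA => ?_
    rw [conv _ _ Y ?_ hY]
    · refine Finset.sum_congr rfl fun B hB => ?_
      rw [pf_prod hA, pf_prod hB]
    · intro d hd
      refine wt_ne (k := k) (T := T) fun h => hd ?_
      rw [h]; simp
  · intro d hd
    refine wt_ne (k := k) (T := T) fun h => hd ?_
    simp [h]

lemma mu_prod {Y : ℕ} {A : Finset ℕ} (hA : A ∈ (Nat.primesBelow Y).powerset) :
    ArithmeticFunction.moebius (∏ p ∈ A, p) = (-1) ^ A.card := by
  rw [ArithmeticFunction.moebius_apply_of_squarefree (sf_prod hA)]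
  congr 1
  rw [← (ArithmeticFunction.cardDistinctFactors_eq_cardFactors_iff_squarefree (sf_prod hA).ne_zero).mpr (sf_prod hA),
    ArithmeticFunction.cardDistinctFactors_apply]
  conv_rhs => rw [← pf_prod hA]
  rfl

lemma log_prod' {Y : ℕ} {A : Finset ℕ} (hA : A ∈ (Nat.primesBelow Y).powerset) :
    Real.log ((∏ p ∈ A, p : ℕ) : ℝ) = ∑ p ∈ A, Real.log p := by
  push_cast
  rw [Real.log_prod]
  intro p hp
  have := (Nat.prime_of_mem_primesBelow (Finset.mem_powerset.mp hA hp)).ne_zero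
  exact_mod_cast this

/-- trivial bound -/
lemma wt_rankin {k : ℕ} (hk : 1 ≤ k) {T : ℝ} (hT : 0 < T) {δ : ℝ} (hδ : 0 ≤ δ) {Y : ℕ} {A : Finset ℕ}
    (hA : A ∈ (Nat.primesBelow Y).powerset) :
    |wt k T (∏ p ∈ A, p)| ≤ Real.exp (δ * T) * ∏ p ∈ A, (p : ℝ) ^ (-δ) := by
  have e : ∏ p ∈ A, (p : ℝ) ^ (-δ) = Real.exp (- δ * Real.log ((∏ p ∈ A, p : ℕ) : ℝ)) := by
    rw [log_prod' hA, Finset.mul_sum, Real.exp_sum]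
    refine Finset.prod_congr rfl fun p hp => ?_
    have := (Nat.prime_of_mem_primesBelow (Finset.mem_powerset.mp hA hp)).pos
    rw [Real.rpow_def_of_pos (by exact_mod_cast this), mul_comm]
  rw [e, ← Real.exp_add, wt_eq hk (sf_prod hA), mu_prod hA, abs_mul]
  set L := Real.log ((∏ p ∈ A, p : ℕ) : ℝ)
  have hL : 0 ≤ L := Real.log_natCast_nonneg _
  have h1 : |(((-1 : ℤ) ^ A.card : ℤ) : ℝ)| = 1 := by push_cast; simp
  rw [h1, one_mul]
  by_cases h : T ≤ L
  · rw [max_eq_right (by linarith), zero_div, zero_pow (by omega), abs_zero]; positivity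
  · have : 0 ≤ max (T - L) 0 / T := by positivity
    rw [abs_of_nonneg (by positivity)]
    have h2 : max (T - L) 0 / T ≤ 1 := by
      rw [div_le_one hT, max_le_iff]; constructor <;> linarith
    refine (pow_le_one₀ this h2).trans ?_
    apply Real.one_le_exp
    nlinarith

lemma QQ_rankin {k : ℕ} (hk : 1 ≤ k) : ∃ C > 0, ∀ T > 0, ∀ s : ℂ, 9 / 10 ≤ s.re →
    ‖QQ k T s‖ ≤ C * Real.exp (3 / 10 * T) := by
  set K : ℝ := k * 2 ^ k
  have hK : 0 ≤ K := by positivity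
  have hsum : Summable (fun n : ℕ => 3 * K * (n : ℝ) ^ (-(21/20) : ℝ)) := by
    apply Summable.mul_left
    rw [Real.summable_nat_rpow]; norm_num
  refine ⟨Real.exp (∑' n : ℕ, 3 * K * (n : ℝ) ^ (-(21/20) : ℝ)), Real.exp_pos _, fun T hT s hs => ?_⟩
  set S := Nat.primesBelow (⌊Real.exp T⌋₊ + 1)
  rw [QQ_eq k T s _ (Nat.lt_succ_self _)]
  set E := Real.exp (3 / 20 * T)
  have h1 : ‖∑ A ∈ S.powerset, ∑ B ∈ S.powerset,
      (wt k T (∏ p ∈ A, p) : ℂ) * (wt k T (∏ p ∈ B, p) : ℂ) * ∏ p ∈ A ∪ B, ff k ((p : ℂ) ^ (-s))‖ ≤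
      E ^ 2 * ∑ A ∈ S.powerset, ∑ B ∈ S.powerset, (∏ p ∈ A ∪ B, ‖ff k ((p : ℂ) ^ (-s))‖) *
        (∏ p ∈ A, (p : ℝ) ^ (-(3/20) : ℝ)) * (∏ p ∈ B, (p : ℝ) ^ (-(3/20) : ℝ)) := by
    simp only [Finset.mul_sum]
    refine (norm_sum_le _ _).trans (Finset.sum_le_sum fun A hA => (norm_sum_le _ _).trans (Finset.sum_le_sum fun B hB => ?_))
    rw [norm_mul, norm_mul, norm_prod, Complex.norm_real, Complex.norm_real, Real.norm_eq_abs, Real.norm_eq_abs]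
    have a := wt_rankin hk hT (by norm_num : (0:ℝ) ≤ 3/20) hA
    have b := wt_rankin hk hT (by norm_num : (0:ℝ) ≤ 3/20) hB
    calc _ ≤ (E * ∏ p ∈ A, (p : ℝ) ^ (-(3/20) : ℝ)) * (E * ∏ p ∈ B, (p : ℝ) ^ (-(3/20) : ℝ)) * ∏ p ∈ A ∪ B, ‖ff k ((p : ℂ) ^ (-s))‖ := by
          gcongr
      _ = _ := by ring
  refine h1.trans ?_
  rw [comb]
  have h2 : E ^ 2 = Real.exp (3 / 10 * T) := by
    rw [← Real.exp_nat_mul]; congr 1; push_cast; ring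
  rw [h2, mul_comm]
  gcongr
  have h3 : ∀ p ∈ S, ‖ff k ((p : ℂ) ^ (-s))‖ * ((p : ℝ) ^ (-(3/20) : ℝ) + (p : ℝ) ^ (-(3/20) : ℝ) + (p : ℝ) ^ (-(3/20) : ℝ) * (p : ℝ) ^ (-(3/20) : ℝ)) ≤
      3 * K * (p : ℝ) ^ (-(21/20) : ℝ) := by
    intro p hp
    have hp := Nat.prime_of_mem_primesBelow hp
    have hp0 : (0:ℝ) < p := by exact_mod_cast hp.pos
    have hp1 : (1:ℝ) ≤ p := by exact_mod_cast hp.one_le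
    have x1 := norm_x hs hp.two_le
    have f1 := ff_norm k _ (x1.1.trans (by norm_num))
    have a1 : (p : ℝ) ^ (-(3/20) : ℝ) ≤ 1 := Real.rpow_le_one_of_one_le_of_nonpos hp1 (by norm_num)
    have a0 : 0 < (p : ℝ) ^ (-(3/20) : ℝ) := by positivity
    have e : (p : ℝ) ^ (-(21/20) : ℝ) = (p : ℝ) ^ (-(9/10) : ℝ) * (p : ℝ) ^ (-(3/20) : ℝ) := by
      rw [← Real.rpow_add hp0]; norm_num
    rw [e]
    calc _ ≤ (K * (p : ℝ) ^ (-(9/10) : ℝ)) * (3 * (p : ℝ) ^ (-(3/20) : ℝ)) := by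
          gcongr
          · exact f1.trans (by gcongr; exact x1.2)
          · nlinarith
      _ = _ := by ring
  calc _ ≤ ∏ p ∈ S, Real.exp (3 * K * (p : ℝ) ^ (-(21/20) : ℝ)) := by
        refine Finset.prod_le_prod (fun p _ => by positivity) fun p hp => ?_
        have := Real.add_one_le_exp (3 * K * (p : ℝ) ^ (-(21/20) : ℝ))
        have := h3 p hp
        linarith
    _ = Real.exp (∑ p ∈ S, 3 * K * (p : ℝ) ^ (-(21/20) : ℝ)) := (Real.exp_sum _ _).symm
    _ ≤ _ := by
        gcongr
        exact hsum.sum_le_tsum _ fun _ _ => by positivity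

end Sel

end PartB4

section PartB4b

namespace Sel
open Filter Topology Loc MeasureTheory Complex Lap

noncomputable def al (k : ℕ) (T N : ℝ) (A : Finset ℕ) (ξ : ℝ) : ℂ :=
  cexp ((T / N : ℝ) * vl 3 ξ) * (vl 3 ξ ^ (k + 1))⁻¹ * ∏ p ∈ A, (-((p : ℂ) ^ (-(vl 3 ξ / N))))

lemma al_eq (k : ℕ) (T : ℝ) {N : ℝ} (hN : 0 < N) {Y : ℕ} {A : Finset ℕ} (hA : A ∈ (Nat.primesBelow Y).powerset) (ξ : ℝ) :
    al k T N A ξ = (-1) ^ A.card * (cexp (((T - Real.log ((∏ p ∈ A, p : ℕ) : ℝ)) / N : ℝ) * vl 3 ξ) * (vl 3 ξ ^ (k + 1))⁻¹) := by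
  rw [al, Finset.prod_neg, log_prod' hA]
  have hN' : (N : ℂ) ≠ 0 := by exact_mod_cast hN.ne'
  have e : ∏ p ∈ A, ((p : ℂ) ^ (-(vl 3 ξ / N))) = cexp (-(vl 3 ξ / N) * ((∑ p ∈ A, Real.log p : ℝ) : ℂ)) := by
    push_cast
    rw [Finset.mul_sum, Complex.exp_sum]
    refine Finset.prod_congr rfl fun p hp => ?_
    have := (Nat.prime_of_mem_primesBelow (Finset.mem_powerset.mp hA hp)).ne_zero
    rw [Complex.cpow_def_of_ne_zero (by exact_mod_cast this), ← Complex.natCast_log, mul_comm]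
  rw [e]
  have e2 : cexp (((T - ∑ p ∈ A, Real.log p) / N : ℝ) * vl 3 ξ) =
      cexp ((T / N : ℝ) * vl 3 ξ) * cexp (-(vl 3 ξ / N) * ((∑ p ∈ A, Real.log p : ℝ) : ℂ)) := by
    rw [← Complex.exp_add]; congr 1
    generalize (∑ p ∈ A, Real.log p) = L
    push_cast; field_simp; ring
  rw [e2]; ring

lemma base_int (k : ℕ) (hk : 1 ≤ k) (x : ℝ) : Integrable (fun ξ : ℝ => cexp (x * vl 3 ξ) * (vl 3 ξ ^ (k + 1))⁻¹) := by
  refine Integrable.bdd_mul (c := Real.exp (x * 3)) (vl_inv_int (by norm_num) k hk) ?_ (Eventually.of_forall fun ξ => ?_)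
  · apply Continuous.aestronglyMeasurable
    have := vl_cont 3
    fun_prop
  · rw [Complex.norm_exp]; simp

lemma al_int (k : ℕ) (hk : 1 ≤ k) (T : ℝ) {N : ℝ} (hN : 0 < N) {Y : ℕ} {A : Finset ℕ} (hA : A ∈ (Nat.primesBelow Y).powerset) :
    Integrable (al k T N A) := by
  have : al k T N A = _ := funext (al_eq k T hN hA)
  rw [this]
  exact (base_int k hk _).const_mul _

noncomputable def cc (k : ℕ) (T N : ℝ) : ℝ := k.factorial * (N / T) ^ k / (2 * Real.pi)

lemma wt_int (k : ℕ) (hk : 1 ≤ k) {T : ℝ} (hT : 0 < T) {N : ℝ} (hN : 0 < N) {Y : ℕ} {A : Finset ℕ} (hA : A ∈ (Nat.primesBelow Y).powerset) :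
    (wt k T (∏ p ∈ A, p) : ℂ) = cc k T N * ∫ ξ, al k T N A ξ := by
  have : al k T N A = _ := funext (al_eq k T hN hA)
  rw [this, integral_const_mul, perron (by norm_num) k hk, wt_eq hk (sf_prod hA), mu_prod hA]
  generalize Real.log ((∏ p ∈ A, p : ℕ) : ℝ) = L
  have e : max ((T - L) / N) 0 = max (T - L) 0 / N := by
    rw [← max_div_div_right hN.le, zero_div]
  rw [e, cc]
  generalize max (T - L) 0 = M
  have hN' : (N : ℂ) ≠ 0 := by exact_mod_cast hN.ne'
  have hT' : (T : ℂ) ≠ 0 := by exact_mod_cast hT.ne'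
  have hp' : (Real.pi : ℂ) ≠ 0 := by exact_mod_cast Real.pi_ne_zero
  have h1 : (k.factorial : ℂ) ≠ 0 := by exact_mod_cast k.factorial_ne_zero
  push_cast
  rw [div_pow, div_pow, div_pow]
  field_simp

/-- kernel -/
noncomputable def ker (k : ℕ) (τ : ℝ) (z : ℝ × ℝ) : ℂ :=
  (cexp (τ * vl 3 z.1) * (vl 3 z.1 ^ (k + 1))⁻¹) * (cexp (τ * vl 3 z.2) * (vl 3 z.2 ^ (k + 1))⁻¹)

lemma ker_int (k : ℕ) (hk : 1 ≤ k) (τ : ℝ) : Integrable (ker k τ) :=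
  (base_int k hk τ).mul_prod (base_int k hk τ)

lemma QQ_fin (k : ℕ) (hk : 1 ≤ k) {T : ℝ} (hT : 0 < T) {N : ℝ} (hN : 0 < N) (s : ℂ) (Y : ℕ) (hY : ⌊Real.exp T⌋₊ < Y) :
    QQ k T s = (cc k T N) ^ 2 * ∫ z : ℝ × ℝ, ker k (T / N) z * ∏ p ∈ Nat.primesBelow Y,
      EE k ((p : ℂ) ^ (-s)) ((p : ℂ) ^ (-(vl 3 z.1 / N))) ((p : ℂ) ^ (-(vl 3 z.2 / N))) := by
  set S := Nat.primesBelow Y with hS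
  have key : ∀ z : ℝ × ℝ, ker k (T / N) z * ∏ p ∈ S,
      EE k ((p : ℂ) ^ (-s)) ((p : ℂ) ^ (-(vl 3 z.1 / N))) ((p : ℂ) ^ (-(vl 3 z.2 / N))) =
      ∑ A ∈ S.powerset, ∑ B ∈ S.powerset, (∏ p ∈ A ∪ B, ff k ((p : ℂ) ^ (-s))) * (al k T N A z.1 * al k T N B z.2) := by
    intro z
    have h := comb S (fun p => ff k ((p : ℂ) ^ (-s))) (fun p => -((p : ℂ) ^ (-(vl 3 z.1 / N)))) (fun p => -((p : ℂ) ^ (-(vl 3 z.2 / N))))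
    have e : ∏ p ∈ S, EE k ((p : ℂ) ^ (-s)) ((p : ℂ) ^ (-(vl 3 z.1 / N))) ((p : ℂ) ^ (-(vl 3 z.2 / N))) =
        ∏ p ∈ S, (1 + ff k ((p : ℂ) ^ (-s)) * (-((p : ℂ) ^ (-(vl 3 z.1 / N))) + -((p : ℂ) ^ (-(vl 3 z.2 / N))) +
          -((p : ℂ) ^ (-(vl 3 z.1 / N))) * -((p : ℂ) ^ (-(vl 3 z.2 / N))))) := by
      refine Finset.prod_congr rfl fun p _ => ?_
      rw [EE]; ring
    rw [e, ← h, Finset.mul_sum]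
    refine Finset.sum_congr rfl fun A _ => ?_
    rw [Finset.mul_sum]
    refine Finset.sum_congr rfl fun B _ => ?_
    rw [al, al, ker]; ring
  simp_rw [key]
  rw [integral_finsetSum, QQ_eq k T s Y hY, Finset.mul_sum]
  · refine Finset.sum_congr rfl fun A hA => ?_
    rw [integral_finsetSum, Finset.mul_sum]
    · refine Finset.sum_congr rfl fun B hB => ?_
      rw [integral_const_mul, wt_int k hk hT hN hA, wt_int k hk hT hN hB, Measure.volume_eq_prod, integral_prod_mul]
      ring
    · intro B hB
      exact ((al_int k hk T hN hA).mul_prod (al_int k hk T hN hB)).const_mul _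
  · intro A hA
    refine integrable_finsetSum _ fun B hB => ?_
    exact ((al_int k hk T hN hA).mul_prod (al_int k hk T hN hB)).const_mul _

noncomputable def Eul (k : ℕ) (s u v : ℂ) : ℂ :=
  riemannZeta (s + u + v) ^ k * (riemannZeta (s + u) ^ k)⁻¹ * (riemannZeta (s + v) ^ k)⁻¹ * Hh k s u v

lemma EE_prod_bound (k : ℕ) {s : ℂ} {c : ℝ} (hs : 9 / 10 ≤ s.re) (hc : 0 < c) (h1 : 1 < s.re + c) :
    ∃ C, ∀ u v : ℂ, u.re = c → v.re = c → ∀ n, ‖∏ p ∈ Nat.primesBelow n, EE k ((p : ℂ) ^ (-s)) ((p : ℂ) ^ (-u)) ((p : ℂ) ^ (-v))‖ ≤ C := by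
  set K : ℝ := k * 2 ^ k
  have hK : 0 ≤ K := by positivity
  have hsum : Summable (fun n : ℕ => 3 * K * (n : ℝ) ^ (-(s.re + c) : ℝ)) := by
    apply Summable.mul_left
    rw [Real.summable_nat_rpow]; linarith
  refine ⟨Real.exp (∑' n : ℕ, 3 * K * (n : ℝ) ^ (-(s.re + c) : ℝ)), fun u v hu hv n => ?_⟩
  rw [norm_prod]
  calc _ ≤ ∏ p ∈ Nat.primesBelow n, Real.exp (3 * K * (p : ℝ) ^ (-(s.re + c) : ℝ)) := by
        refine Finset.prod_le_prod (fun p _ => norm_nonneg _) fun p hp => ?_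
        have hp := Nat.prime_of_mem_primesBelow hp
        have hp0 : (0:ℝ) < p := by exact_mod_cast hp.pos
        have hp1 : (1:ℝ) ≤ p := by exact_mod_cast hp.one_le
        have x1 := norm_x hs hp.two_le
        have f1 := ff_norm k _ (x1.1.trans (by norm_num))
        have a1 : (p : ℝ) ^ (-c) ≤ 1 := Real.rpow_le_one_of_one_le_of_nonpos hp1 (by linarith)
        have ea : ‖(p : ℂ) ^ (-u)‖ = (p : ℝ) ^ (-c) := by rw [Complex.norm_natCast_cpow_of_pos hp.pos]; simp [hu]
        have eb : ‖(p : ℂ) ^ (-v)‖ = (p : ℝ) ^ (-c) := by rw [Complex.norm_natCast_cpow_of_pos hp.pos]; simp [hv]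
        have ex : ‖(p : ℂ) ^ (-s)‖ = (p : ℝ) ^ (-s.re) := by rw [Complex.norm_natCast_cpow_of_pos hp.pos]; simp
        have a0 : 0 < (p : ℝ) ^ (-c) := by positivity
        have h3 : ‖(p : ℂ) ^ (-u) + (p : ℂ) ^ (-v) - (p : ℂ) ^ (-u) * (p : ℂ) ^ (-v)‖ ≤ 3 * (p : ℝ) ^ (-c) := by
          refine (norm_sub_le _ _).trans ?_
          refine (add_le_add_left (norm_add_le _ _) _).trans ?_
          rw [norm_mul, ea, eb]; nlinarith
        have h4 := Real.add_one_le_exp (3 * K * (p : ℝ) ^ (-(s.re + c)))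
        refine le_trans ?_ h4
        rw [EE]
        refine (norm_sub_le _ _).trans ?_
        rw [norm_one, norm_mul, add_comm]
        refine add_le_add ?_ le_rfl
        rw [neg_add, Real.rpow_add hp0]
        calc _ ≤ (K * (p : ℝ) ^ (-s.re)) * (3 * (p : ℝ) ^ (-c)) := by
              rw [ex] at f1
              gcongr
          _ = _ := by ring
    _ = Real.exp (∑ p ∈ Nat.primesBelow n, 3 * K * (p : ℝ) ^ (-(s.re + c) : ℝ)) := (Real.exp_sum _ _).symm
    _ ≤ _ := by
        gcongr
        exact hsum.sum_le_tsum _ fun _ _ => by positivity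

lemma ker_cont (k : ℕ) (τ : ℝ) : Continuous (ker k τ) := by
  have h : Continuous (fun ξ : ℝ => cexp (τ * vl 3 ξ) * (vl 3 ξ ^ (k + 1))⁻¹) := by
    have := vl_cont 3
    refine Continuous.mul (by fun_prop) ?_
    exact Continuous.inv₀ (this.pow _) fun ξ => pow_ne_zero _ (vl_ne (by norm_num) ξ)
  exact (h.comp continuous_fst).mul (h.comp continuous_snd)

lemma QQ_full (k : ℕ) (hk : 1 ≤ k) {T : ℝ} (hT : 0 < T) {N : ℝ} (hN : 0 < N) {s : ℂ} (hs : 9 / 10 ≤ s.re) (hs1 : 1 < s.re + 3 / N) :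
    QQ k T s = (cc k T N) ^ 2 * ∫ z : ℝ × ℝ, ker k (T / N) z * Eul k s (vl 3 z.1 / N) (vl 3 z.2 / N) := by
  obtain ⟨C, hC⟩ := EE_prod_bound k hs (c := 3 / N) (by positivity) hs1
  have re : ∀ ξ, (vl 3 ξ / N).re = 3 / N := by intro ξ; rw [Complex.div_ofReal_re, vl_re]
  have ht : Tendsto (fun Y : ℕ => ∫ z : ℝ × ℝ, ker k (T / N) z * ∏ p ∈ Nat.primesBelow Y,
      EE k ((p : ℂ) ^ (-s)) ((p : ℂ) ^ (-(vl 3 z.1 / N))) ((p : ℂ) ^ (-(vl 3 z.2 / N)))) atTop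
      (𝓝 (∫ z : ℝ × ℝ, ker k (T / N) z * Eul k s (vl 3 z.1 / N) (vl 3 z.2 / N))) := by
    refine tendsto_integral_of_dominated_convergence (fun z => ‖ker k (T / N) z‖ * C) ?_ ?_ ?_ ?_
    · intro Y
      apply Continuous.aestronglyMeasurable
      refine (ker_cont k _).mul (continuous_finsetProd _ fun p hp => ?_)
      have hp : (p : ℂ) ≠ 0 := by exact_mod_cast (Nat.prime_of_mem_primesBelow hp).ne_zero
      have h : Continuous (fun ξ : ℝ => (p : ℂ) ^ (-(vl 3 ξ / N))) := by
        have := vl_cont 3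
        exact Continuous.const_cpow (by fun_prop) (Or.inl hp)
      have h1 := h.comp continuous_fst (X := ℝ × ℝ)
      have h2 := h.comp continuous_snd (X := ℝ × ℝ)
      simp only [Function.comp_def] at h1 h2
      unfold EE
      fun_prop
    · exact (ker_int k hk _).norm.mul_const C
    · intro Y
      refine Eventually.of_forall fun z => ?_
      rw [norm_mul]
      gcongr
      exact hC _ _ (re _) (re _) Y
    · refine Eventually.of_forall fun z => ?_
      refine Tendsto.const_mul _ ?_
      have hpos : 0 ≤ 3 / N := by positivity
      refine EE_tendsto k hs ?_ ?_ ?_ ?_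
      · rw [re]; exact hpos
      · rw [re]; exact hpos
      · rw [add_re, re]; exact hs1
      · rw [add_re, re]; exact hs1
  have ht2 := ht.const_mul ((cc k T N : ℂ) ^ 2)
  refine tendsto_nhds_unique ?_ ht2
  refine tendsto_const_nhds.congr' ?_
  filter_upwards [eventually_gt_atTop ⌊Real.exp T⌋₊] with Y hY
  exact QQ_fin k hk hT hN s Y hY

end Sel

end PartB4b

section PartB5

namespace Sel
open Filter Topology Loc MeasureTheory Complex Lap

noncomputable def DD (z : ℝ × ℝ) : ℝ := (1 + |z.1|)⁻¹ * (1 + |z.2|)⁻¹ * (1 + |z.1 + z.2|) ^ (-(1/2) : ℝ)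

lemma DD_nonneg (z : ℝ × ℝ) : 0 ≤ DD z := by unfold DD; positivity

lemma DD_cont : Continuous DD := by
  unfold DD
  refine Continuous.mul (Continuous.mul ?_ ?_) ?_
  · exact Continuous.inv₀ (by fun_prop) fun z => by positivity
  · exact Continuous.inv₀ (by fun_prop) fun z => by positivity
  · exact Continuous.rpow_const (by fun_prop) fun z => Or.inl (by positivity)

lemma amgm {a b c : ℝ} (ha : 0 < a) (hb : 0 < b) (hc : 0 < c) : a⁻¹ * b⁻¹ * c ^ (-(1/2) : ℝ) ≤
    a ^ (-(5/4) : ℝ) * b ^ (-(5/4) : ℝ) + a ^ (-(5/4) : ℝ) * c ^ (-(5/4) : ℝ) + b ^ (-(5/4) : ℝ) * c ^ (-(5/4) : ℝ) := by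
  have h := Real.geom_mean_le_arith_mean3_weighted (w₁ := 3/5) (w₂ := 1/5) (w₃ := 1/5)
    (p₁ := a ^ (-(5/4) : ℝ) * b ^ (-(5/4) : ℝ)) (p₂ := a ^ (-(5/4) : ℝ) * c ^ (-(5/4) : ℝ)) (p₃ := b ^ (-(5/4) : ℝ) * c ^ (-(5/4) : ℝ))
    (by norm_num) (by norm_num) (by norm_num) (by positivity) (by positivity) (by positivity) (by norm_num)
  have e : (a ^ (-(5/4) : ℝ) * b ^ (-(5/4) : ℝ)) ^ (3/5:ℝ) * (a ^ (-(5/4) : ℝ) * c ^ (-(5/4) : ℝ)) ^ (1/5:ℝ) * (b ^ (-(5/4) : ℝ) * c ^ (-(5/4) : ℝ)) ^ (1/5:ℝ) = a⁻¹ * b⁻¹ * c ^ (-(1/2) : ℝ) := by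
    rw [← Real.rpow_neg_one a, ← Real.rpow_neg_one b]
    rw [Real.mul_rpow (by positivity) (by positivity), Real.mul_rpow (by positivity) (by positivity), Real.mul_rpow (by positivity) (by positivity)]
    simp only [← Real.rpow_mul ha.le, ← Real.rpow_mul hb.le, ← Real.rpow_mul hc.le]
    have ea : a ^ (-1:ℝ) = a ^ (-(5/4) * (3/5) : ℝ) * a ^ (-(5/4) * (1/5) : ℝ) := by rw [← Real.rpow_add ha]; norm_num
    have eb : b ^ (-1:ℝ) = b ^ (-(5/4) * (3/5) : ℝ) * b ^ (-(5/4) * (1/5) : ℝ) := by rw [← Real.rpow_add hb]; norm_num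
    have ec : c ^ (-(1/2):ℝ) = c ^ (-(5/4) * (1/5) : ℝ) * c ^ (-(5/4) * (1/5) : ℝ) := by rw [← Real.rpow_add hc]; norm_num
    rw [ea, eb, ec]; ring
  rw [e] at h
  refine h.trans ?_
  have p1 : 0 ≤ a ^ (-(5/4) : ℝ) * b ^ (-(5/4) : ℝ) := by positivity
  have p2 : 0 ≤ a ^ (-(5/4) : ℝ) * c ^ (-(5/4) : ℝ) := by positivity
  have p3 : 0 ≤ b ^ (-(5/4) : ℝ) * c ^ (-(5/4) : ℝ) := by positivity
  linarith

lemma DD_int : Integrable DD := by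
  have h0 : Integrable (fun x : ℝ => (1 + |x|) ^ (-(5/4) : ℝ)) := by
    have := integrable_one_add_norm (E := ℝ) (μ := volume) (r := 5/4) (by simp; norm_num)
    simpa using this
  have h1 : Integrable (fun z : ℝ × ℝ => (1 + |z.1|) ^ (-(5/4) : ℝ) * (1 + |z.2|) ^ (-(5/4) : ℝ)) := h0.mul_prod h0
  have h2 : Integrable (fun z : ℝ × ℝ => (1 + |z.1|) ^ (-(5/4) : ℝ) * (1 + |z.1 + z.2|) ^ (-(5/4) : ℝ)) :=
    (measurePreserving_prod_add (G := ℝ) volume volume).integrable_comp_of_integrable h1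
  have h3 : Integrable (fun z : ℝ × ℝ => (1 + |z.2|) ^ (-(5/4) : ℝ) * (1 + |z.1 + z.2|) ^ (-(5/4) : ℝ)) := by
    have := (measurePreserving_prod_add_swap (G := ℝ) volume volume).integrable_comp_of_integrable h1
    refine this.congr (Eventually.of_forall fun z => ?_)
    simp only [Function.comp]
    rw [add_comm z.2 z.1]
  refine Integrable.mono' ((h1.add h2).add h3) DD_cont.aestronglyMeasurable (Eventually.of_forall fun z => ?_)
  rw [Real.norm_of_nonneg (DD_nonneg z)]
  exact amgm (by positivity) (by positivity) (by positivity)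

lemma core {n1 n2 n3 N : ℝ} (h1 : 0 ≤ n1) (h2 : 0 ≤ n2) (hN : 1 ≤ N) (h3 : 1 / N ≤ n3) (h : 1 + n3 ≤ 2 * ((1 + n1) * (1 + n2))) :
    (1 / n3 + (1 + n3) ^ (1/4 : ℝ)) * ((1 + n1) ^ (-(3/4) : ℝ) * (1 + n2) ^ (-(3/4) : ℝ)) ≤ 4 * (N ^ (1/2 : ℝ) * n3 ^ (-(1/2) : ℝ)) := by
  have hN0 : 0 < N := by linarith
  have hn3 : 0 < n3 := lt_of_lt_of_le (by positivity) h3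
  rw [← Real.mul_rpow (by positivity) (by positivity)]
  set P := (1 + n1) * (1 + n2) with hP
  have hP1 : 1 ≤ P := by rw [hP]; nlinarith
  have hP0 : 0 < P := by linarith
  have A : 1 / n3 * P ^ (-(3/4) : ℝ) ≤ N ^ (1/2 : ℝ) * n3 ^ (-(1/2) : ℝ) := by
    have a1 : P ^ (-(3/4) : ℝ) ≤ 1 := Real.rpow_le_one_of_one_le_of_nonpos hP1 (by norm_num)
    have a2 : 1 / n3 = n3 ^ (-(1/2) : ℝ) * n3 ^ (-(1/2) : ℝ) := by
      rw [← Real.rpow_add hn3]; norm_num; rw [Real.rpow_neg_one]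
    have a3 : n3 ^ (-(1/2) : ℝ) ≤ N ^ (1/2 : ℝ) := by
      calc n3 ^ (-(1/2) : ℝ) ≤ (1 / N) ^ (-(1/2) : ℝ) := Real.rpow_le_rpow_of_nonpos (by positivity) h3 (by norm_num)
        _ = N ^ (1/2 : ℝ) := by rw [one_div, Real.inv_rpow hN0.le, Real.rpow_neg hN0.le, inv_inv]
    calc 1 / n3 * P ^ (-(3/4) : ℝ) ≤ 1 / n3 * 1 := by gcongr
      _ = n3 ^ (-(1/2) : ℝ) * n3 ^ (-(1/2) : ℝ) := by rw [mul_one, a2]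
      _ ≤ _ := by gcongr
  have B : (1 + n3) ^ (1/4 : ℝ) * P ^ (-(3/4) : ℝ) ≤ 3 * (N ^ (1/2 : ℝ) * n3 ^ (-(1/2) : ℝ)) := by
    have b1 : (1 + n3) ^ (1/4 : ℝ) ≤ 2 ^ (1/4:ℝ) * P ^ (1/4 : ℝ) := by
      rw [← Real.mul_rpow (by norm_num) hP0.le]; gcongr
    have b2 : P ^ (-(1/2) : ℝ) ≤ 2 ^ (1/2:ℝ) * n3 ^ (-(1/2) : ℝ) := by
      have e : (2:ℝ) ^ (1/2:ℝ) = (1/2:ℝ) ^ (-(1/2):ℝ) := by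
        rw [one_div 2, Real.inv_rpow (by norm_num), Real.rpow_neg (by norm_num), inv_inv]
      rw [e, ← Real.mul_rpow (by norm_num) hn3.le]
      apply Real.rpow_le_rpow_of_nonpos (by positivity) _ (by norm_num)
      linarith
    have b3 : (2:ℝ) ^ (1/4:ℝ) ≤ 3/2 := by
      have : ((2:ℝ) ^ (1/4:ℝ)) ^ 4 ≤ (3/2) ^ 4 := by
        rw [← Real.rpow_natCast, ← Real.rpow_mul (by norm_num)]; norm_num
      exact le_of_pow_le_pow_left₀ (by norm_num) (by norm_num) this
    have b4 : (2:ℝ) ^ (1/2:ℝ) ≤ 2 := by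
      have : ((2:ℝ) ^ (1/2:ℝ)) ^ 2 ≤ 2 ^ 2 := by
        rw [← Real.rpow_natCast, ← Real.rpow_mul (by norm_num)]; norm_num
      exact le_of_pow_le_pow_left₀ (by norm_num) (by norm_num) this
    have b5 : 1 ≤ N ^ (1/2 : ℝ) := Real.one_le_rpow hN (by norm_num)
    have e : P ^ (1/4 : ℝ) * P ^ (-(3/4) : ℝ) = P ^ (-(1/2) : ℝ) := by rw [← Real.rpow_add hP0]; norm_num
    calc (1 + n3) ^ (1/4 : ℝ) * P ^ (-(3/4) : ℝ) ≤ (2 ^ (1/4:ℝ) * P ^ (1/4 : ℝ)) * P ^ (-(3/4) : ℝ) := by gcongr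
      _ = 2 ^ (1/4:ℝ) * P ^ (-(1/2) : ℝ) := by rw [mul_assoc, e]
      _ ≤ 3/2 * (2 * (1 * n3 ^ (-(1/2) : ℝ))) := by
          gcongr
          rw [one_mul]
          exact b2.trans (by gcongr)
      _ ≤ 3/2 * (2 * (N ^ (1/2 : ℝ) * n3 ^ (-(1/2) : ℝ))) := by gcongr
      _ = _ := by ring
  rw [add_mul]; linarith

/-- the square of admissible w -/
def Sqr (w : ℂ) : Prop := |w.re| ≤ 1 ∧ |w.im| ≤ 1

lemma Sqr.norm {w : ℂ} (hw : Sqr w) : ‖w‖ ≤ 2 := (Complex.norm_le_abs_re_add_abs_im w).trans (by linarith [hw.1, hw.2])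

lemma W1_bd {w : ℂ} (hw : Sqr w) (ξ : ℝ) : 2 ≤ (w + vl 3 ξ).re ∧ (w + vl 3 ξ).re ≤ 4 ∧ ‖w + vl 3 ξ‖ ≤ 2 * ‖vl 3 ξ‖ ∧ 2 ≤ ‖w + vl 3 ξ‖ := by
  have h1 := abs_le.mp hw.1
  have h2 : 3 ≤ ‖vl 3 ξ‖ := by
    have := Complex.re_le_norm (vl 3 ξ); rwa [vl_re] at this
  have h3 : 2 ≤ (w + vl 3 ξ).re := by simp; linarith
  refine ⟨h3, by simp; linarith, ?_, h3.trans (Complex.re_le_norm _)⟩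
  refine (norm_add_le _ _).trans ?_
  linarith [hw.norm]

lemma vl_ge (ξ : ℝ) : (1 + |ξ|) / 2 ≤ ‖vl 3 ξ‖ := by
  have := Complex.re_le_norm (vl 3 ξ)
  have h2 := Complex.abs_im_le_norm (vl 3 ξ)
  rw [vl_re] at this; rw [vl_im] at h2
  linarith

lemma W3_bd {w : ℂ} (hw : Sqr w) (z : ℝ × ℝ) : 5 ≤ (w + vl 3 z.1 + vl 3 z.2).re ∧ 1 ≤ ‖w + vl 3 z.1 + vl 3 z.2‖ ∧ (1 + |z.1 + z.2|) / 2 ≤ ‖w + vl 3 z.1 + vl 3 z.2‖ := by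
  have h1 := abs_le.mp hw.1
  have h3 : 5 ≤ (w + vl 3 z.1 + vl 3 z.2).re := by simp; linarith
  have h4 := Complex.re_le_norm (w + vl 3 z.1 + vl 3 z.2)
  have h5 := Complex.abs_im_le_norm (w + vl 3 z.1 + vl 3 z.2)
  have h6 : |z.1 + z.2| - 1 ≤ |(w + vl 3 z.1 + vl 3 z.2).im| := by
    simp only [add_im, vl_im]
    have : |z.1 + z.2| ≤ |w.im + z.1 + z.2| + |w.im| := by
      have := abs_sub (w.im + z.1 + z.2) w.im
      rwa [show w.im + z.1 + z.2 - w.im = z.1 + z.2 by ring] at this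
    linarith [hw.2]
  refine ⟨h3, by linarith, by linarith⟩

lemma W3_rpow {w : ℂ} (hw : Sqr w) (z : ℝ × ℝ) : ‖w + vl 3 z.1 + vl 3 z.2‖ ^ (-(1/2) : ℝ) ≤ 2 * (1 + |z.1 + z.2|) ^ (-(1/2) : ℝ) := by
  have h := (W3_bd hw z).2.2
  calc _ ≤ ((1 + |z.1 + z.2|) / 2) ^ (-(1/2) : ℝ) := Real.rpow_le_rpow_of_nonpos (by positivity) h (by norm_num)
    _ = (1 + |z.1 + z.2|) ^ (-(1/2) : ℝ) * (1/2) ^ (-(1/2) : ℝ) := by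
        rw [div_eq_mul_one_div, Real.mul_rpow (by positivity) (by norm_num)]
    _ ≤ (1 + |z.1 + z.2|) ^ (-(1/2) : ℝ) * 2 := by
        gcongr
        have : ((1/2:ℝ) ^ (-(1/2):ℝ)) ^ 2 ≤ 2 ^ 2 := by
          rw [← Real.rpow_natCast, ← Real.rpow_mul (by norm_num)]; norm_num
        exact le_of_pow_le_pow_left₀ (by norm_num) (by norm_num) this
    _ = _ := by ring

/-- generic kernel bound -/
lemma ker_dom {k : ℕ} {τ : ℝ} {M : ℝ} (hτ : τ ≤ M) {w : ℂ} (hw : Sqr w) (z : ℝ × ℝ) {F : ℂ} {C : ℝ} (hC : 0 ≤ C)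
    (hF : ‖F‖ ≤ C * (‖vl 3 z.1‖ ^ k * ‖vl 3 z.2‖ ^ k * ‖w + vl 3 z.1 + vl 3 z.2‖ ^ (-(1/2) : ℝ))) :
    ‖ker k τ z * F‖ ≤ Real.exp (6 * M) * (8 * C) * DD z := by
  have a1 := vl_ge z.1
  have a2 := vl_ge z.2
  have a3 := W3_rpow hw z
  have p1 : 0 < ‖vl 3 z.1‖ := lt_of_lt_of_le (by positivity) a1
  have p2 : 0 < ‖vl 3 z.2‖ := lt_of_lt_of_le (by positivity) a2
  have e : ‖ker k τ z‖ = Real.exp (6 * τ) * (‖vl 3 z.1‖ ^ (k + 1))⁻¹ * (‖vl 3 z.2‖ ^ (k + 1))⁻¹ := by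
    rw [ker]
    simp only [norm_mul, Complex.norm_exp, norm_inv, norm_pow]
    have : Real.exp (6 * τ) = Real.exp ((τ * vl 3 z.1).re) * Real.exp ((τ * vl 3 z.2).re) := by
      rw [← Real.exp_add]; congr 1; simp; ring
    rw [this]; ring
  rw [norm_mul, e, DD]
  have i1 : ‖vl 3 z.1‖⁻¹ ≤ 2 * (1 + |z.1|)⁻¹ := by
    rw [← div_eq_mul_inv, inv_le_comm₀ p1 (by positivity), inv_div]; exact a1
  have i2 : ‖vl 3 z.2‖⁻¹ ≤ 2 * (1 + |z.2|)⁻¹ := by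
    rw [← div_eq_mul_inv, inv_le_comm₀ p2 (by positivity), inv_div]; exact a2
  calc _ ≤ Real.exp (6 * M) * (‖vl 3 z.1‖ ^ (k + 1))⁻¹ * (‖vl 3 z.2‖ ^ (k + 1))⁻¹ * (C * (‖vl 3 z.1‖ ^ k * ‖vl 3 z.2‖ ^ k * ‖w + vl 3 z.1 + vl 3 z.2‖ ^ (-(1/2) : ℝ))) := by
        gcongr
    _ = Real.exp (6 * M) * C * (‖vl 3 z.1‖⁻¹ * ‖vl 3 z.2‖⁻¹ * ‖w + vl 3 z.1 + vl 3 z.2‖ ^ (-(1/2) : ℝ)) := by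
        rw [pow_succ, pow_succ]; field_simp
    _ ≤ Real.exp (6 * M) * C * ((2 * (1 + |z.1|)⁻¹) * (2 * (1 + |z.2|)⁻¹) * (2 * (1 + |z.1 + z.2|) ^ (-(1/2) : ℝ))) := by
        gcongr
    _ = _ := by ring

lemma Eul_bound (k : ℕ) (hk : 1 ≤ k) : ∃ C > 0, ∀ N : ℝ, 10 ≤ N → ∀ w, Sqr w → ∀ z : ℝ × ℝ,
    ‖(N : ℂ) ^ k * Eul k (1 + w / N) (vl 3 z.1 / N) (vl 3 z.2 / N)‖ ≤
      C * (‖vl 3 z.1‖ ^ k * ‖vl 3 z.2‖ ^ k * ‖w + vl 3 z.1 + vl 3 z.2‖ ^ (-(1/2) : ℝ)) := by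
  obtain ⟨C1, hC1, h1⟩ := Zb.zeta_upper
  obtain ⟨C2, hC2, h2⟩ := Zb.zeta_lower
  obtain ⟨C3, hC3, h3⟩ := Hh_bound k
  refine ⟨(16 * C1 * C2 ^ 2) ^ k * C3, by positivity, fun N hN w hw z => ?_⟩
  have hN0 : 0 < N := by linarith
  have hNc : (N : ℂ) ≠ 0 := by exact_mod_cast hN0.ne'
  obtain ⟨a1, a2, a3, a4⟩ := W1_bd hw z.1
  obtain ⟨b1, b2, b3, b4⟩ := W1_bd hw z.2
  obtain ⟨c1, c2, c3⟩ := W3_bd hw z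
  set U := vl 3 z.1
  set V := vl 3 z.2
  set W1 := w + U with hW1
  set W2 := w + V with hW2
  set W3 := w + U + V with hW3
  have e1 : 1 + w / N + U / N = 1 + W1 / N := by rw [hW1]; field_simp; ring
  have e2 : 1 + w / N + V / N = 1 + W2 / N := by rw [hW2]; field_simp; ring
  have e3 : 1 + w / N + U / N + V / N = 1 + W3 / N := by rw [hW3]; field_simp; ring
  rw [Eul, e3, e1, e2]
  have n1 : ‖W1 / N‖ = ‖W1‖ / N := by rw [norm_div, Complex.norm_real, Real.norm_of_nonneg hN0.le]
  have n2 : ‖W2 / N‖ = ‖W2‖ / N := by rw [norm_div, Complex.norm_real, Real.norm_of_nonneg hN0.le]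
  have n3 : ‖W3 / N‖ = ‖W3‖ / N := by rw [norm_div, Complex.norm_real, Real.norm_of_nonneg hN0.le]
  have z1 := h2 (W1 / N) (by rw [div_ofReal_re]; positivity) (by rw [div_ofReal_re, div_le_one hN0]; linarith)
  have z2 := h2 (W2 / N) (by rw [div_ofReal_re]; positivity) (by rw [div_ofReal_re, div_le_one hN0]; linarith)
  have z3 := h1 (W3 / N) (by rw [div_ofReal_re]; positivity)
  rw [n1] at z1; rw [n2] at z2; rw [n3] at z3
  have hH : ‖Hh k (1 + w / N) (U / N) (V / N)‖ ≤ C3 := by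
    apply h3
    · rw [add_re, div_ofReal_re, one_re]
      have := (abs_le.mp hw.1).1
      have : -(1/10) ≤ w.re / N := by
        rw [le_div_iff₀ hN0]; linarith
      linarith
    · rw [div_ofReal_re, vl_re]; positivity
    · rw [div_ofReal_re, vl_re]; positivity
  have tri : ‖W3‖ ≤ 2 * ‖W1‖ + ‖W2‖ := by
    have : W3 = W1 + W2 - w := by rw [hW1, hW2, hW3]; ring
    rw [this]
    refine (norm_sub_le _ _).trans ?_
    refine (add_le_add_left (norm_add_le _ _) _).trans ?_
    linarith [hw.norm]
  have hc := core (n1 := ‖W1‖ / N) (n2 := ‖W2‖ / N) (n3 := ‖W3‖ / N) (N := N) (by positivity) (by positivity) (by linarith)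
    (by gcongr) (by
      have : ‖W3‖ / N ≤ 2 * (‖W1‖ / N) + ‖W2‖ / N := by
        rw [← mul_div_assoc, ← add_div]; gcongr
      have q1 : 0 ≤ ‖W1‖ / N := by positivity
      have q2 : 0 ≤ ‖W2‖ / N := by positivity
      nlinarith [mul_nonneg q1 q2])
  have pN : N ^ (1/2 : ℝ) * (‖W3‖ / N) ^ (-(1/2) : ℝ) = N * ‖W3‖ ^ (-(1/2) : ℝ) := by
    rw [Real.div_rpow (norm_nonneg _) hN0.le, Real.rpow_neg hN0.le (1/2), div_inv_eq_mul]
    have : N = N ^ (1/2 : ℝ) * N ^ (1/2 : ℝ) := by rw [← Real.rpow_add hN0]; norm_num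
    conv_rhs => rw [this]
    ring
  rw [pN] at hc
  have main : N * (‖riemannZeta (1 + W3 / N)‖ * ‖(riemannZeta (1 + W1 / N))⁻¹‖ * ‖(riemannZeta (1 + W2 / N))⁻¹‖) ≤
      16 * C1 * C2 ^ 2 * (‖U‖ * ‖V‖ * ‖W3‖ ^ (-(1/2) : ℝ)) := by
    calc _ ≤ N * ((C1 * (1 / (‖W3‖ / N) + (1 + ‖W3‖ / N) ^ (1 / 4 : ℝ))) * (C2 * (‖W1‖ / N * (1 + ‖W1‖ / N) ^ (-(3/4) : ℝ))) * (C2 * (‖W2‖ / N * (1 + ‖W2‖ / N) ^ (-(3/4) : ℝ)))) := by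
          gcongr
      _ = C1 * C2 ^ 2 * (N * (‖W1‖ / N * (‖W2‖ / N))) * ((1 / (‖W3‖ / N) + (1 + ‖W3‖ / N) ^ (1 / 4 : ℝ)) * ((1 + ‖W1‖ / N) ^ (-(3/4) : ℝ) * (1 + ‖W2‖ / N) ^ (-(3/4) : ℝ))) := by ring
      _ ≤ C1 * C2 ^ 2 * (N * (‖W1‖ / N * (‖W2‖ / N))) * (4 * (N * ‖W3‖ ^ (-(1/2) : ℝ))) := by gcongr
      _ = 4 * C1 * C2 ^ 2 * (‖W1‖ * ‖W2‖ * ‖W3‖ ^ (-(1/2) : ℝ)) := by field_simp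
      _ ≤ 4 * C1 * C2 ^ 2 * ((2 * ‖U‖) * (2 * ‖V‖) * ‖W3‖ ^ (-(1/2) : ℝ)) := by gcongr
      _ = _ := by ring
  calc _ = (N * (‖riemannZeta (1 + W3 / N)‖ * ‖(riemannZeta (1 + W1 / N))⁻¹‖ * ‖(riemannZeta (1 + W2 / N))⁻¹‖)) ^ k * ‖Hh k (1 + w / N) (U / N) (V / N)‖ := by
        simp only [norm_mul, norm_pow, norm_inv, Complex.norm_real, Real.norm_of_nonneg hN0.le]
        simp only [mul_pow, inv_pow]; ring
    _ ≤ (16 * C1 * C2 ^ 2 * (‖U‖ * ‖V‖ * ‖W3‖ ^ (-(1/2) : ℝ))) ^ k * C3 := by gcongr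
    _ = (16 * C1 * C2 ^ 2) ^ k * C3 * (‖U‖ ^ k * ‖V‖ ^ k * (‖W3‖ ^ (-(1/2) : ℝ)) ^ k) := by simp only [mul_pow]; ring
    _ ≤ _ := by
        gcongr
        refine pow_le_of_le_one (by positivity) ?_ (by omega)
        exact Real.rpow_le_one_of_one_le_of_nonpos c2 (by norm_num)

end Sel

end PartB5

section PartB5b

namespace Sel
open Lap Loc Complex MeasureTheory Filter Topology

lemma Sqr.re_ge {w : ℂ} (hw : Sqr w) {N : ℝ} (hN : 10 ≤ N) : 9 / 10 ≤ (1 + w / N).re := by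
  rw [add_re, div_ofReal_re, one_re]
  have hN0 : 0 < N := by linarith
  have := (abs_le.mp hw.1).1
  have : -(1/10) ≤ w.re / N := by
    rw [le_div_iff₀ hN0]; linarith
  linarith

lemma Sqr.re_gt {w : ℂ} (hw : Sqr w) {N : ℝ} (hN : 10 ≤ N) : 1 < (1 + w / N).re + 3 / N := by
  rw [add_re, div_ofReal_re, one_re]
  have hN0 : 0 < N := by linarith
  have := (abs_le.mp hw.1).1
  have : 0 < w.re / N + 3 / N := by
    rw [← add_div]; apply div_pos _ hN0; linarith
  linarith

lemma Eul_meas (k : ℕ) {N : ℝ} (hN : 10 ≤ N) {w : ℂ} (hw : Sqr w) :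
    AEStronglyMeasurable (fun z : ℝ × ℝ => Eul k (1 + w / N) (vl 3 z.1 / N) (vl 3 z.2 / N)) := by
  have hs := hw.re_ge hN
  have hs1 := hw.re_gt hN
  set s := 1 + w / N
  have hN0 : 0 < N := by linarith
  have re : ∀ ξ, (vl 3 ξ / N).re = 3 / N := by intro ξ; rw [Complex.div_ofReal_re, vl_re]
  refine aestronglyMeasurable_of_tendsto_ae atTop (f := fun (Y : ℕ) (z : ℝ × ℝ) => ∏ p ∈ Nat.primesBelow Y,
      EE k ((p : ℂ) ^ (-s)) ((p : ℂ) ^ (-(vl 3 z.1 / N))) ((p : ℂ) ^ (-(vl 3 z.2 / N)))) ?_ ?_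
  · intro Y
    apply Continuous.aestronglyMeasurable
    refine continuous_finsetProd _ fun p hp => ?_
    have hp : (p : ℂ) ≠ 0 := by exact_mod_cast (Nat.prime_of_mem_primesBelow hp).ne_zero
    have h : Continuous (fun ξ : ℝ => (p : ℂ) ^ (-(vl 3 ξ / N))) := by
      have := vl_cont 3
      exact Continuous.const_cpow (by fun_prop) (Or.inl hp)
    have h1 := h.comp continuous_fst (X := ℝ × ℝ)
    have h2 := h.comp continuous_snd (X := ℝ × ℝ)
    simp only [Function.comp_def] at h1 h2
    unfold EE
    fun_prop
  · refine Eventually.of_forall fun z => ?_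
    have hpos : 0 ≤ 3 / N := by positivity
    refine EE_tendsto k hs ?_ ?_ ?_ ?_
    · rw [re]; exact hpos
    · rw [re]; exact hpos
    · rw [add_re, re]; exact hs1
    · rw [add_re, re]; exact hs1

lemma zeta_lim {W : ℂ} (hW : W ≠ 0) : Tendsto (fun N : ℝ => (W / N) * riemannZeta (1 + W / N)) atTop (𝓝 1) := by
  have h0 : Tendsto (fun N : ℝ => W / (N : ℂ)) atTop (𝓝 0) := by
    have : Tendsto (fun N : ℝ => ((N⁻¹ : ℝ) : ℂ)) atTop (𝓝 ((0 : ℝ) : ℂ)) :=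
      (Complex.continuous_ofReal.tendsto 0).comp tendsto_inv_atTop_zero
    have := this.const_mul W
    simpa [div_eq_mul_inv] using this
  have h1 : Tendsto (fun N : ℝ => 1 + W / (N : ℂ)) atTop (𝓝[≠] 1) := by
    rw [tendsto_nhdsWithin_iff]
    constructor
    · simpa using h0.const_add 1
    · filter_upwards [eventually_gt_atTop 0] with N hN
      have : W / (N : ℂ) ≠ 0 := div_ne_zero hW (by exact_mod_cast hN.ne')
      simpa using this
  have := riemannZeta_residue_one.comp h1
  refine this.congr fun N => ?_
  simp

/-- limiting integrand -/
noncomputable def LL (k : ℕ) (w : ℂ) (z : ℝ × ℝ) : ℂ := ((w + vl 3 z.1) * (w + vl 3 z.2) / (w + vl 3 z.1 + vl 3 z.2)) ^ k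

noncomputable def qq (k : ℕ) (γ : ℝ) (w : ℂ) : ℂ := (k.factorial * (1 / γ) ^ k / (2 * Real.pi)) ^ 2 * ∫ z : ℝ × ℝ, ker k γ z * LL k w z

lemma Eul_lim (k : ℕ) {w : ℂ} (hw : Sqr w) (z : ℝ × ℝ) :
    Tendsto (fun N : ℝ => (N : ℂ) ^ k * Eul k (1 + w / N) (vl 3 z.1 / N) (vl 3 z.2 / N)) atTop (𝓝 (LL k w z)) := by
  obtain ⟨a1, a2, a3, a4⟩ := W1_bd hw z.1
  obtain ⟨b1, b2, b3, b4⟩ := W1_bd hw z.2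
  obtain ⟨c1, c2, c3⟩ := W3_bd hw z
  have n1 : w + vl 3 z.1 ≠ 0 := norm_pos_iff.mp (by linarith)
  have n2 : w + vl 3 z.2 ≠ 0 := norm_pos_iff.mp (by linarith)
  have n3 : w + vl 3 z.1 + vl 3 z.2 ≠ 0 := norm_pos_iff.mp (by linarith)
  have z1 := zeta_lim n1
  have z2 := zeta_lim n2
  have z3 := zeta_lim n3
  have h0 : ∀ W : ℂ, Tendsto (fun N : ℝ => W / (N : ℂ)) atTop (𝓝 0) := by
    intro W
    have : Tendsto (fun N : ℝ => ((N⁻¹ : ℝ) : ℂ)) atTop (𝓝 ((0 : ℝ) : ℂ)) :=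
      (Complex.continuous_ofReal.tendsto 0).comp tendsto_inv_atTop_zero
    have := this.const_mul W
    simpa [div_eq_mul_inv] using this
  have hH : Tendsto (fun N : ℝ => Hh k (1 + w / N) (vl 3 z.1 / N) (vl 3 z.2 / N)) atTop (𝓝 1) := by
    refine Hh_tendsto_one k (by simpa using (h0 w).const_add 1) (h0 _) (h0 _) ?_ ?_ ?_
    · filter_upwards [eventually_ge_atTop 10] with N hN using hw.re_ge hN
    · filter_upwards [eventually_ge_atTop 10] with N hN
      rw [div_ofReal_re, vl_re]; positivity
    · filter_upwards [eventually_ge_atTop 10] with N hN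
      rw [div_ofReal_re, vl_re]; positivity
  have H := (((z3.pow k).mul (((z1.pow k).inv₀ (by simp)).mul ((z2.pow k).inv₀ (by simp)))).mul hH).mul_const (LL k w z)
  simp only [one_pow, inv_one, mul_one, one_mul] at H
  refine H.congr' ?_
  filter_upwards [eventually_ge_atTop 10] with N hN
  have hNc : (N : ℂ) ≠ 0 := by
    have : N ≠ 0 := by linarith
    exact_mod_cast this
  have e1 : 1 + w / N + vl 3 z.1 / N = 1 + (w + vl 3 z.1) / N := by ring
  have e2 : 1 + w / N + vl 3 z.2 / N = 1 + (w + vl 3 z.2) / N := by ring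
  have e3 : 1 + w / N + vl 3 z.1 / N + vl 3 z.2 / N = 1 + (w + vl 3 z.1 + vl 3 z.2) / N := by ring
  rw [Eul, e3, e1, e2, LL]
  simp only [← mul_pow, ← inv_pow, mul_inv, inv_div]
  rw [mul_right_comm, ← mul_assoc, ← mul_assoc]
  simp only [← mul_assoc, ← mul_pow]
  congr 2
  generalize (riemannZeta (1 + (w + vl 3 z.1) / N))⁻¹ = A1
  generalize (riemannZeta (1 + (w + vl 3 z.2) / N))⁻¹ = A2
  generalize riemannZeta (1 + (w + vl 3 z.1 + vl 3 z.2) / N) = A3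
  field_simp

lemma LL_bound (k : ℕ) (hk : 1 ≤ k) : ∃ C > 0, ∀ w, Sqr w → ∀ z : ℝ × ℝ,
    ‖LL k w z‖ ≤ C * (‖vl 3 z.1‖ ^ k * ‖vl 3 z.2‖ ^ k * ‖w + vl 3 z.1 + vl 3 z.2‖ ^ (-(1/2) : ℝ)) := by
  obtain ⟨C, hC, h⟩ := Eul_bound k hk
  refine ⟨C, hC, fun w hw z => ?_⟩
  refine le_of_tendsto (Eul_lim k hw z).norm ?_
  filter_upwards [eventually_ge_atTop 10] with N hN using h N hN w hw z

lemma QQ_lim (k : ℕ) (hk : 1 ≤ k) {γ : ℝ} (hγ : 0 < γ) {T : ℝ → ℝ} (hT : Tendsto (fun N => T N / N) atTop (𝓝 γ)) :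
    (∃ C > 0, ∀ᶠ N : ℝ in atTop, ∀ w, Sqr w → ‖(N : ℂ) ^ k * QQ k (T N) (1 + w / N)‖ ≤ C) ∧
    ∀ w, Sqr w → Tendsto (fun N : ℝ => (N : ℂ) ^ k * QQ k (T N) (1 + w / N)) atTop (𝓝 (qq k γ w)) := by
  obtain ⟨C, hC, hb⟩ := Eul_bound k hk
  have hτ : ∀ᶠ N in atTop, T N / N ≤ γ + 1 := hT.eventually (eventually_le_nhds (by linarith))
  have hτ0 : ∀ᶠ N in atTop, 0 < T N / N := hT.eventually (eventually_gt_nhds hγ)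
  have hcc : Tendsto (fun N : ℝ => ((cc k (T N) N : ℝ) : ℂ) ^ 2) atTop (𝓝 ((k.factorial * (1 / γ) ^ k / (2 * Real.pi)) ^ 2)) := by
    have : Tendsto (fun N : ℝ => cc k (T N) N) atTop (𝓝 (k.factorial * (1 / γ) ^ k / (2 * Real.pi))) := by
      unfold cc
      refine Tendsto.div_const (Tendsto.const_mul _ (Tendsto.pow ?_ _)) _
      have := hT.inv₀ hγ.ne'
      simpa [one_div] using this
    have := ((Complex.continuous_ofReal.tendsto _).comp this).pow 2
    simpa [Function.comp_def] using this
  have key : ∀ᶠ N : ℝ in atTop, ∀ w, Sqr w → (N : ℂ) ^ k * QQ k (T N) (1 + w / N) =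
      (cc k (T N) N) ^ 2 * ∫ z : ℝ × ℝ, ker k (T N / N) z * ((N : ℂ) ^ k * Eul k (1 + w / N) (vl 3 z.1 / N) (vl 3 z.2 / N)) := by
    filter_upwards [hτ0, eventually_ge_atTop 10] with N h1 h2 w hw
    have hN0 : 0 < N := by linarith
    have hT0 : 0 < T N := by
      have := mul_pos h1 hN0
      rwa [div_mul_cancel₀ _ hN0.ne'] at this
    rw [QQ_full k hk hT0 hN0 (hw.re_ge h2) (hw.re_gt h2), mul_left_comm, ← integral_const_mul]
    congr 2
    ext z; ring
  constructor
  · have hI : 0 ≤ ∫ z, Real.exp (6 * (γ + 1)) * (8 * C) * DD z := by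
      apply integral_nonneg
      intro z
      have := DD_nonneg z
      positivity
    set I := ∫ z, Real.exp (6 * (γ + 1)) * (8 * C) * DD z with hIdef
    have hb1 : ∀ᶠ N in atTop, ‖((cc k (T N) N : ℝ) : ℂ) ^ 2‖ ≤ ‖(((k.factorial * (1 / γ) ^ k / (2 * Real.pi)) ^ 2 : ℂ))‖ + 1 :=
      hcc.norm.eventually (eventually_le_nhds (by linarith))
    refine ⟨(‖(((k.factorial * (1 / γ) ^ k / (2 * Real.pi)) ^ 2 : ℂ))‖ + 1) * (I + 1), by positivity, ?_⟩
    filter_upwards [key, hb1, hτ, eventually_ge_atTop 10] with N h1 h2 h3 h4 w hw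
    rw [h1 w hw, norm_mul]
    gcongr
    refine le_trans ?_ (by linarith : I ≤ I + 1)
    exact norm_integral_le_of_norm_le (DD_int.const_mul _) (Eventually.of_forall fun z => ker_dom h3 hw z hC.le (hb N h4 w hw z))
  · intro w hw
    have : Tendsto (fun N : ℝ => ((cc k (T N) N : ℝ) : ℂ) ^ 2 * ∫ z : ℝ × ℝ, ker k (T N / N) z * ((N : ℂ) ^ k * Eul k (1 + w / N) (vl 3 z.1 / N) (vl 3 z.2 / N))) atTop (𝓝 (qq k γ w)) := by
      refine hcc.mul ?_
      refine tendsto_integral_filter_of_dominated_convergence (fun z => Real.exp (6 * (γ + 1)) * (8 * C) * DD z) ?_ ?_ (DD_int.const_mul _) ?_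
      · filter_upwards [eventually_ge_atTop 10] with N hN
        exact (ker_cont k _).aestronglyMeasurable.mul ((Eul_meas k hN hw).const_mul _)
      · filter_upwards [hτ, eventually_ge_atTop 10] with N h3 h4
        exact Eventually.of_forall fun z => ker_dom h3 hw z hC.le (hb N h4 w hw z)
      · refine Eventually.of_forall fun z => ?_
        refine Tendsto.mul ?_ (Eul_lim k hw z)
        unfold ker
        have hTc : Tendsto (fun N : ℝ => ((T N / N : ℝ) : ℂ)) atTop (𝓝 (γ : ℂ)) := (Complex.continuous_ofReal.tendsto _).comp hT
        have q : ∀ v : ℂ, Tendsto (fun N : ℝ => cexp (((T N / N : ℝ) : ℂ) * v)) atTop (𝓝 (cexp (γ * v))) := fun v =>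
          (Complex.continuous_exp.tendsto _).comp (hTc.mul_const v)
        exact ((q _).mul_const _).mul ((q _).mul_const _)
    refine this.congr' ?_
    filter_upwards [key] with N h1
    exact (h1 w hw).symm

end Sel

end PartB5b

section PartB7

namespace Sel
open Lap Loc Complex MeasureTheory Filter Topology Set

lemma J_dom (m j : ℕ) {w : ℂ} (hw : Sqr w) (z : ℝ × ℝ) :
    ‖((w + vl 3 z.1 + vl 3 z.2) ^ (j + 1))⁻¹‖ ≤ 1 * (‖vl 3 z.1‖ ^ m * ‖vl 3 z.2‖ ^ m * ‖w + vl 3 z.1 + vl 3 z.2‖ ^ (-(1/2) : ℝ)) := by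
  have h3 : ∀ ξ, 1 ≤ ‖vl 3 ξ‖ := by
    intro ξ
    have := Complex.re_le_norm (vl 3 ξ); rw [vl_re] at this; linarith
  have c2 := (W3_bd hw z).2.1
  have a1 := one_le_pow₀ (h3 z.1) (n := m)
  have a2 := one_le_pow₀ (h3 z.2) (n := m)
  have hp : 0 ≤ ‖w + vl 3 z.1 + vl 3 z.2‖ ^ (-(1/2) : ℝ) := by positivity
  rw [norm_inv, norm_pow, one_mul]
  calc (‖w + vl 3 z.1 + vl 3 z.2‖ ^ (j + 1))⁻¹ = ‖w + vl 3 z.1 + vl 3 z.2‖ ^ (-((j + 1 : ℕ) : ℝ)) := by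
        rw [Real.rpow_neg (by positivity), Real.rpow_natCast]
    _ ≤ ‖w + vl 3 z.1 + vl 3 z.2‖ ^ (-(1/2) : ℝ) := by
        apply Real.rpow_le_rpow_of_exponent_le c2
        have : (0:ℝ) ≤ j := by positivity
        push_cast; linarith
    _ = 1 * 1 * ‖w + vl 3 z.1 + vl 3 z.2‖ ^ (-(1/2) : ℝ) := by ring
    _ ≤ _ := by gcongr

lemma J_int (m j : ℕ) (γ : ℝ) {w : ℂ} (hw : Sqr w) :
    Integrable (fun z : ℝ × ℝ => ker m γ z * ((w + vl 3 z.1 + vl 3 z.2) ^ (j + 1))⁻¹) := by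
  refine Integrable.mono' (DD_int.const_mul (Real.exp (6 * γ) * (8 * 1))) ?_ (Eventually.of_forall fun z => ker_dom le_rfl hw z zero_le_one (J_dom m j hw z))
  apply Continuous.aestronglyMeasurable
  refine (ker_cont m γ).mul (Continuous.inv₀ ?_ fun z => pow_ne_zero _ (norm_pos_iff.mp (by linarith [(W3_bd hw z).2.1])))
  have h1 := (vl_cont 3).comp continuous_fst (X := ℝ × ℝ)
  have h2 := (vl_cont 3).comp continuous_snd (X := ℝ × ℝ)
  simp only [Function.comp_def] at h1 h2
  fun_prop

lemma exp_int_cancel {γ : ℝ} {f : ℝ → ℂ} (h : Integrable (fun ξ : ℝ => cexp (γ * vl 3 ξ) * f ξ)) : Integrable f := by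
  have hc : Continuous (fun ξ : ℝ => cexp (-(γ * vl 3 ξ))) := by
    have := vl_cont 3
    fun_prop
  have := h.bdd_mul (c := Real.exp (-(γ * 3))) hc.aestronglyMeasurable (Eventually.of_forall fun ξ => by
    rw [Complex.norm_exp]; simp)
  refine this.congr (Eventually.of_forall fun ξ => ?_)
  simp only
  rw [← mul_assoc, ← Complex.exp_add]; simp

lemma J_eval (m j : ℕ) {γ : ℝ} (hγ : 0 < γ) {w : ℂ} (hw : Sqr w) :
    ∫ z : ℝ × ℝ, ker m γ z * ((w + vl 3 z.1 + vl 3 z.2) ^ (j + 1))⁻¹ =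
      (2 * Real.pi) ^ 2 * ∫ r in (0:ℝ)..γ, (((γ - r : ℝ) : ℂ) ^ m / m.factorial) ^ 2 * ((r : ℂ) ^ j / j.factorial) * cexp (-(w * r)) := by
  have hI := J_int m j γ hw
  rw [Measure.volume_eq_prod] at hI ⊢
  rw [integral_prod _ hI]
  set ρ2 : ℝ → ℂ := (Icc 0 γ).indicator (fun r : ℝ => ((γ - r : ℝ) : ℂ) ^ m / m.factorial * ((r : ℂ) ^ j / j.factorial) * cexp (-(w * r))) with hρ2
  have hcont : Continuous (fun r : ℝ => ((γ - r : ℝ) : ℂ) ^ m / m.factorial * ((r : ℂ) ^ j / j.factorial) * cexp (-(w * r))) := by fun_prop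
  have hρ2I : Integrable ρ2 := by
    rw [hρ2, integrable_indicator_iff measurableSet_Icc]
    exact hcont.continuousOn.integrableOn_compact isCompact_Icc
  have inner : ∀ᵐ ξ : ℝ, ∫ y : ℝ, ker m γ (ξ, y) * ((w + vl 3 ξ + vl 3 y) ^ (j + 1))⁻¹ =
      2 * Real.pi * (cexp (γ * vl 3 ξ) * ((vl 3 ξ ^ (m + 1))⁻¹ * ∫ t in Ioi (0:ℝ), cexp (-(vl 3 ξ * t)) * ρ2 t)) := by
    filter_upwards [hI.prod_right_ae] with ξ hξ
    set U := vl 3 ξ with hU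
    have hUre : 2 ≤ (w + U).re := (W1_bd hw ξ).1
    set ρ1 : ℝ → ℂ := (Ici 0).indicator (fun t : ℝ => (t : ℂ) ^ j / j.factorial * cexp (-((w + U) * t))) with hρ1
    have hc1 : Continuous (fun t : ℝ => (t : ℂ) ^ j / j.factorial * cexp (-((w + U) * t))) := by fun_prop
    have hρ1pos : ∀ t, 0 ≤ t → ρ1 t = (t : ℂ) ^ j / j.factorial * cexp (-((w + U) * t)) := by
      intro t ht; rw [hρ1, indicator_of_mem (by exact ht)]
    have lap : ∀ V : ℂ, V.re = 3 → ∫ t in Ioi (0:ℝ), cexp (-(V * t)) * ρ1 t = ((w + U + V) ^ (j + 1))⁻¹ := by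
      intro V hV
      rw [← lap_pow (V := w + U + V) (by rw [add_re, hV]; linarith) j]
      refine setIntegral_congr_fun measurableSet_Ioi fun t ht => ?_
      rw [hρ1pos t (le_of_lt ht), mul_left_comm, ← Complex.exp_add, mul_comm]
      congr 2; ring
    have hne : ∀ V : ℂ, V.re = 3 → w + U + V ≠ 0 := by
      intro V hV h
      have := congrArg Complex.re h
      rw [add_re, hV, zero_re] at this; linarith
    have e0 : ∀ y : ℝ, ker m γ (ξ, y) * ((w + U + vl 3 y) ^ (j + 1))⁻¹ =
        (cexp (γ * U) * (U ^ (m + 1))⁻¹) * (cexp (γ * vl 3 y) * ((vl 3 y ^ (m + 1))⁻¹ * ∫ t in Ioi (0:ℝ), cexp (-(vl 3 y * t)) * ρ1 t)) := by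
      intro y
      rw [lap _ (vl_re _ _), ker]; simp only; ring
    have hUne : cexp (γ * U) * (U ^ (m + 1))⁻¹ ≠ 0 :=
      mul_ne_zero (Complex.exp_ne_zero _) (inv_ne_zero (pow_ne_zero _ (vl_ne (by norm_num) ξ)))
    have hLi : Integrable (fun y : ℝ => (vl 3 y ^ (m + 1))⁻¹ * ∫ t in Ioi (0:ℝ), cexp (-(vl 3 y * t)) * ρ1 t) := by
      apply exp_int_cancel (γ := γ)
      have h := hξ.const_mul (cexp (γ * U) * (U ^ (m + 1))⁻¹)⁻¹
      refine h.congr (Eventually.of_forall fun y => ?_)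
      simp only
      rw [e0, ← mul_assoc, inv_mul_cancel₀ hUne, one_mul]
    have hL := lemL ρ1 3 (by norm_num) m ?_ ?_ ?_ hLi γ
    · simp_rw [e0]
      rw [integral_const_mul, hL]
      have : ∫ r in (0:ℝ)..γ, ((γ - r : ℝ) : ℂ) ^ m / m.factorial * ρ1 r = ∫ t in Ioi (0:ℝ), cexp (-(U * t)) * ρ2 t := by
        rw [intervalIntegral.integral_of_le hγ.le]
        have e2 : ∀ t : ℝ, cexp (-(U * t)) * ρ2 t = (Icc 0 γ).indicator (fun t : ℝ => cexp (-(U * t)) * (((γ - t : ℝ) : ℂ) ^ m / m.factorial * ((t : ℂ) ^ j / j.factorial) * cexp (-(w * t)))) t := by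
          intro t
          by_cases h : t ∈ Icc 0 γ
          · rw [hρ2, indicator_of_mem h, indicator_of_mem h]
          · rw [hρ2, indicator_of_notMem h, indicator_of_notMem h, mul_zero]
        simp_rw [e2]
        rw [setIntegral_indicator measurableSet_Icc]
        have : Ioi (0:ℝ) ∩ Icc 0 γ = Ioc 0 γ := by
          ext t; simp only [mem_inter_iff, mem_Ioi, mem_Icc, mem_Ioc]; constructor
          · rintro ⟨a, b, c⟩; exact ⟨a, c⟩
          · rintro ⟨a, c⟩; exact ⟨a, a.le, c⟩
        rw [this]
        refine setIntegral_congr_fun measurableSet_Ioc fun t ht => ?_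
        rw [hρ1pos t ht.1.le, show -((w + U) * (t:ℂ)) = -(U * t) + -(w * t) by ring, Complex.exp_add]
        ring
      rw [this]; ring
    · intro a b
      rw [hρ1]
      have := hc1.intervalIntegrable (μ := volume) a b
      rw [intervalIntegrable_iff] at this ⊢
      exact this.indicator measurableSet_Ici
    · intro r hr
      rw [hρ1, indicator_of_notMem (by simpa using hr)]
    · have := lap 3 (by simp)
      refine Integrable.of_integral_ne_zero ?_
      have h3 : ((3:ℝ):ℂ) = 3 := by norm_num
      rw [h3, this]
      exact inv_ne_zero (pow_ne_zero _ (hne _ (by simp)))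
  have hout := hI.integral_prod_left
  have hF2 : Integrable (fun ξ : ℝ => (vl 3 ξ ^ (m + 1))⁻¹ * ∫ t in Ioi (0:ℝ), cexp (-(vl 3 ξ * t)) * ρ2 t) := by
    apply exp_int_cancel (γ := γ)
    have h := hout.const_mul ((2 * Real.pi : ℂ))⁻¹
    refine h.congr ?_
    filter_upwards [inner] with ξ hξ
    have hpi : (2 * Real.pi : ℂ) ≠ 0 := by
      simp [Real.pi_ne_zero]
    rw [hξ, ← mul_assoc, inv_mul_cancel₀ hpi, one_mul]
  rw [integral_congr_ae inner, integral_const_mul, lemL ρ2 3 (by norm_num) m ?_ ?_ ?_ hF2 γ]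
  · rw [← mul_assoc, ← sq]
    congr 1
    refine intervalIntegral.integral_congr fun r hr => ?_
    rw [uIcc_of_le hγ.le] at hr
    rw [hρ2, indicator_of_mem hr]
    ring
  · intro a b
    exact hρ2I.intervalIntegrable
  · intro r hr
    rw [hρ2, indicator_of_notMem (fun h => by linarith [h.1])]
  · apply Integrable.integrableOn
    have : (fun t : ℝ => cexp (-((3:ℝ) * t)) * ρ2 t) = (Icc 0 γ).indicator (fun t : ℝ => cexp (-((3:ℝ) * t)) * (((γ - t : ℝ) : ℂ) ^ m / m.factorial * ((t : ℂ) ^ j / j.factorial) * cexp (-(w * t)))) := by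
      ext t
      by_cases h : t ∈ Icc 0 γ
      · rw [hρ2, indicator_of_mem h, indicator_of_mem h]
      · rw [hρ2, indicator_of_notMem h, indicator_of_notMem h, mul_zero]
    rw [this, integrable_indicator_iff measurableSet_Icc]
    apply ContinuousOn.integrableOn_compact isCompact_Icc
    exact Continuous.continuousOn (by fun_prop)

end Sel

end PartB7

section PartB7b

namespace Sel
open Lap Loc Complex MeasureTheory Filter Topology Set

noncomputable def ed (i : Fin 4) (t : ℝ) : ℂ := ![(t : ℂ) + (-1 : ℝ) * I, t + (1 : ℝ) * I, (1 : ℝ) + t * I, (-1 : ℝ) + t * I] i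
noncomputable def cf (i : Fin 4) : ℂ := ![1, -1, I, -I] i
noncomputable def dd (i : Fin 4) : ℂ := ![1, 1, I, I] i

/-- integral over the boundary of the square -/
noncomputable def Sq (F : ℂ → ℂ) : ℂ := ∑ i, cf i * ∫ t in (-1:ℝ)..1, F (ed i t)

lemma Sq_eq (F : ℂ → ℂ) : Sq F = (∫ t in (-1:ℝ)..1, F (t + (-1 : ℝ) * I)) - (∫ t in (-1:ℝ)..1, F (t + (1 : ℝ) * I)) +
    I • (∫ t in (-1:ℝ)..1, F ((1 : ℝ) + t * I)) - I • (∫ t in (-1:ℝ)..1, F ((-1 : ℝ) + t * I)) := by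
  rw [Sq, Fin.sum_univ_four]
  simp only [cf, ed, Matrix.cons_val, smul_eq_mul]
  ring

lemma ed_deriv (i : Fin 4) (t : ℝ) : HasDerivAt (ed i) (dd i) t := by
  have h : HasDerivAt (fun t : ℝ => (t : ℂ)) 1 t := Complex.ofRealCLM.hasDerivAt
  fin_cases i
  · exact h.add_const _
  · exact h.add_const _
  · exact ((h.mul_const I).const_add (((1 : ℝ) : ℂ))).congr_deriv (one_mul I)
  · exact ((h.mul_const I).const_add (((-1 : ℝ) : ℂ))).congr_deriv (one_mul I)

lemma ed_cont (i : Fin 4) : Continuous (ed i) := continuous_iff_continuousAt.mpr fun t => (ed_deriv i t).continuousAt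

lemma ed_ne (i : Fin 4) (t : ℝ) : ed i t ≠ 0 := by
  intro h
  have h1 := congrArg Complex.re h
  have h2 := congrArg Complex.im h
  fin_cases i <;> simp [ed] at h1 h2

lemma ed_sqr (i : Fin 4) {t : ℝ} (ht : |t| ≤ 1) : Sqr (ed i t) := by
  fin_cases i <;> simp [ed, Sqr, ht]

lemma ed_norm (i : Fin 4) (t : ℝ) : 1 ≤ ‖ed i t‖ := by
  have h1 := Complex.abs_re_le_norm (ed i t)
  have h2 := Complex.abs_im_le_norm (ed i t)
  fin_cases i
  · refine le_trans ?_ h2; simp [ed]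
  · refine le_trans ?_ h2; simp [ed]
  · refine le_trans ?_ h1; simp [ed]
  · refine le_trans ?_ h1; simp [ed]

lemma Sq_congr {F G : ℂ → ℂ} (h : ∀ w, Sqr w → w ≠ 0 → F w = G w) : Sq F = Sq G := by
  unfold Sq
  refine Finset.sum_congr rfl fun i _ => ?_
  congr 1
  refine intervalIntegral.integral_congr fun t ht => ?_
  rw [uIcc_of_le (by norm_num)] at ht
  exact h _ (ed_sqr i (abs_le.mpr ht)) (ed_ne i t)

lemma comp_ed {F : ℂ → ℂ} (hF : ContinuousOn F {0}ᶜ) (i : Fin 4) : Continuous (fun t => F (ed i t)) :=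
  hF.comp_continuous (ed_cont i) fun t => ed_ne i t

lemma Sq_add {F G : ℂ → ℂ} (hF : ContinuousOn F {0}ᶜ) (hG : ContinuousOn G {0}ᶜ) : Sq (fun w => F w + G w) = Sq F + Sq G := by
  unfold Sq
  rw [← Finset.sum_add_distrib]
  refine Finset.sum_congr rfl fun i _ => ?_
  rw [intervalIntegral.integral_add ((comp_ed hF i).intervalIntegrable _ _) ((comp_ed hG i).intervalIntegrable _ _), mul_add]

lemma Sq_smul (c : ℂ) (F : ℂ → ℂ) : Sq (fun w => c * F w) = c * Sq F := by
  unfold Sq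
  rw [Finset.mul_sum]
  refine Finset.sum_congr rfl fun i _ => ?_
  rw [intervalIntegral.integral_const_mul]; ring

lemma Sq_sum {ι : Type*} (s : Finset ι) {F : ι → ℂ → ℂ} (hF : ∀ i ∈ s, ContinuousOn (F i) {0}ᶜ) :
    Sq (fun w => ∑ i ∈ s, F i w) = ∑ i ∈ s, Sq (F i) := by
  unfold Sq
  rw [Finset.sum_comm]
  refine Finset.sum_congr rfl fun i _ => ?_
  rw [intervalIntegral.integral_finsetSum, Finset.mul_sum]
  intro j hj
  exact (comp_ed (hF j hj) i).intervalIntegrable _ _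

lemma Sq_swap {a b : ℝ} {G : ℂ → ℝ → ℂ} (hG : ContinuousOn (Function.uncurry G) ({0}ᶜ ×ˢ univ)) :
    Sq (fun w => ∫ r in a..b, G w r) = ∫ r in a..b, Sq (fun w => G w r) := by
  have hc : ∀ i, Continuous (Function.uncurry fun (t r : ℝ) => G (ed i t) r) := by
    intro i
    have : Continuous (fun z : ℝ × ℝ => Function.uncurry G (ed i z.1, z.2)) :=
      hG.comp_continuous (((ed_cont i).comp continuous_fst).prodMk continuous_snd) fun z => ⟨ed_ne i z.1, mem_univ _⟩
    exact this
  unfold Sq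
  rw [intervalIntegral.integral_finsetSum]
  · refine Finset.sum_congr rfl fun i _ => ?_
    rw [intervalIntegral.integral_const_mul]
    congr 1
    apply intervalIntegral_intervalIntegral_swap
    exact ((hc i).continuousOn.integrableOn_compact (isCompact_uIcc.prod isCompact_uIcc)).mono_set
      (prod_mono uIoc_subset_uIcc uIoc_subset_uIcc)
  · intro i _
    apply Continuous.intervalIntegrable
    refine continuous_const.mul ?_
    apply intervalIntegral.continuous_parametric_intervalIntegral_of_continuous'
    exact (hc i).comp continuous_swap

lemma Sq_deriv {F F' : ℂ → ℂ} (h : ∀ w ≠ 0, HasDerivAt F (F' w) w) (hF : ContinuousOn F' {0}ᶜ) : Sq F' = 0 := by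
  have key : ∀ i, ∫ t in (-1:ℝ)..1, dd i * F' (ed i t) = F (ed i 1) - F (ed i (-1)) := by
    intro i
    refine intervalIntegral.integral_eq_sub_of_hasDerivAt (f := fun t => F (ed i t)) (fun t _ => ?_) ?_
    · have := (h _ (ed_ne i t)).scomp t (ed_deriv i t)
      simpa [smul_eq_mul, Function.comp_def] using this
    · exact (continuous_const.mul (comp_ed hF i)).intervalIntegrable _ _
  simp only [intervalIntegral.integral_const_mul] at key
  have k0 := key 0
  have k1 := key 1
  have k2 := key 2
  have k3 := key 3
  rw [Sq, Fin.sum_univ_four]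
  simp only [dd, cf, ed, Matrix.cons_val] at *
  rw [show (-1 : ℂ) * ∫ t in (-1:ℝ)..1, F' (t + (1 : ℝ) * I) = -(1 * ∫ t in (-1:ℝ)..1, F' (t + (1 : ℝ) * I)) by ring,
    show (-I : ℂ) * ∫ t in (-1:ℝ)..1, F' ((-1 : ℝ) + t * I) = -(I * ∫ t in (-1:ℝ)..1, F' ((-1 : ℝ) + t * I)) by ring,
    k0, k1, k2, k3]
  ring

lemma Sq_entire {F : ℂ → ℂ} (h : Differentiable ℂ F) : Sq F = 0 := by
  rw [Sq_eq]
  have := integral_boundary_rect_eq_zero_of_differentiableOn F ⟨-1, -1⟩ ⟨1, 1⟩ h.differentiableOn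
  simpa using this

lemma Sq_inv : Sq (fun w => w⁻¹) = 2 * Real.pi * I := by
  have e : ∀ t : ℝ, (((1 + t ^ 2)⁻¹ : ℝ) : ℂ) = (1 + (t:ℂ) ^ 2)⁻¹ := by intro t; push_cast; rfl
  have hne : ∀ t : ℝ, (1 + (t:ℂ) ^ 2) ≠ 0 := by
    intro t
    have : (1 + t ^ 2 : ℝ) ≠ 0 := by positivity
    exact_mod_cast this
  have hI : ∫ t in (-1:ℝ)..1, (1 + (t:ℂ) ^ 2)⁻¹ = ((Real.pi : ℝ) : ℂ) / 2 := by
    rw [intervalIntegral.integral_congr (g := fun t : ℝ => (((1 + t ^ 2)⁻¹ : ℝ) : ℂ)) (fun t _ => (e t).symm)]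
    rw [intervalIntegral.integral_ofReal, integral_inv_one_add_sq, Real.arctan_neg, Real.arctan_one]
    push_cast; ring
  have hc : ∀ i, IntervalIntegrable (fun t => (ed i t)⁻¹) volume (-1) 1 := fun i =>
    ((ed_cont i).inv₀ (ed_ne i)).intervalIntegrable _ _
  have h1 : (∫ t in (-1:ℝ)..1, (ed 0 t)⁻¹) - ∫ t in (-1:ℝ)..1, (ed 1 t)⁻¹ = 2 * I * (Real.pi / 2) := by
    rw [← intervalIntegral.integral_sub (hc 0) (hc 1), ← hI, ← intervalIntegral.integral_const_mul]
    refine intervalIntegral.integral_congr fun t _ => ?_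
    have n0 := ed_ne 0 t
    have n1 := ed_ne 1 t
    have := hne t
    simp only [ed, Matrix.cons_val, ofReal_neg, ofReal_one, neg_mul, one_mul] at n0 n1 ⊢
    field_simp
    linear_combination (2 * I) * I_sq
  have h2 : (∫ t in (-1:ℝ)..1, (ed 2 t)⁻¹) - ∫ t in (-1:ℝ)..1, (ed 3 t)⁻¹ = 2 * (Real.pi / 2) := by
    rw [← intervalIntegral.integral_sub (hc 2) (hc 3), ← hI, ← intervalIntegral.integral_const_mul]
    refine intervalIntegral.integral_congr fun t _ => ?_
    have n0 := ed_ne 2 t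
    have n1 := ed_ne 3 t
    have := hne t
    simp only [ed, Matrix.cons_val, ofReal_neg, ofReal_one, neg_mul, one_mul] at n0 n1 ⊢
    field_simp
    linear_combination (-2 * t ^ 2) * I_sq
  rw [Sq, Fin.sum_univ_four]
  simp only [cf, Matrix.cons_val]
  linear_combination h1 + I * h2

lemma Sq_exp (a : ℂ) (j : ℕ) : Sq (fun w => cexp (a * w) * (w ^ (j + 1))⁻¹) = 2 * Real.pi * I * (a ^ j / j.factorial) := by
  have hcont : ∀ n, ContinuousOn (fun w : ℂ => cexp (a * w) * (w ^ n)⁻¹) {0}ᶜ := by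
    intro n
    refine ContinuousOn.mul (by fun_prop) (ContinuousOn.inv₀ (by fun_prop) fun w hw => pow_ne_zero _ hw)
  induction j with
  | zero =>
    have hd : Differentiable ℂ (dslope (fun w => cexp (a * w)) 0) := by
      rw [← differentiableOn_univ, differentiableOn_dslope univ_mem]
      exact Differentiable.differentiableOn (by fun_prop)
    have : Sq (fun w => cexp (a * w) * (w ^ (0 + 1))⁻¹) = Sq (fun w => dslope (fun w => cexp (a * w)) 0 w + w⁻¹) := by
      refine Sq_congr fun w _ hw => ?_
      rw [dslope_of_ne _ hw, slope_def_field]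
      simp
      field_simp
      ring
    rw [this, Sq_add hd.continuous.continuousOn (continuousOn_inv₀.mono (fun w hw => hw)), Sq_entire hd, Sq_inv]
    simp
  | succ n ih =>
    have h := Sq_deriv (F := fun w => cexp (a * w) * (w ^ (n + 1))⁻¹)
      (F' := fun w => a * (cexp (a * w) * (w ^ (n + 1))⁻¹) + (-(n + 1 : ℂ)) * (cexp (a * w) * (w ^ (n + 1 + 1))⁻¹)) ?_ ?_
    · rw [Sq_add (F := fun w => a * (cexp (a * w) * (w ^ (n + 1))⁻¹)) (G := fun w => (-(n + 1 : ℂ)) * (cexp (a * w) * (w ^ (n + 1 + 1))⁻¹))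
        (continuousOn_const.mul (hcont _)) (continuousOn_const.mul (hcont _)), Sq_smul, Sq_smul, ih] at h
      have hn : (n + 1 : ℂ) ≠ 0 := by exact_mod_cast n.succ_ne_zero
      have hf : (n.factorial : ℂ) ≠ 0 := by exact_mod_cast n.factorial_ne_zero
      have h2 : Sq (fun w => cexp (a * w) * (w ^ (n + 1 + 1))⁻¹) = a * (2 * Real.pi * I * (a ^ n / n.factorial)) / (n + 1) := by
        rw [eq_div_iff hn]; linear_combination -h
      rw [h2, Nat.factorial_succ]
      push_cast
      field_simp
      ring
    · intro w hw
      have h1 : HasDerivAt (fun w => cexp (a * w)) (cexp (a * w) * (a * 1)) w := ((hasDerivAt_id w).const_mul a).cexp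
      have h2 := (hasDerivAt_pow (n + 1) w).inv (pow_ne_zero _ hw)
      refine (h1.mul h2).congr_deriv ?_
      simp only [Pi.inv_apply, Nat.add_sub_cancel]
      push_cast
      field_simp
      ring
    · exact (continuousOn_const.mul (hcont _)).add (continuousOn_const.mul (hcont _))

lemma beta_int (γ : ℝ) (b : ℕ) : ∀ a : ℕ, ∫ r in (0:ℝ)..γ, r ^ a * (γ - r) ^ b = a.factorial * b.factorial / (a + b + 1).factorial * γ ^ (a + b + 1) := by
  induction b with
  | zero =>
    intro a
    simp [Nat.factorial_succ]
    have : (a.factorial : ℝ) ≠ 0 := by positivity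
    field_simp
  | succ b ih =>
    intro a
    have h : ∫ r in (0:ℝ)..γ, ((a + 1) * (r ^ a * (γ - r) ^ (b + 1)) - (b + 1) * (r ^ (a + 1) * (γ - r) ^ b)) = γ ^ (a + 1) * (γ - γ) ^ (b + 1) - 0 ^ (a + 1) * (γ - 0) ^ (b + 1) := by
      refine intervalIntegral.integral_eq_sub_of_hasDerivAt (f := fun r => r ^ (a + 1) * (γ - r) ^ (b + 1)) (fun r _ => ?_) ?_
      · have h1 := hasDerivAt_pow (a + 1) r
        have h2 := ((hasDerivAt_id r).const_sub γ).pow (b + 1)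
        refine (h1.mul h2).congr_deriv ?_
        simp only [id, Nat.add_sub_cancel, Pi.pow_apply]
        push_cast; ring
      · exact Continuous.intervalIntegrable (by fun_prop) _ _
    rw [intervalIntegral.integral_sub (Continuous.intervalIntegrable (by fun_prop) _ _) (Continuous.intervalIntegrable (by fun_prop) _ _),
      intervalIntegral.integral_const_mul, intervalIntegral.integral_const_mul, ih (a + 1)] at h
    have ha : (a + 1 : ℝ) ≠ 0 := by positivity
    have h2 : ∫ r in (0:ℝ)..γ, r ^ a * (γ - r) ^ (b + 1) = (b + 1) * ((a + 1).factorial * b.factorial / (a + 1 + b + 1).factorial * γ ^ (a + 1 + b + 1)) / (a + 1) := by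
      rw [eq_div_iff ha]
      simp at h
      linear_combination h
    rw [h2, show a + 1 + b + 1 = a + (b + 1) + 1 by ring]
    rw [Nat.factorial_succ a, Nat.factorial_succ b]
    push_cast
    field_simp

end Sel

end PartB7b

section PartB7c

namespace Sel
open Lap Loc Complex MeasureTheory Filter Topology Set

/-- the r-integral -/
noncomputable def AA (m j : ℕ) (γ r : ℝ) : ℂ := (((γ - r : ℝ) : ℂ) ^ m / m.factorial) ^ 2 * ((r : ℂ) ^ j / j.factorial)

lemma AA_cont (m j : ℕ) (γ : ℝ) : Continuous (AA m j γ) := by unfold AA; fun_prop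

lemma ker_LL (k : ℕ) (γ : ℝ) {w : ℂ} (hw : Sqr w) (z : ℝ × ℝ) :
    ker k γ z * LL k w z = (∑ j ∈ Finset.range k, (k.choose (j + 1) : ℂ) * w ^ (k - (j + 1)) *
      (ker (k - (j + 1)) γ z * ((w + vl 3 z.1 + vl 3 z.2) ^ (j + 1))⁻¹)) + w ^ k * ker k γ z := by
  have n3 : w + vl 3 z.1 + vl 3 z.2 ≠ 0 := norm_pos_iff.mp (by linarith [(W3_bd hw z).2.1])
  have u : vl 3 z.1 ≠ 0 := vl_ne (by norm_num) _
  have v : vl 3 z.2 ≠ 0 := vl_ne (by norm_num) _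
  have e : (w + vl 3 z.1) * (w + vl 3 z.2) / (w + vl 3 z.1 + vl 3 z.2) = vl 3 z.1 * vl 3 z.2 / (w + vl 3 z.1 + vl 3 z.2) + w := by
    field_simp; ring
  rw [LL, e, add_pow, Finset.sum_range_succ', mul_add, Finset.mul_sum]
  congr 1
  · refine Finset.sum_congr rfl fun j hj => ?_
    rw [Finset.mem_range] at hj
    obtain ⟨m, rfl⟩ := Nat.exists_eq_add_of_le (Nat.succ_le_of_lt hj)
    have : j.succ + m - (j + 1) = m := by omega
    rw [this, ker, ker, div_pow, mul_pow]
    have p : ∀ x : ℂ, x ≠ 0 → (x ^ (j.succ + m + 1))⁻¹ * x ^ (j + 1) = (x ^ (m + 1))⁻¹ := by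
      intro x hx
      rw [show j.succ + m + 1 = (j + 1) + (m + 1) by simp; ring, pow_add, mul_inv]
      field_simp
    rw [← p _ u, ← p _ v, div_eq_mul_inv]
    ring
  · simp; ring

lemma qq_eq (k : ℕ) (hk : 1 ≤ k) {γ : ℝ} (hγ : 0 < γ) {w : ℂ} (hw : Sqr w) (h0 : w ≠ 0) :
    cexp w * (w ^ k)⁻¹ * qq k γ w = ((k.factorial * (1 / γ) ^ k / (2 * Real.pi)) ^ 2 : ℂ) *
      ((∑ j ∈ Finset.range k, (k.choose (j + 1) : ℂ) * (2 * Real.pi) ^ 2 * ∫ r in (0:ℝ)..γ, AA (k - (j + 1)) j γ r * (cexp ((1 - r) * w) * (w ^ (j + 1))⁻¹))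
        + (∫ z, ker k γ z) * cexp w) := by
  rw [qq]
  simp_rw [ker_LL k γ hw]
  rw [integral_add, integral_finsetSum]
  · simp_rw [integral_const_mul, J_eval _ _ hγ hw]
    rw [mul_left_comm]
    congr 1
    rw [mul_add, Finset.mul_sum]
    congr 1
    · refine Finset.sum_congr rfl fun j hj => ?_
      rw [Finset.mem_range] at hj
      have e : ∀ r : ℝ, AA (k - (j + 1)) j γ r * (cexp ((1 - r) * w) * (w ^ (j + 1))⁻¹) =
          (cexp w * (w ^ (j + 1))⁻¹) * ((((γ - r : ℝ) : ℂ) ^ (k - (j + 1)) / (k - (j + 1)).factorial) ^ 2 * ((r : ℂ) ^ j / j.factorial) * cexp (-(w * r))) := by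
        intro r
        rw [AA, show (1 - (r:ℂ)) * w = w + -(w * r) by ring, Complex.exp_add]; ring
      simp_rw [e]
      rw [intervalIntegral.integral_const_mul]
      have : (w ^ k)⁻¹ * w ^ (k - (j + 1)) = (w ^ (j + 1))⁻¹ := by
        obtain ⟨m, rfl⟩ := Nat.exists_eq_add_of_le (Nat.succ_le_of_lt hj)
        have : j.succ + m - (j + 1) = m := by omega
        rw [this, pow_add]
        field_simp
      rw [← this]; ring
    · have : w ^ k ≠ 0 := pow_ne_zero _ h0
      field_simp
  · intro j _
    exact (J_int _ _ γ hw).const_mul _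
  · refine integrable_finsetSum _ fun j _ => ?_
    exact (J_int _ _ γ hw).const_mul _
  · exact (ker_int k hk γ).const_mul _

lemma AA_int (m j : ℕ) (γ : ℝ) : ∫ r in (0:ℝ)..γ, AA m j γ r * (2 * Real.pi * I * ((1 - (r:ℂ)) ^ j / j.factorial)) =
    2 * Real.pi * I * ((∑ i ∈ Finset.range (j + 1), (j.choose i : ℝ) * (-1) ^ i * (((j + i).factorial * (2 * m).factorial / (j + i + 2 * m + 1).factorial * γ ^ (j + i + 2 * m + 1)) / (m.factorial ^ 2 * j.factorial ^ 2)) : ℝ) : ℂ) := by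
  have e : ∀ r : ℝ, AA m j γ r * (2 * Real.pi * I * ((1 - (r:ℂ)) ^ j / j.factorial)) =
      2 * Real.pi * I * ((∑ i ∈ Finset.range (j + 1), ((j.choose i : ℝ) * (-1) ^ i / (m.factorial ^ 2 * j.factorial ^ 2)) * (r ^ (j + i) * (γ - r) ^ (2 * m)) : ℝ) : ℂ) := by
    intro r
    have : (∑ i ∈ Finset.range (j + 1), ((j.choose i : ℝ) * (-1) ^ i / (m.factorial ^ 2 * j.factorial ^ 2)) * (r ^ (j + i) * (γ - r) ^ (2 * m))) =
        (r ^ j * (γ - r) ^ (2 * m) / (m.factorial ^ 2 * j.factorial ^ 2)) * (1 - r) ^ j := by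
      rw [show (1 - r) ^ j = (-r + 1) ^ j by ring, add_pow, Finset.mul_sum]
      refine Finset.sum_congr rfl fun i _ => ?_
      rw [neg_pow r i]
      ring
    rw [this, AA]
    push_cast
    ring
  simp_rw [e]
  rw [intervalIntegral.integral_const_mul, intervalIntegral.integral_ofReal, intervalIntegral.integral_finsetSum]
  · congr 2
    refine Finset.sum_congr rfl fun i _ => ?_
    rw [intervalIntegral.integral_const_mul, beta_int]
    ring
  · intro i _
    exact Continuous.intervalIntegrable (by fun_prop) _ _

lemma Rpoly_eq (k : ℕ) {γ : ℝ} (hγ : 0 < γ) : Rpoly k γ = (1 / γ) ^ (2 * k) * ∑ j ∈ Finset.range k, (k.choose (j + 1) : ℝ) *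
    (∑ i ∈ Finset.range (j + 1), (j.choose i : ℝ) * (-1) ^ i * (((j + i).factorial * (2 * (k - (j + 1))).factorial / (j + i + 2 * (k - (j + 1)) + 1).factorial * γ ^ (j + i + 2 * (k - (j + 1)) + 1)) / ((k - (j + 1)).factorial ^ 2 * j.factorial ^ 2))) := by
  rw [Rpoly, Finset.mul_sum]
  have : Finset.Icc 1 k = Finset.Ico (0 + 1) (k + 1) := by ext; simp
  rw [this, ← Finset.sum_Ico_add', ← Finset.range_eq_Ico]
  refine Finset.sum_congr rfl fun j hj => ?_
  rw [Finset.mem_range] at hj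
  rw [Finset.mul_sum, Finset.mul_sum]
  refine Finset.sum_congr rfl fun i hi => ?_
  rw [Finset.mem_range] at hi
  obtain ⟨m, rfl⟩ := Nat.exists_eq_add_of_le (Nat.succ_le_of_lt hj)
  obtain ⟨l, rfl⟩ := Nat.exists_eq_add_of_le (Nat.lt_succ_iff.mp hi)
  have h1 : (i + l).succ + m - (i + l + 1) = m := by omega
  have h2 : i + l + 1 - 1 = i + l := by omega
  have h3 : i + l + 1 - i = l + 1 := by omega
  have h4 : 2 * ((i + l).succ + m) - (i + l + 1) + i = i + l + i + 2 * m + 1 := by omega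
  rw [h1, h2, h3, h4]
  have g1 : Real.Gamma (((i + l + 1 : ℕ) : ℝ) + i) = (i + l + i).factorial := by
    rw [← Real.Gamma_nat_eq_factorial]; push_cast; ring_nf
  have g2 : Real.Gamma (((i + l + 1 : ℕ) : ℝ)) = (i + l).factorial := by
    rw [← Real.Gamma_nat_eq_factorial]; push_cast; ring_nf
  have g3 : ((2 * m).choose m : ℝ) = (2 * m).factorial / (m.factorial ^ 2) := by
    have := Nat.choose_mul_factorial_mul_factorial (show m ≤ 2 * m by omega)
    rw [show 2 * m - m = m by omega] at this
    rw [eq_div_iff (by positivity), ← this]; push_cast; ring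
  have g4 : (1 / γ) ^ (2 * ((i + l).succ + m)) * γ ^ (i + l + i + 2 * m + 1) = 1 / γ ^ (l + 1) := by
    rw [show 2 * ((i + l).succ + m) = (i + l + i + 2 * m + 1) + (l + 1) by simp; ring, pow_add, one_div, inv_pow, inv_pow]
    field_simp
  rw [g1, g2, g3]
  rw [div_eq_mul_one_div _ (γ ^ (l + 1)), ← g4]
  field_simp

lemma Sq_qq (k : ℕ) (hk : 1 ≤ k) {γ : ℝ} (hγ : 0 < γ) :
    Sq (fun w => cexp w * (w ^ k)⁻¹ * qq k γ w) = 2 * Real.pi * I * (((k.factorial : ℝ) ^ 2 * Rpoly k γ : ℝ) : ℂ) := by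
  have hGc : ∀ j, ContinuousOn (Function.uncurry fun (w : ℂ) (r : ℝ) => AA (k - (j + 1)) j γ r * (cexp ((1 - r) * w) * (w ^ (j + 1))⁻¹)) ({0}ᶜ ×ˢ univ) := by
    intro j
    have h1 := (AA_cont (k - (j + 1)) j γ).comp continuous_snd (X := ℂ × ℝ)
    refine ContinuousOn.mul h1.continuousOn (ContinuousOn.mul (by fun_prop) (ContinuousOn.inv₀ (by fun_prop) ?_))
    intro x hx
    exact pow_ne_zero _ hx.1
  have hIc : ∀ j, ContinuousOn (fun w : ℂ => ∫ r in (0:ℝ)..γ, AA (k - (j + 1)) j γ r * (cexp ((1 - r) * w) * (w ^ (j + 1))⁻¹)) {0}ᶜ := by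
    intro j
    have : ∀ w : ℂ, ∫ r in (0:ℝ)..γ, AA (k - (j + 1)) j γ r * (cexp ((1 - r) * w) * (w ^ (j + 1))⁻¹) =
        (∫ r in (0:ℝ)..γ, AA (k - (j + 1)) j γ r * cexp ((1 - r) * w)) * (w ^ (j + 1))⁻¹ := by
      intro w
      rw [← intervalIntegral.integral_mul_const]; congr 1; ext r; ring
    simp_rw [this]
    refine ContinuousOn.mul (Continuous.continuousOn ?_) (ContinuousOn.inv₀ (by fun_prop) fun w hw => pow_ne_zero _ hw)
    apply intervalIntegral.continuous_parametric_intervalIntegral_of_continuous'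
    have h1 := (AA_cont (k - (j + 1)) j γ).comp continuous_snd (X := ℂ × ℝ)
    exact Continuous.mul h1 (by fun_prop)
  rw [Sq_congr (fun w hw h0 => qq_eq k hk hγ hw h0), Sq_smul, Sq_add, Sq_sum, Sq_smul, Sq_entire (F := cexp) Complex.differentiable_exp]
  · have e : ∀ j ∈ Finset.range k, Sq (fun w => (k.choose (j + 1) : ℂ) * (2 * Real.pi) ^ 2 * ∫ r in (0:ℝ)..γ, AA (k - (j + 1)) j γ r * (cexp ((1 - r) * w) * (w ^ (j + 1))⁻¹)) =
        (2 * Real.pi * I) * ((2 * Real.pi) ^ 2 * (((k.choose (j + 1) : ℝ) * (∑ i ∈ Finset.range (j + 1), (j.choose i : ℝ) * (-1) ^ i * (((j + i).factorial * (2 * (k - (j + 1))).factorial / (j + i + 2 * (k - (j + 1)) + 1).factorial * γ ^ (j + i + 2 * (k - (j + 1)) + 1)) / ((k - (j + 1)).factorial ^ 2 * j.factorial ^ 2))) : ℝ) : ℂ)) := by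
      intro j _
      rw [Sq_smul, Sq_swap (hGc j)]
      simp_rw [Sq_smul, Sq_exp]
      rw [AA_int]
      push_cast
      ring
    rw [Finset.sum_congr rfl e, ← Finset.mul_sum, ← Finset.mul_sum, ← Complex.ofReal_sum, Rpoly_eq k hγ]
    generalize (∑ j ∈ Finset.range k, _ : ℝ) = R
    have hpi : (Real.pi : ℂ) ≠ 0 := by exact_mod_cast Real.pi_ne_zero
    have hg : (γ : ℂ) ≠ 0 := by exact_mod_cast hγ.ne'
    push_cast
    field_simp
    ring
  · intro j _
    exact continuousOn_const.mul (hIc j)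
  · exact continuousOn_finsetSum _ fun j _ => continuousOn_const.mul (hIc j)
  · exact Continuous.continuousOn (by fun_prop)

end Sel

end PartB7c

section PartB6a

namespace Sel
open Filter Topology Loc MeasureTheory

/-- generalized divisor function -/
noncomputable def tk (k n : ℕ) : ℕ := ((ArithmeticFunction.zeta ^ k : ArithmeticFunction ℕ) n)

lemma tk_mult (k : ℕ) : (ArithmeticFunction.zeta ^ k : ArithmeticFunction ℕ).IsMultiplicative := by
  induction k with
  | zero => rw [pow_zero]; exact ArithmeticFunction.isMultiplicative_one
  | succ k ih => rw [pow_succ]; exact ih.mul ArithmeticFunction.isMultiplicative_zeta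

lemma tk_prime (k : ℕ) {p : ℕ} (hp : p.Prime) : tk k p = k := by
  unfold tk
  induction k with
  | zero => simp [ArithmeticFunction.one_apply, hp.ne_one]
  | succ k ih =>
    rw [pow_succ, ArithmeticFunction.mul_apply, Nat.sum_divisorsAntidiagonal (f := fun a b => (ArithmeticFunction.zeta ^ k : ArithmeticFunction ℕ) a * ArithmeticFunction.zeta b), hp.sum_divisors, Nat.div_self hp.pos, Nat.div_one]
    rw [ih]
    have h1 := (tk_mult k).1
    rw [h1]
    simp [hp.ne_zero]
    try ring

lemma tk_sf (k : ℕ) {n : ℕ} (hn : Squarefree n) : tk k n = k ^ n.primeFactors.card := by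
  conv_lhs => rw [← Nat.prod_primeFactors_of_squarefree hn]
  change (ArithmeticFunction.zeta ^ k : ArithmeticFunction ℕ) _ = _
  rw [(tk_mult k).map_prod_of_prime n.primeFactors (fun p hp => Nat.prime_of_mem_primeFactors hp)]
  change ∏ p ∈ n.primeFactors, tk k p = _
  rw [Finset.prod_congr rfl (g := fun _ => k) fun p hp => (tk_prime k (Nat.prime_of_mem_primeFactors hp) :)]
  simp

lemma tk_cast (k n : ℕ) : (tk k n : ℂ) = ((ArithmeticFunction.zeta : ArithmeticFunction ℂ) ^ k) n := by
  unfold tk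
  have : (((ArithmeticFunction.zeta ^ k : ArithmeticFunction ℕ) : ArithmeticFunction ℂ)) = ((ArithmeticFunction.zeta : ArithmeticFunction ℂ) ^ k) := by
    induction k with
    | zero => simp
    | succ k ih => rw [pow_succ, pow_succ, ← ih, ArithmeticFunction.natCoe_mul]
  rw [← this]; simp

/-- indicator of integers coprime to q -/
noncomputable def uq (q : ℕ) : ArithmeticFunction ℂ :=
  ⟨fun n => if n ≠ 0 ∧ n.Coprime q then 1 else 0, by simp⟩

lemma uq_apply (q n : ℕ) : uq q n = if n ≠ 0 ∧ n.Coprime q then 1 else 0 := rfl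

lemma uq_pow (q k n : ℕ) : ((uq q) ^ k) n = if n.Coprime q then (tk k n : ℂ) else 0 := by
  rw [tk_cast]
  induction k generalizing n with
  | zero =>
    rw [pow_zero, pow_zero]
    by_cases h : n = 1
    · simp [h]
    · simp [ArithmeticFunction.one_apply, h]
  | succ k ih =>
    rw [pow_succ, pow_succ, ArithmeticFunction.mul_apply, ArithmeticFunction.mul_apply]
    by_cases h : n.Coprime q
    · rw [if_pos h]
      refine Finset.sum_congr rfl fun x hx => ?_
      have hx' := Nat.mem_divisorsAntidiagonal.mp hx
      have h1 : x.1.Coprime q := Nat.Coprime.coprime_dvd_left ⟨x.2, hx'.1.symm⟩ h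
      have h2 : x.2.Coprime q := Nat.Coprime.coprime_dvd_left ⟨x.1, by rw [mul_comm]; exact hx'.1.symm⟩ h
      have h3 : x.2 ≠ 0 := fun h0 => hx'.2 (by rw [← hx'.1, h0, mul_zero])
      rw [ih, if_pos h1, uq_apply, if_pos ⟨h3, h2⟩]
      simp [ArithmeticFunction.zeta_apply, h3]
    · rw [if_neg h]
      refine Finset.sum_eq_zero fun x hx => ?_
      have hx' := Nat.mem_divisorsAntidiagonal.mp hx
      rw [ih, uq_apply]
      by_cases h1 : x.1.Coprime q
      · have : ¬ x.2.Coprime q := fun h2 => h (by rw [← hx'.1]; exact h1.mul_left h2)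
        simp [this]
      · simp [h1]

lemma uq_series (q : ℕ) (hq : q ≠ 0) {s : ℂ} (hs : 1 < s.re) :
    LSeriesHasSum (uq q) s ((∏ p ∈ q.primeFactors, (1 - (p : ℂ) ^ (-s))) * riemannZeta s) := by
  have : NeZero q := ⟨hq⟩
  have hs1 : s ≠ 1 := by rintro rfl; simp at hs
  rw [← DirichletCharacter.LFunctionTrivChar_eq_mul_riemannZeta hs1, DirichletCharacter.LFunctionTrivChar,
    DirichletCharacter.LFunction_eq_LSeries _ hs]
  have h := (ZMod.LSeriesSummable_of_one_lt_re (fun x => (1 : DirichletCharacter ℂ q) x) hs).LSeriesHasSum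
  refine (LSeriesHasSum_congr s _ ?_).mp h
  intro n hn
  rw [uq_apply]
  by_cases hc : n.Coprime q
  · rw [if_pos ⟨hn, hc⟩, MulChar.one_apply ((ZMod.isUnit_iff_coprime n q).mpr hc)]
  · rw [if_neg (fun h => hc h.2), MulChar.map_nonunit _ (fun h => hc ((ZMod.isUnit_iff_coprime n q).mp h))]

lemma uq_pow_series (q k : ℕ) (hq : q ≠ 0) {s : ℂ} (hs : 1 < s.re) :
    LSeriesHasSum ((uq q) ^ k : ArithmeticFunction ℂ) s (((∏ p ∈ q.primeFactors, (1 - (p : ℂ) ^ (-s))) * riemannZeta s) ^ k) := by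
  induction k with
  | zero =>
    rw [pow_zero, pow_zero]
    have := (LSeriesHasSum_iff (f := LSeries.delta) (s := s) (a := 1)).mpr ⟨?_, ?_⟩
    · refine (LSeriesHasSum_congr s _ ?_).mp this
      intro n hn
      simp [LSeries.delta, ArithmeticFunction.one_apply]
    · refine LSeriesSummable_of_bounded_of_one_lt_re (m := 1) (fun n hn => ?_) hs
      unfold LSeries.delta; split_ifs <;> simp
    · rw [LSeries_delta]; rfl
  | succ k ih =>
    rw [pow_succ, pow_succ]
    exact ArithmeticFunction.LSeriesHasSum_mul ih (uq_series q hq hs)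

open Classical in
lemma P_series (k : ℕ) (P : Finset ℕ) (hP : ∀ p ∈ P, p.Prime) {s : ℂ} (hs : 1 < s.re) :
    LSeriesHasSum (fun n => if ∀ p ∈ P, p ∣ n then (tk k n : ℂ) else 0) s
      (riemannZeta s ^ k * ∏ p ∈ P, ff k ((p : ℂ) ^ (-s))) := by
  have key : ∀ A ∈ P.powerset, LSeriesHasSum ((-1 : ℂ) ^ A.card • (fun n => ((uq (∏ p ∈ A, p)) ^ k : ArithmeticFunction ℂ) n)) s
      ((-1 : ℂ) ^ A.card * ((∏ p ∈ A, (1 - (p : ℂ) ^ (-s))) * riemannZeta s) ^ k) := by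
    intro A hA
    have hA' : ∀ p ∈ A, p.Prime := fun p hp => hP p (Finset.mem_powerset.mp hA hp)
    have h := uq_pow_series (∏ p ∈ A, p) k (Finset.prod_ne_zero_iff.mpr fun p hp => (hA' p hp).ne_zero) hs
    rw [Nat.primeFactors_prod hA'] at h
    exact h.smul _
  have h2 := LSeriesHasSum.sum key
  have e : ∑ A ∈ P.powerset, ((-1 : ℂ) ^ A.card * ((∏ p ∈ A, (1 - (p : ℂ) ^ (-s))) * riemannZeta s) ^ k)
      = riemannZeta s ^ k * ∏ p ∈ P, ff k ((p : ℂ) ^ (-s)) := by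
    unfold ff
    simp_rw [sub_eq_add_neg (1 : ℂ) ((_ : ℂ) ^ k)]
    rw [Finset.prod_one_add, Finset.mul_sum]
    refine Finset.sum_congr rfl fun A hA => ?_
    rw [mul_pow, ← Finset.prod_pow, Finset.prod_neg]
    ring
  rw [e] at h2
  refine (LSeriesHasSum_congr s _ ?_).mp h2
  intro n hn
  simp only [Finset.sum_apply, Pi.smul_apply, smul_eq_mul, uq_pow]
  have e2 : (if ∀ p ∈ P, p ∣ n then (tk k n : ℂ) else 0) = (tk k n : ℂ) * ∏ p ∈ P, (1 + -(if ¬ p ∣ n then 1 else 0)) := by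
    split_ifs with h
    · rw [Finset.prod_congr rfl (g := fun _ => (1:ℂ)) (fun p hp => by simp [h p hp])]; simp
    · push Not at h
      obtain ⟨p, hp, hpn⟩ := h
      rw [Finset.prod_eq_zero hp (by simp [hpn])]; simp
  rw [e2, Finset.prod_one_add, Finset.mul_sum]
  refine Finset.sum_congr rfl fun A hA => ?_
  have hA' : ∀ p ∈ A, p.Prime := fun p hp => hP p (Finset.mem_powerset.mp hA hp)
  rw [Finset.prod_neg]
  have e3 : n.Coprime (∏ p ∈ A, p) ↔ ∀ p ∈ A, ¬ p ∣ n := by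
    rw [Nat.coprime_prod_right_iff]
    refine forall₂_congr fun p hp => ?_
    rw [Nat.coprime_comm, (hA' p hp).coprime_iff_not_dvd]
  by_cases h : ∀ p ∈ A, ¬ p ∣ n
  · rw [if_pos (e3.mpr h), Finset.prod_congr rfl (g := fun _ => (1:ℂ)) (fun p hp => by simp [h p hp])]; simp; ring
  · rw [if_neg (fun h' => h (e3.mp h'))]
    push Not at h
    obtain ⟨p, hp, hpn⟩ := h
    rw [Finset.prod_eq_zero hp (by simp [hpn])]; simp

/-- the coefficients -/
noncomputable def an (k : ℕ) (T : ℝ) (n : ℕ) : ℝ := tk k n * (∑ d ∈ n.divisors, wt k T d) ^ 2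

lemma an_nonneg (k : ℕ) (T : ℝ) (n : ℕ) : 0 ≤ an k T n := by unfold an; positivity

open Classical in
lemma divisors_sum (k : ℕ) (T : ℝ) {n : ℕ} (hn : n ≠ 0) :
    ∑ d ∈ n.divisors, wt k T d = ∑ d ∈ Finset.Icc 1 ⌊Real.exp T⌋₊, if (∀ p ∈ d.primeFactors, p ∣ n) then wt k T d else 0 := by
  have h1 : ∑ d ∈ n.divisors, wt k T d = ∑ d ∈ n.divisors ∪ Finset.Icc 1 ⌊Real.exp T⌋₊, if (∀ p ∈ d.primeFactors, p ∣ n) then wt k T d else 0 := by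
    have : ∑ d ∈ n.divisors, wt k T d = ∑ d ∈ n.divisors, if (∀ p ∈ d.primeFactors, p ∣ n) then wt k T d else 0 := by
      refine Finset.sum_congr rfl fun d hd => ?_
      rw [if_pos]
      exact fun p hp => (Nat.dvd_of_mem_primeFactors hp).trans (Nat.dvd_of_mem_divisors hd)
    rw [this]
    refine Finset.sum_subset Finset.subset_union_left fun d _ hd => ?_
    split_ifs with h
    · by_contra hne
      refine hd (Nat.mem_divisors.mpr ⟨?_, hn⟩)
      rw [← Nat.prod_primeFactors_of_squarefree (wt_ne hne).1]
      exact Finset.prod_primes_dvd n (fun p hp => (Nat.prime_of_mem_primeFactors hp).prime) h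
    · rfl
  rw [h1]
  symm
  refine Finset.sum_subset Finset.subset_union_right fun d _ hd => ?_
  split_ifs with h
  · by_contra hne
    refine hd (Finset.mem_Icc.mpr ⟨Nat.pos_of_ne_zero (wt_ne hne).1.ne_zero, (wt_ne hne).2⟩)
  · rfl

lemma an_series (k : ℕ) (T : ℝ) {s : ℂ} (hs : 1 < s.re) :
    LSeriesHasSum (fun n => (an k T n : ℂ)) s (riemannZeta s ^ k * QQ k T s) := by
  classical
  set R := Finset.Icc 1 ⌊Real.exp T⌋₊ with hR
  have key : ∀ d ∈ R, ∀ e ∈ R, LSeriesHasSum (((wt k T d : ℂ) * (wt k T e : ℂ)) • (fun n => if ∀ p ∈ d.primeFactors ∪ e.primeFactors, p ∣ n then (tk k n : ℂ) else 0)) s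
      (((wt k T d : ℂ) * (wt k T e : ℂ)) * (riemannZeta s ^ k * ∏ p ∈ d.primeFactors ∪ e.primeFactors, ff k ((p : ℂ) ^ (-s)))) := by
    intro d _ e _
    refine (P_series k _ ?_ hs).smul _
    intro p hp
    rcases Finset.mem_union.mp hp with h | h
    · exact Nat.prime_of_mem_primeFactors h
    · exact Nat.prime_of_mem_primeFactors h
  have h2 := LSeriesHasSum.sum fun d hd => LSeriesHasSum.sum (key d hd)
  have e : ∑ d ∈ R, ∑ e ∈ R, (((wt k T d : ℂ) * (wt k T e : ℂ)) * (riemannZeta s ^ k * ∏ p ∈ d.primeFactors ∪ e.primeFactors, ff k ((p : ℂ) ^ (-s)))) = riemannZeta s ^ k * QQ k T s := by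
    unfold QQ
    simp only [Finset.mul_sum, ← hR]
    refine Finset.sum_congr rfl fun d _ => Finset.sum_congr rfl fun e _ => ?_
    ring
  rw [e] at h2
  refine (LSeriesHasSum_congr s _ ?_).mp h2
  intro n hn
  unfold an
  rw [divisors_sum k T hn, pow_two, Finset.sum_mul_sum]
  simp only [Finset.sum_apply, Pi.smul_apply, smul_eq_mul, ← hR]
  push_cast
  rw [Finset.mul_sum]
  refine Finset.sum_congr rfl fun d _ => ?_
  rw [Finset.mul_sum]
  refine Finset.sum_congr rfl fun e _ => ?_
  simp only [Finset.mem_union, or_imp, forall_and]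
  rw [ite_and]
  split_ifs <;> (push_cast; ring)

end Sel

end PartB6a

section PartB6b

namespace Mel
open Filter Topology MeasureTheory Complex Set

/-- admissible test functions -/
def IsG (g : ℝ → ℝ) : Prop := ContDiff ℝ (⊤ : ℕ∞) g ∧ Function.support g ⊆ Set.Icc 1 2

/-- Mellin transform -/
noncomputable def MM (g : ℝ → ℝ) (s : ℂ) : ℂ := mellin (fun t => (g t : ℂ)) s

lemma IsG.zero {g : ℝ → ℝ} (h : IsG g) {t : ℝ} (ht : t ∉ Icc (1:ℝ) 2) : g t = 0 := by
  by_contra h0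
  exact ht (h.2 h0)

lemma IsG.deriv {g : ℝ → ℝ} (h : IsG g) : IsG (fun t => -(t * deriv g t)) := by
  refine ⟨?_, ?_⟩
  · have h1 : ContDiff ℝ (⊤ : ℕ∞) (_root_.deriv g) := (contDiff_infty_iff_deriv.mp h.1).2
    exact (contDiff_id.mul h1).neg
  · intro t ht
    have h1 : _root_.deriv g t ≠ 0 := by
      intro h0; apply ht; simp [h0]
    have h2 := support_deriv_subset (f := g) h1
    exact (closure_minimal h.2 isClosed_Icc) h2

lemma MM_eq {g : ℝ → ℝ} (h : IsG g) (s : ℂ) : MM g s = ∫ t in (1/2:ℝ)..3, (t:ℂ)^(s-1) * (g t:ℂ) := by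
  unfold MM mellin
  rw [intervalIntegral.integral_of_le (by norm_num)]
  refine setIntegral_eq_of_subset_of_forall_sdiff_eq_zero measurableSet_Ioi ?_ ?_
  · intro t ht; exact lt_trans (by norm_num) ht.1
  · intro t ht
    have hz : g t = 0 := h.zero fun h1 => ?_
    · simp [hz]
    exact ht.2 ⟨by linarith [h1.1], by linarith [h1.2]⟩

lemma slit_of {t : ℝ} (ht : 0 < t) : (t : ℂ) ∈ slitPlane := by
  rw [Complex.mem_slitPlane_iff]; left; simpa using ht

lemma cpow_contOn (s : ℂ) : ContinuousOn (fun t : ℝ => (t:ℂ)^s) (uIcc (1/2:ℝ) 3) := by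
  rw [uIcc_of_le (by norm_num)]
  intro t ht
  have ht0 : 0 < t := by linarith [ht.1]
  exact (ContinuousAt.cpow (Complex.continuous_ofReal.continuousAt) continuousAt_const (slit_of ht0)).continuousWithinAt

lemma MM_deriv {g : ℝ → ℝ} (h : IsG g) (s : ℂ) : s * MM g s = MM (fun t => -(t * deriv g t)) s := by
  rw [MM_eq h, MM_eq h.deriv]
  have hgd : Differentiable ℝ g := h.1.differentiable (by simp)
  have hgc : Continuous g := hgd.continuous
  have hg' : Continuous (deriv g) := h.1.continuous_deriv (by simp)
  have hd : ∀ t ∈ uIcc (1/2:ℝ) 3, HasDerivAt (fun t : ℝ => (t:ℂ)^s * (g t:ℂ)) (s * ((t:ℂ)^(s-1) * (g t:ℂ)) - (t:ℂ)^(s-1) * ((-(t * deriv g t) : ℝ) : ℂ)) t := by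
    intro t ht
    rw [uIcc_of_le (by norm_num)] at ht
    have ht0 : 0 < t := by linarith [ht.1]
    have htc : (t:ℂ) ≠ 0 := by exact_mod_cast ht0.ne'
    have h1 : HasDerivAt (fun t : ℝ => (t:ℂ)^s) (s * (t:ℂ)^(s-1)) t := by
      have := (hasDerivAt_id (t:ℂ)).cpow_const (c := s) (slit_of ht0)
      simpa using this.comp_ofReal
    have h2 : HasDerivAt (fun t : ℝ => (g t : ℂ)) ((deriv g t : ℝ) : ℂ) t := (hgd t).hasDerivAt.ofReal_comp
    have h3 := h1.mul h2
    refine h3.congr_deriv ?_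
    have : (t:ℂ)^s = (t:ℂ)^(s-1) * t := by rw [cpow_sub _ _ htc, cpow_one]; field_simp
    rw [this]; push_cast; ring
  have hc1 : ContinuousOn (fun t : ℝ => s * ((t:ℂ)^(s-1) * (g t:ℂ))) (uIcc (1/2:ℝ) 3) :=
    continuousOn_const.mul ((cpow_contOn _).mul (Complex.continuous_ofReal.comp hgc).continuousOn)
  have hc2 : ContinuousOn (fun t : ℝ => (t:ℂ)^(s-1) * ((-(t * deriv g t) : ℝ) : ℂ)) (uIcc (1/2:ℝ) 3) :=
    (cpow_contOn _).mul (Complex.continuous_ofReal.comp (by fun_prop)).continuousOn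
  have := intervalIntegral.integral_eq_sub_of_hasDerivAt hd (hc1.sub hc2).intervalIntegrable
  rw [intervalIntegral.integral_sub hc1.intervalIntegrable hc2.intervalIntegrable,
    intervalIntegral.integral_const_mul] at this
  have z1 : g 3 = 0 := h.zero (by norm_num)
  have z2 : g (1/2) = 0 := h.zero (by norm_num)
  rw [z1, z2] at this
  simp only [ofReal_zero, mul_zero, sub_zero] at this
  exact sub_eq_zero.mp this

lemma MM_bd0 {g : ℝ → ℝ} (h : IsG g) : ∃ C > 0, ∀ s : ℂ, 0 ≤ s.re → s.re ≤ 3 → ‖MM g s‖ ≤ C := by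
  have hgc : Continuous g := h.1.continuous
  obtain ⟨B, hB⟩ := (isCompact_Icc (a := (1:ℝ)) (b := 2)).exists_bound_of_continuousOn hgc.continuousOn
  refine ⟨(4 * (|B|+1)) * |3 - 1/2|, by norm_num; positivity, fun s h0 h3 => ?_⟩
  rw [MM_eq h]
  refine intervalIntegral.norm_integral_le_of_norm_le_const fun t ht => ?_
  by_cases ht1 : t ∈ Icc (1:ℝ) 2
  · rw [norm_mul, norm_cpow_eq_rpow_re_of_pos (by linarith [ht1.1])]
    have e1 : t ^ (s-1).re ≤ 4 := by
      calc t ^ (s-1).re ≤ t ^ (2:ℝ) := Real.rpow_le_rpow_of_exponent_le ht1.1 (by simp; linarith)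
        _ = t^2 := by norm_num
        _ ≤ 4 := by nlinarith [ht1.1, ht1.2]
    have e2 : ‖(g t : ℂ)‖ ≤ |B| + 1 := by
      rw [norm_real]; linarith [hB t ht1, le_abs_self B]
    gcongr
  · rw [h.zero ht1]; simp; positivity

lemma MM_bd (A : ℕ) : ∀ {g : ℝ → ℝ} (_ : IsG g), ∃ C > 0, ∀ s : ℂ, 0 ≤ s.re → s.re ≤ 3 → ‖s‖^A * ‖MM g s‖ ≤ C := by
  induction A with
  | zero => intro g h; simpa using MM_bd0 h
  | succ A ih =>
    intro g h
    obtain ⟨C, hC, hb⟩ := ih h.deriv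
    refine ⟨C, hC, fun s h0 h3 => ?_⟩
    have := hb s h0 h3
    rw [← MM_deriv h, norm_mul] at this
    calc ‖s‖^(A+1) * ‖MM g s‖ = ‖s‖^A * (‖s‖ * ‖MM g s‖) := by ring
      _ ≤ C := this

lemma IsG.bigO_top {g : ℝ → ℝ} (h : IsG g) (a : ℝ) : (fun t => (g t : ℂ)) =O[atTop] (fun t : ℝ => t ^ (-a)) := by
  have : (fun t => (g t : ℂ)) =ᶠ[atTop] (fun _ => (0:ℂ)) := by
    filter_upwards [eventually_gt_atTop 2] with t ht
    rw [h.zero]; simp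
    intro h1; linarith [h1.2]
  exact this.trans_isBigO (Asymptotics.isBigO_zero _ _)

lemma IsG.bigO_bot {g : ℝ → ℝ} (h : IsG g) (a : ℝ) : (fun t => (g t : ℂ)) =O[𝓝[>] 0] (fun t : ℝ => t ^ (-a)) := by
  have : (fun t => (g t : ℂ)) =ᶠ[𝓝[>] 0] (fun _ => (0:ℂ)) := by
    filter_upwards [mem_nhdsWithin_of_mem_nhds (Iio_mem_nhds (show (0:ℝ) < 1 by norm_num))] with t ht
    rw [h.zero]; simp
    intro h1; linarith [h1.1, mem_Iio.mp ht]
  exact this.trans_isBigO (Asymptotics.isBigO_zero _ _)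

lemma IsG.locInt {g : ℝ → ℝ} (h : IsG g) : LocallyIntegrableOn (fun t => (g t : ℂ)) (Ioi 0) :=
  ((Complex.continuous_ofReal.comp h.1.continuous).locallyIntegrable).locallyIntegrableOn _

lemma MM_diff {g : ℝ → ℝ} (h : IsG g) : Differentiable ℂ (MM g) := fun s =>
  mellin_differentiableAt_of_isBigO_rpow h.locInt (h.bigO_top (s.re+1)) (by linarith) (h.bigO_bot (s.re-1)) (by linarith)

lemma MM_conv {g : ℝ → ℝ} (h : IsG g) (s : ℂ) : MellinConvergent (fun t => (g t : ℂ)) s :=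
  mellinConvergent_of_isBigO_rpow h.locInt (h.bigO_top (s.re+1)) (by linarith) (h.bigO_bot (s.re-1)) (by linarith)

lemma MM_one (g : ℝ → ℝ) : MM g 1 = ((∫ x in Ioi (0:ℝ), g x : ℝ) : ℂ) := by
  unfold MM mellin
  simp only [sub_self, cpow_zero, one_smul]
  exact integral_ofReal

lemma MM_dec (A : ℕ) {g : ℝ → ℝ} (h : IsG g) : ∃ C > 0, ∀ s : ℂ, 9/10 ≤ s.re → s.re ≤ 2 →
    (1 + ‖s‖)^A * ‖MM g s‖ ≤ C := by
  obtain ⟨C, hC, hb⟩ := MM_bd A h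
  refine ⟨3^A * C, by positivity, fun s h0 h2 => ?_⟩
  have hs : 1 + ‖s‖ ≤ 3 * ‖s‖ := by linarith [s.re_le_norm]
  calc (1 + ‖s‖)^A * ‖MM g s‖ ≤ (3*‖s‖)^A * ‖MM g s‖ := by gcongr
    _ = 3^A * (‖s‖^A * ‖MM g s‖) := by ring
    _ ≤ 3^A * C := by gcongr; exact hb s (by linarith) (by linarith)

lemma MM_vert {g : ℝ → ℝ} (h : IsG g) : Integrable (fun y : ℝ => MM g ((2:ℝ) + y * I)) := by
  obtain ⟨C, hC, hb⟩ := MM_dec 2 h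
  refine Integrable.mono' (g := fun y : ℝ => C * (1 + y^2)⁻¹) (integrable_inv_one_add_sq.const_mul C) ?_ ?_
  · exact ((MM_diff h).continuous.comp (by fun_prop)).aestronglyMeasurable
  · refine Eventually.of_forall fun y => ?_
    have := hb ((2:ℝ) + y * I) (by simp; norm_num) (by simp)
    have h1 : |y| ≤ ‖((2:ℝ):ℂ) + y * I‖ := by
      have := Complex.abs_im_le_norm (((2:ℝ):ℂ) + y * I); simpa using this
    rw [← div_eq_mul_inv, le_div_iff₀ (by positivity), mul_comm]
    refine le_trans ?_ this
    gcongr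
    nlinarith [sq_abs y, abs_nonneg y]

lemma MM_inv {g : ℝ → ℝ} (h : IsG g) {x : ℝ} (hx : 0 < x) :
    ∫ y : ℝ, (x:ℂ) ^ (-((2:ℝ) + y * I)) * MM g ((2:ℝ) + y * I) = 2 * Real.pi * (g x : ℂ) := by
  have := mellinInv_mellin_eq 2 (fun t => (g t : ℂ)) hx (MM_conv h _) (MM_vert h) (Complex.continuous_ofReal.comp h.1.continuous).continuousAt
  rw [← this, mellinInv]
  have hp : (Real.pi : ℂ) ≠ 0 := by exact_mod_cast Real.pi_ne_zero
  change _ = _ * ((1 / (2 * Real.pi)) • ∫ y : ℝ, (x:ℂ) ^ (-((2:ℝ) + y * I)) * MM g ((2:ℝ) + y * I))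
  generalize (∫ y : ℝ, (x:ℂ) ^ (-((2:ℝ) + y * I)) * MM g ((2:ℝ) + y * I)) = J
  rw [Complex.real_smul]
  push_cast
  field_simp

end Mel

end PartB6b

section PartB6c

namespace Sel
open Filter Topology MeasureTheory Complex Set

/-- horizontal segment integral -/
noncomputable def Hs (F : ℂ → ℂ) (a b y : ℝ) : ℂ := ∫ x : ℝ in a..b, F (x + y * I)
/-- vertical segment integral -/
noncomputable def Vs (F : ℂ → ℂ) (x c d : ℝ) : ℂ := ∫ y : ℝ in c..d, F (x + y * I)

lemma rect0 {F : ℂ → ℂ} (hd : ∀ s : ℂ, 9/10 ≤ s.re → s ≠ 1 → DifferentiableAt ℂ F s)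
    {a b c d : ℝ} (hab : a ≤ b) (hcd : c ≤ d) (ha : 9/10 ≤ a) (h1 : b < 1 ∨ 1 < a ∨ d < 0 ∨ 0 < c) :
    Hs F a b c - Hs F a b d + I * Vs F b c d - I * Vs F a c d = 0 := by
  have := Complex.integral_boundary_rect_eq_zero_of_differentiableOn F (⟨a, c⟩ : ℂ) (⟨b, d⟩ : ℂ) ?_
  · simpa [Hs, Vs] using this
  · intro s hs
    simp only [uIcc_of_le hab, uIcc_of_le hcd, mem_reProdIm, mem_Icc] at hs
    refine (hd s (by linarith [hs.1.1]) ?_).differentiableWithinAt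
    rintro rfl
    simp only [one_re, one_im] at hs
    rcases h1 with h | h | h | h <;> linarith [hs.1.1, hs.1.2, hs.2.1, hs.2.2]

lemma contour_fin {F : ℂ → ℂ} (hd : ∀ s : ℂ, 9/10 ≤ s.re → s ≠ 1 → DifferentiableAt ℂ F s)
    {r M : ℝ} (hr : 0 < r) (hr1 : r < 1/10) (hM : 1 ≤ M) :
    I * (Vs F 2 (-M) M - Vs F (9/10) (-M) M) = Hs F (9/10) 2 M - Hs F (9/10) 2 (-M) +
      (Hs F (1-r) (1+r) (-r) - Hs F (1-r) (1+r) r + I * Vs F (1+r) (-r) r - I * Vs F (1-r) (-r) r) := by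
  have e1 := rect0 hd (a := 9/10) (b := 1-r) (c := -M) (d := M) (by linarith) (by linarith) le_rfl (Or.inl (by linarith))
  have e2 := rect0 hd (a := 1+r) (b := 2) (c := -M) (d := M) (by linarith) (by linarith) (by linarith) (Or.inr (Or.inl (by linarith)))
  have e3 := rect0 hd (a := 1-r) (b := 1+r) (c := r) (d := M) (by linarith) (by linarith) (by linarith) (Or.inr (Or.inr (Or.inr (by linarith))))
  have e4 := rect0 hd (a := 1-r) (b := 1+r) (c := -M) (d := -r) (by linarith) (by linarith) (by linarith) (Or.inr (Or.inr (Or.inl (by linarith))))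
  have hH : ∀ y : ℝ, y ≠ 0 → ∀ a b : ℝ, 9/10 ≤ a → 9/10 ≤ b → IntervalIntegrable (fun x : ℝ => F (x + y * I)) volume a b := by
    intro y hy a b ha hb
    refine ContinuousOn.intervalIntegrable fun x hx => ?_
    have hx' : 9/10 ≤ x := le_trans (le_min ha hb) hx.1
    have h := (hd (x + y * I) (by simpa using hx') (fun h => hy (by simpa using congrArg im h))).continuousAt
    exact (ContinuousAt.comp (f := fun x : ℝ => (x:ℂ) + y * I) h (by fun_prop)).continuousWithinAt
  have hV : ∀ x : ℝ, 9/10 ≤ x → x ≠ 1 → ∀ a b : ℝ, IntervalIntegrable (fun y : ℝ => F (x + y * I)) volume a b := by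
    intro x hx hx1 a b
    refine ContinuousOn.intervalIntegrable fun y _ => ?_
    have h := (hd (x + y * I) (by simpa using hx) (fun h => hx1 (by simpa using congrArg re h))).continuousAt
    exact (ContinuousAt.comp (f := fun y : ℝ => (x:ℂ) + y * I) h (by fun_prop)).continuousWithinAt
  have sH : ∀ y : ℝ, y ≠ 0 → Hs F (9/10) 2 y = Hs F (9/10) (1-r) y + Hs F (1-r) (1+r) y + Hs F (1+r) 2 y := by
    intro y hy
    unfold Hs
    rw [intervalIntegral.integral_add_adjacent_intervals, intervalIntegral.integral_add_adjacent_intervals] <;>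
      apply hH y hy <;> linarith
  have sV : ∀ x : ℝ, 9/10 ≤ x → x ≠ 1 → Vs F x (-M) M = Vs F x (-M) (-r) + Vs F x (-r) r + Vs F x r M := by
    intro x hx hx1
    unfold Vs
    rw [intervalIntegral.integral_add_adjacent_intervals, intervalIntegral.integral_add_adjacent_intervals] <;>
      apply hV x hx hx1
  rw [sH M (by linarith), sH (-M) (by linarith)]
  have s1 := sV (1-r) (by linarith) (by linarith)
  have s2 := sV (1+r) (by linarith) (by linarith)
  rw [s1] at e1
  rw [s2] at e2
  linear_combination e1 + e2 + e3 + e4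

lemma line_int {F : ℂ → ℂ} (hd : ∀ s : ℂ, 9/10 ≤ s.re → s ≠ 1 → DifferentiableAt ℂ F s) {C : ℝ}
    (hb : ∀ s : ℂ, 9/10 ≤ s.re → s.re ≤ 2 → 1 ≤ |s.im| → ‖F s‖ ≤ C / (1 + s.im^2)) {x : ℝ} (h9 : 9/10 ≤ x) (h2 : x ≤ 2) (h1 : x ≠ 1) :
    Integrable (fun y : ℝ => F (x + y * I)) := by
  have hc : Continuous (fun y : ℝ => F (x + y * I)) := by
    refine continuous_iff_continuousAt.mpr fun y => ?_
    have h := (hd (x + y * I) (by simpa using h9) (fun h => h1 (by simpa using congrArg re h))).continuousAt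
    exact (ContinuousAt.comp (f := fun y : ℝ => (x:ℂ) + y * I) h (by fun_prop))
  obtain ⟨B, hB⟩ := (isCompact_Icc (a := (-1:ℝ)) (b := 1)).exists_bound_of_continuousOn hc.continuousOn
  refine Integrable.mono' (g := fun y : ℝ => (|C| + 2 * |B|) * (1 + y^2)⁻¹) (integrable_inv_one_add_sq.const_mul _) hc.aestronglyMeasurable ?_
  refine Eventually.of_forall fun y => ?_
  rw [← div_eq_mul_inv]
  have hp : 0 < 1 + y^2 := by positivity
  by_cases hy : 1 ≤ |y|
  · have := hb (x + y * I) (by simpa using h9) (by simpa using h2) (by simpa using hy)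
    refine this.trans ?_
    have e : ((x:ℂ) + y * I).im = y := by simp
    rw [e]
    gcongr
    linarith [le_abs_self C, abs_nonneg B]
  · have hy' : |y| ≤ 1 := by linarith
    have := hB y (abs_le.mp hy')
    refine this.trans ?_
    rw [le_div_iff₀ hp]
    have : y^2 ≤ 1 := by rw [← sq_abs]; nlinarith [abs_nonneg y]
    nlinarith [le_abs_self B, abs_nonneg B, abs_nonneg C]

lemma Hs_lim {F : ℂ → ℂ} {C : ℝ}
    (hb : ∀ s : ℂ, 9/10 ≤ s.re → s.re ≤ 2 → 1 ≤ |s.im| → ‖F s‖ ≤ C / (1 + s.im^2)) (ε : ℝ) (hε : |ε| = 1) :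
    Tendsto (fun M : ℝ => Hs F (9/10) 2 (ε * M)) atTop (𝓝 0) := by
  have hl : Tendsto (fun M : ℝ => (|C| / M) * |2 - 9/10|) atTop (𝓝 0) := by
    have := (tendsto_const_nhds (x := |C|)).div_atTop tendsto_id
    simpa using this.mul_const |(2:ℝ) - 9/10|
  refine squeeze_zero_norm' ?_ hl
  filter_upwards [eventually_ge_atTop 1] with M hM
  unfold Hs
  refine intervalIntegral.norm_integral_le_of_norm_le_const fun x hx => ?_
  rw [uIoc_of_le (by norm_num)] at hx
  have e : ((x:ℂ) + ((ε * M : ℝ) : ℂ) * I).im = ε * M := by simp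
  have e' : ((x:ℂ) + ((ε * M : ℝ) : ℂ) * I).re = x := by simp
  have := hb (x + ((ε * M : ℝ) : ℂ) * I) (by rw [e']; linarith [hx.1]) (by rw [e']; exact hx.2) (by rw [e, abs_mul, hε]; rw [one_mul, abs_of_pos] <;> linarith)
  refine this.trans ?_
  rw [e]
  have e2 : (ε * M)^2 = M^2 := by rw [mul_pow, ← sq_abs ε, hε]; ring
  rw [e2]
  calc C / (1+M^2) ≤ |C| / (1 + M^2) := by gcongr; exact le_abs_self C
    _ ≤ |C| / M := by gcongr; nlinarith

lemma contour {F : ℂ → ℂ} (hd : ∀ s : ℂ, 9/10 ≤ s.re → s ≠ 1 → DifferentiableAt ℂ F s) {C : ℝ}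
    (hb : ∀ s : ℂ, 9/10 ≤ s.re → s.re ≤ 2 → 1 ≤ |s.im| → ‖F s‖ ≤ C / (1 + s.im^2)) {N : ℝ} (hN : 10 < N) :
    I * ((∫ y : ℝ, F ((2:ℝ) + y * I)) - ∫ y : ℝ, F ((9/10:ℝ) + y * I)) = (N:ℂ)⁻¹ * Sq (fun w => F (1 + w / N)) := by
  have hN0 : N ≠ 0 := by linarith
  have hNc : (N:ℂ) ≠ 0 := by exact_mod_cast hN0
  set r := 1 / N with hr
  have hr0 : 0 < r := by positivity
  have hr1 : r < 1/10 := by rw [hr]; exact one_div_lt_one_div_of_lt (by norm_num) hN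
  have hrc : (r:ℂ) = (N:ℂ)⁻¹ := by rw [hr]; push_cast; simp
  have hsq : (N:ℂ)⁻¹ * Sq (fun w => F (1 + w / N)) = (Hs F (1-r) (1+r) (-r) - Hs F (1-r) (1+r) r + I * Vs F (1+r) (-r) r - I * Vs F (1-r) (-r) r) := by
    have key : ∀ f : ℝ → ℂ, ∀ G : ℝ → ℂ, (∀ t, G t = f (t / N)) → (N:ℂ)⁻¹ * ∫ t in (-1:ℝ)..1, G t = ∫ t in (-r)..r, f t := by
      intro f G h
      simp only [h]
      rw [intervalIntegral.integral_comp_div _ hN0, Complex.real_smul, ← mul_assoc, inv_mul_cancel₀ hNc, one_mul]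
      rw [hr, neg_div]
    have k1 : ∀ y : ℝ, (N:ℂ)⁻¹ * ∫ t in (-1:ℝ)..1, F (1 + ((t:ℂ) + (y:ℂ) * I) / N) = Hs F (1-r) (1+r) (r * y) := by
      intro y
      rw [key (fun t => F (((t + 1 : ℝ) : ℂ) + ((r * y : ℝ) : ℂ) * I)) _ (fun t => ?_)]
      · unfold Hs
        rw [intervalIntegral.integral_comp_add_right (fun t : ℝ => F ((t : ℂ) + ((r * y : ℝ) : ℂ) * I))]
        congr 1 <;> ring
      · congr 1; push_cast; rw [hrc]; field_simp; ring
    have k2 : ∀ x : ℝ, (N:ℂ)⁻¹ * ∫ t in (-1:ℝ)..1, F (1 + ((x:ℂ) + (t:ℂ) * I) / N) = Vs F (1 + r * x) (-r) r := by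
      intro x
      rw [key (fun t => F (((1 + r * x : ℝ) : ℂ) + (t : ℂ) * I)) _ (fun t => ?_)]
      · rfl
      · congr 1; push_cast; rw [hrc]; field_simp; ring
    have a1 := k1 (-1)
    have a2 := k1 1
    have a3 := k2 1
    have a4 := k2 (-1)
    rw [Sq_eq]
    simp only [smul_eq_mul]
    rw [mul_sub, mul_add, mul_sub, a1, a2, mul_left_comm, a3, mul_left_comm, a4]
    ring_nf
  rw [hsq]
  have hl2 := intervalIntegral_tendsto_integral (line_int hd hb (x := 2) (by norm_num) le_rfl (by norm_num)) tendsto_neg_atTop_atBot tendsto_id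
  have hl9 := intervalIntegral_tendsto_integral (line_int hd hb (x := 9/10) le_rfl (by norm_num) (by norm_num)) tendsto_neg_atTop_atBot tendsto_id
  have L := (hl2.sub hl9).const_mul I
  have h1 := Hs_lim hb 1 (by simp)
  have h2 := Hs_lim hb (-1) (by simp)
  have R := (h1.sub h2).add_const (Hs F (1-r) (1+r) (-r) - Hs F (1-r) (1+r) r + I * Vs F (1+r) (-r) r - I * Vs F (1-r) (-r) r)
  rw [sub_zero, zero_add] at R
  refine tendsto_nhds_unique L (R.congr' ?_)
  filter_upwards [eventually_ge_atTop 1] with M hM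
  have := contour_fin hd hr0 hr1 hM
  rw [one_mul, neg_one_mul, ← this]
  rfl

end Sel

end PartB6c

section PartB6d

namespace Sel
open Filter Topology MeasureTheory Complex Set Loc Mel

/-- integrand -/
noncomputable def Phi (g : ℝ → ℝ) (k : ℕ) (N T : ℝ) (s : ℂ) : ℂ :=
  MM g s * cexp (N * s) * (riemannZeta s ^ k * QQ k T s)

lemma QQ_diff (k : ℕ) (T : ℝ) : Differentiable ℂ (QQ k T) := by
  unfold QQ ff
  refine Differentiable.fun_sum fun d hd => Differentiable.fun_sum fun e he => ?_
  refine (differentiable_const _).mul ?_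
  have : ∀ p ∈ d.primeFactors ∪ e.primeFactors, Differentiable ℂ (fun s : ℂ => 1 - (1 - (p:ℂ)^(-s))^k) := by
    intro p hp
    have hp0 : p ≠ 0 := by
      rcases Finset.mem_union.mp hp with h | h
      · exact (Nat.prime_of_mem_primeFactors h).ne_zero
      · exact (Nat.prime_of_mem_primeFactors h).ne_zero
    have hpc : (p:ℂ) ≠ 0 := by exact_mod_cast hp0
    have : Differentiable ℂ (fun s : ℂ => (p:ℂ)^(-s)) := differentiable_neg.const_cpow (Or.inl hpc)
    fun_prop
  exact Differentiable.fun_finsetProd this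

lemma Phi_diff {g : ℝ → ℝ} (hg : IsG g) (k : ℕ) (N T : ℝ) {s : ℂ} (hs : s ≠ 1) : DifferentiableAt ℂ (Phi g k N T) s := by
  unfold Phi
  have h1 := (MM_diff hg) s
  have h2 := differentiableAt_riemannZeta hs
  have h3 := QQ_diff k T s
  fun_prop

lemma term_norm (f : ℕ → ℂ) (n : ℕ) (y : ℝ) : ‖LSeries.term f ((2:ℝ) + y * I) n‖ = ‖LSeries.term f 2 n‖ := by
  rw [LSeries.norm_term_eq, LSeries.norm_term_eq]; simp

lemma perron_sum {g : ℝ → ℝ} (hg : IsG g) (k : ℕ) (N T : ℝ) :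
    ∫ y : ℝ, Phi g k N T ((2:ℝ) + y * I) = 2 * Real.pi * ((∑' n : ℕ, g (n / Real.exp N) * an k T n : ℝ) : ℂ) := by
  set a : ℕ → ℂ := fun n => (an k T n : ℂ) with ha
  set F : ℕ → ℝ → ℂ := fun n y => LSeries.term a ((2:ℝ) + y * I) n * (cexp (N * ((2:ℝ) + y * I)) * MM g ((2:ℝ) + y * I)) with hF
  have hs2 : ∀ y : ℝ, 1 < (((2:ℝ):ℂ) + y * I).re := by intro y; simp
  have hnorm : ∀ n y, ‖F n y‖ = ‖LSeries.term a 2 n‖ * Real.exp (2 * N) * ‖MM g ((2:ℝ) + y * I)‖ := by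
    intro n y
    rw [hF]
    simp only [norm_mul, term_norm, Complex.norm_exp]
    have : ((N:ℂ) * ((2:ℝ) + y * I)).re = 2 * N := by simp; ring
    rw [this]; ring
  have hcont : ∀ n, Continuous (F n) := by
    intro n
    rw [hF]
    have hM := (MM_diff hg).continuous
    have h1 : Continuous (fun y : ℝ => LSeries.term a ((2:ℝ) + y * I) n) := by
      rcases eq_or_ne n 0 with rfl | hn
      · simpa using continuous_const
      · simp only [LSeries.term_of_ne_zero hn]
        have hnc : (n:ℂ) ≠ 0 := by exact_mod_cast hn
        refine continuous_const.div ?_ (fun y => by simp [cpow_eq_zero_iff, hnc])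
        refine Continuous.const_cpow (by fun_prop) (Or.inl hnc)
    exact h1.mul ((by fun_prop : Continuous fun y : ℝ => cexp (N * ((2:ℝ) + y * I))).mul (hM.comp (by fun_prop)))
  have hintg : ∀ n, Integrable (F n) := by
    intro n
    refine Integrable.mono' (g := fun y => ‖LSeries.term a 2 n‖ * Real.exp (2 * N) * ‖MM g ((2:ℝ) + y * I)‖) ((MM_vert hg).norm.const_mul _) (hcont n).aestronglyMeasurable ?_
    exact Eventually.of_forall fun y => (hnorm n y).le
  have hsum : Summable fun n => ∫ y, ‖F n y‖ := by
    simp only [hnorm, integral_const_mul]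
    refine Summable.mul_right _ (Summable.mul_right _ ?_)
    exact (an_series k T (s := 2) (by simp)).LSeriesSummable.norm
  have hs := hasSum_integral_of_summable_integral_norm hintg hsum
  have e1 : ∀ y : ℝ, ∑' n, F n y = Phi g k N T ((2:ℝ) + y * I) := by
    intro y
    have h := (an_series k T (hs2 y)).mul_right (cexp (N * ((2:ℝ) + y * I)) * MM g ((2:ℝ) + y * I))
    rw [h.tsum_eq, Phi]; ring
  have e2 : ∀ n, ∫ y, F n y = 2 * Real.pi * ((g (n / Real.exp N) * an k T n : ℝ) : ℂ) := by
    intro n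
    rcases eq_or_ne n 0 with rfl | hn
    · have : g 0 = 0 := hg.zero (by norm_num)
      simp [hF, this]
    · have hn0 : (0:ℝ) < n := by positivity
      have hx : (0:ℝ) < n / Real.exp N := by positivity
      have := MM_inv hg hx
      push_cast
      rw [← mul_assoc, show (2 * Real.pi * (g ((n:ℝ) / Real.exp N) : ℂ)) = _ from this.symm, ← integral_mul_const]
      congr 1
      ext y
      rw [hF]
      simp only [LSeries.term_of_ne_zero hn]
      have hnc : (n:ℂ) ≠ 0 := by exact_mod_cast hn
      have hxc : (((n / Real.exp N : ℝ)) : ℂ) ≠ 0 := by exact_mod_cast hx.ne'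
      rw [cpow_def_of_ne_zero hxc, ← ofReal_log hx.le, Real.log_div hn0.ne' (Real.exp_pos N).ne', Real.log_exp,
        cpow_def_of_ne_zero hnc, ← Complex.natCast_log, div_eq_mul_inv, ← Complex.exp_neg]
      push_cast
      have : cexp ((Complex.log n - N : ℂ) * -((2:ℂ) + y * I)) = cexp (-((Complex.log n : ℂ) * (2 + y * I))) * cexp (N * (2 + y * I)) := by
        rw [← Complex.exp_add]; congr 1; ring
      rw [this, ha]; ring
  simp only [e1, e2] at hs
  rw [← hs.tsum_eq, tsum_mul_left, ← ofReal_tsum]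

lemma zeta_bd : ∃ C > 0, ∀ s : ℂ, 9/10 ≤ s.re → 1/10 ≤ ‖s - 1‖ → ‖riemannZeta s‖ ≤ C * (1 + ‖s‖) := by
  obtain ⟨C, hC, hb⟩ := Zb.zeta_sub (1/10) (by norm_num) (by norm_num)
  refine ⟨10 + C, by positivity, fun s hs h1 => ?_⟩
  have hne : s ≠ 1 := by rintro rfl; norm_num at h1
  have h := hb s (by linarith) hne
  have h2 : ‖1 / (s - 1)‖ ≤ 10 := by
    rw [norm_div, norm_one, div_le_iff₀ (by linarith)]; linarith
  have h3 : ‖s‖ ^ (2 * (1/10) : ℝ) ≤ 1 + ‖s‖ := by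
    calc ‖s‖ ^ (2 * (1/10) : ℝ) ≤ (1 + ‖s‖) ^ (2 * (1/10) : ℝ) := by
          apply Real.rpow_le_rpow (norm_nonneg _) (by linarith) (by norm_num)
      _ ≤ (1 + ‖s‖) ^ (1 : ℝ) := Real.rpow_le_rpow_of_exponent_le (by linarith [norm_nonneg s]) (by norm_num)
      _ = _ := Real.rpow_one _
  calc ‖riemannZeta s‖ = ‖(riemannZeta s - 1/(s-1)) + 1/(s-1)‖ := by ring_nf
    _ ≤ C * ‖s‖ ^ (2 * (1/10) : ℝ) + 10 := (norm_add_le _ _).trans (add_le_add h h2)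
    _ ≤ C * (1 + ‖s‖) + 10 := by gcongr
    _ ≤ (10 + C) * (1 + ‖s‖) := by nlinarith [norm_nonneg s]

lemma Phi_bd {g : ℝ → ℝ} (hg : IsG g) (k : ℕ) (hk : 1 ≤ k) : ∃ C > 0, ∀ N T : ℝ, 0 < T → ∀ s : ℂ, 9/10 ≤ s.re → s.re ≤ 2 →
    1/10 ≤ ‖s - 1‖ → ‖Phi g k N T s‖ ≤ C * Real.exp (N * s.re + 3/10 * T) / (1 + s.im^2) := by
  obtain ⟨C1, hC1, hb1⟩ := zeta_bd
  obtain ⟨C2, hC2, hb2⟩ := QQ_rankin hk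
  obtain ⟨C3, hC3, hb3⟩ := MM_dec (k+2) hg
  refine ⟨C1^k * C2 * C3, by positivity, fun N T hT s h9 h2 h1 => ?_⟩
  rw [le_div_iff₀ (by positivity)]
  have e1 : 1 + s.im^2 ≤ (1 + ‖s‖)^2 := by
    have := Complex.abs_im_le_norm s
    have h := sq_abs s.im
    nlinarith [abs_nonneg s.im]
  unfold Phi
  simp only [norm_mul, norm_pow, Complex.norm_exp]
  have e2 : ((N:ℂ) * s).re = N * s.re := by simp
  rw [e2, Real.exp_add]
  calc ‖MM g s‖ * Real.exp (N * s.re) * (‖riemannZeta s‖^k * ‖QQ k T s‖) * (1 + s.im^2)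
      ≤ ‖MM g s‖ * Real.exp (N * s.re) * ((C1 * (1 + ‖s‖))^k * (C2 * Real.exp (3/10*T))) * (1 + ‖s‖)^2 := by
        gcongr
        · exact hb1 s h9 h1
        · exact hb2 T hT s h9
    _ = (C1^k * C2 * ((1 + ‖s‖)^(k+2) * ‖MM g s‖)) * (Real.exp (N * s.re) * Real.exp (3/10*T)) := by rw [mul_pow]; ring
    _ ≤ (C1^k * C2 * C3) * (Real.exp (N * s.re) * Real.exp (3/10*T)) := by
        gcongr; exact hb3 s h9 h2

end Sel

end PartB6d

section PartB8

namespace Sel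
open Filter Topology MeasureTheory Complex Set Loc Mel

lemma Sq_tendsto {F : ℝ → ℂ → ℂ} {G : ℂ → ℂ} {C : ℝ}
    (hc : ∀ᶠ N in atTop, ∀ w, Sqr w → w ≠ 0 → ContinuousAt (F N) w)
    (hb : ∀ᶠ N in atTop, ∀ w, Sqr w → 1 ≤ ‖w‖ → ‖F N w‖ ≤ C)
    (hl : ∀ w, Sqr w → w ≠ 0 → Tendsto (fun N => F N w) atTop (𝓝 (G w))) :
    Tendsto (fun N => Sq (F N)) atTop (𝓝 (Sq G)) := by
  unfold Sq
  refine tendsto_finsetSum _ fun i _ => Tendsto.const_mul _ ?_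
  have hI : ∀ t ∈ Set.uIoc (-1:ℝ) 1, |t| ≤ 1 := by
    intro t ht
    rw [uIoc_of_le (by norm_num)] at ht
    exact abs_le.mpr ⟨ht.1.le, ht.2⟩
  refine intervalIntegral.tendsto_integral_filter_of_dominated_convergence (fun _ => C) ?_ ?_ ?_ ?_
  · filter_upwards [hc] with N hN
    have : ContinuousOn (fun t => F N (ed i t)) (Set.uIoc (-1:ℝ) 1) := by
      intro t ht
      have h := hN (ed i t) (ed_sqr i (hI t ht)) (ed_ne i t)
      exact (ContinuousAt.comp (f := ed i) h (ed_cont i).continuousAt).continuousWithinAt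
    exact this.aestronglyMeasurable measurableSet_uIoc
  · filter_upwards [hb] with N hN
    exact Eventually.of_forall fun t ht => hN (ed i t) (ed_sqr i (hI t ht)) (ed_norm i t)
  · exact intervalIntegrable_const
  · exact Eventually.of_forall fun t ht => hl (ed i t) (ed_sqr i (hI t ht)) (ed_ne i t)

lemma zeta_loc : ∃ C > 0, ∀ N : ℝ, 10 ≤ N → ∀ w, Sqr w → w ≠ 0 → ‖(w / N) * riemannZeta (1 + w / N)‖ ≤ C := by
  obtain ⟨C, hC, hb⟩ := Zb.zeta_sub (1/10) (by norm_num) (by norm_num)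
  refine ⟨1 + C * 2, by positivity, fun N hN w hw hw0 => ?_⟩
  have hN0 : (N:ℂ) ≠ 0 := by
    have : N ≠ 0 := by linarith
    exact_mod_cast this
  have hwN : w / N ≠ 0 := div_ne_zero hw0 hN0
  have h := hb (1 + w / N) (by have := hw.re_ge hN; linarith) (by simpa using hwN)
  have hsm : ‖w / N‖ ≤ 1 := by
    rw [norm_div, norm_real, Real.norm_of_nonneg (by linarith), div_le_one (by linarith)]
    linarith [hw.norm]
  have h1 : ‖1 + w / N‖ ^ (2 * (1/10) : ℝ) ≤ 2 := by
    have h2 : ‖1 + w / N‖ ≤ 2 := (norm_add_le _ _).trans (by rw [norm_one]; linarith)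
    calc ‖1 + w / N‖ ^ (2 * (1/10) : ℝ) ≤ 2 ^ (2 * (1/10) : ℝ) := Real.rpow_le_rpow (norm_nonneg _) h2 (by norm_num)
      _ ≤ 2 ^ (1:ℝ) := Real.rpow_le_rpow_of_exponent_le (by norm_num) (by norm_num)
      _ = 2 := Real.rpow_one _
  rw [add_sub_cancel_left] at h
  have e : (w / N) * riemannZeta (1 + w / N) = 1 + (w / N) * (riemannZeta (1 + w / N) - 1 / (w / N)) := by
    rw [mul_sub, mul_one_div_cancel hwN]; ring
  rw [e]
  calc _ ≤ ‖(1:ℂ)‖ + ‖w / N‖ * ‖riemannZeta (1 + w / N) - 1 / (w / N)‖ := (norm_add_le _ _).trans (by rw [norm_mul])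
    _ ≤ 1 + 1 * (C * 2) := by
        rw [norm_one]; gcongr
        exact h.trans (by gcongr)
    _ = _ := by ring

/-- rescaled local integrand -/
noncomputable def Ps (g : ℝ → ℝ) (k : ℕ) (N T : ℝ) (w : ℂ) : ℂ :=
  MM g (1 + w / N) * cexp w * ((w / N) * riemannZeta (1 + w / N)) ^ k * (w ^ k)⁻¹ * ((N:ℂ)^k * QQ k T (1 + w / N))

lemma Phi_Ps (g : ℝ → ℝ) (k : ℕ) {N : ℝ} (hN : N ≠ 0) (T : ℝ) {w : ℂ} (hw : w ≠ 0) :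
    Phi g k N T (1 + w / N) = cexp N * Ps g k N T w := by
  have hN0 : (N:ℂ) ≠ 0 := by exact_mod_cast hN
  unfold Phi Ps
  have e : cexp (N * (1 + w / N)) = cexp N * cexp w := by
    rw [← Complex.exp_add]; congr 1; field_simp
  rw [e, mul_pow, div_pow]
  field_simp

lemma Ps_lim {g : ℝ → ℝ} (hg : IsG g) (k : ℕ) (hk : 1 ≤ k) {γ : ℝ} (hγ : 0 < γ) {T : ℝ → ℝ}
    (hT : Tendsto (fun N => T N / N) atTop (𝓝 γ)) :
    Tendsto (fun N : ℝ => Sq (Ps g k N (T N))) atTop (𝓝 (2 * Real.pi * I * (((k.factorial:ℝ)^2 * Rpoly k γ * ∫ x in Ioi (0:ℝ), g x : ℝ) : ℂ))) := by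
  obtain ⟨⟨CQ, hCQ, hQ⟩, hQl⟩ := QQ_lim k hk hγ hT
  obtain ⟨CZ, hCZ, hZ⟩ := zeta_loc
  obtain ⟨CM, hCM, hM⟩ := MM_bd0 hg
  have e : 2 * Real.pi * I * (((k.factorial:ℝ)^2 * Rpoly k γ * ∫ x in Ioi (0:ℝ), g x : ℝ) : ℂ)
      = Sq (fun w => MM g 1 * (cexp w * (w^k)⁻¹ * qq k γ w)) := by
    rw [Sq_smul, Sq_qq k hk hγ, MM_one]; push_cast; ring
  rw [e]
  have hdiv : ∀ w : ℂ, Tendsto (fun N : ℝ => 1 + w / N) atTop (𝓝 (1 : ℂ)) := by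
    intro w
    have h1 : Tendsto (fun N : ℝ => (N:ℂ)⁻¹) atTop (𝓝 0) := by
      have := (Complex.continuous_ofReal.tendsto 0).comp tendsto_inv_atTop_zero
      refine (this.congr fun N => ?_).trans (by simp)
      simp
    have h2 := (h1.const_mul w).const_add 1
    simpa [div_eq_mul_inv] using h2
  refine Sq_tendsto (C := CM * Real.exp 1 * CZ^k * 1 * CQ) ?_ ?_ ?_
  · filter_upwards [eventually_ge_atTop 10] with N hN w hw hw0
    have hN0 : (N:ℂ) ≠ 0 := by
      have : N ≠ 0 := by linarith
      exact_mod_cast this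
    have hne : 1 + w / N ≠ 1 := by simpa using ⟨hw0, by exact_mod_cast hN0⟩
    have hin : ContinuousAt (fun w : ℂ => 1 + w / N) w := by fun_prop
    have c1 : ContinuousAt (fun w : ℂ => MM g (1 + w / N)) w :=
      ContinuousAt.comp (f := fun w : ℂ => 1 + w / N) (MM_diff hg).continuous.continuousAt hin
    have c2 : ContinuousAt (fun w : ℂ => riemannZeta (1 + w / N)) w :=
      ContinuousAt.comp (f := fun w : ℂ => 1 + w / N) (differentiableAt_riemannZeta hne).continuousAt hin
    have c3 : ContinuousAt (fun w : ℂ => QQ k (T N) (1 + w / N)) w :=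
      ContinuousAt.comp (f := fun w : ℂ => 1 + w / N) (QQ_diff k (T N)).continuous.continuousAt hin
    have c4 : ContinuousAt (fun w : ℂ => (w^k)⁻¹) w := ContinuousAt.inv₀ (by fun_prop) (pow_ne_zero _ hw0)
    have c5 : ContinuousAt (fun w : ℂ => (w / N)) w := by fun_prop
    have c6 : ContinuousAt (fun w : ℂ => cexp w) w := by fun_prop
    exact (((c1.mul c6).mul ((c5.mul c2).pow k)).mul c4).mul (continuousAt_const.mul c3)
  · filter_upwards [hQ, eventually_ge_atTop 10] with N hQN hN w hw hw1
    have hw0 : w ≠ 0 := by rintro rfl; norm_num at hw1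
    have hre := hw.re_ge hN
    have hre2 : (1 + w / N).re ≤ 3 := by
      rw [add_re, div_ofReal_re, one_re]
      have : w.re / N ≤ 1 := by
        rw [div_le_one (by linarith)]; linarith [le_abs_self w.re, hw.1]
      linarith
    unfold Ps
    simp only [norm_mul (_ * _) _, norm_mul (MM g _) _, norm_pow (_ * _ : ℂ) k]
    gcongr
    · exact hM _ (by linarith) hre2
    · rw [Complex.norm_exp]; exact Real.exp_le_exp.mpr (by linarith [le_abs_self w.re, hw.1])
    · exact hZ N hN w hw hw0
    · rw [norm_inv, norm_pow]; exact inv_le_one_of_one_le₀ (one_le_pow₀ hw1)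
    · exact hQN w hw
  · intro w hw hw0
    have l1 := ((MM_diff hg).continuous.tendsto 1).comp (hdiv w)
    have l2 := (zeta_lim hw0).pow k
    have l3 := hQl w hw
    have := (((l1.mul_const (cexp w)).mul l2).mul_const (w^k)⁻¹).mul l3
    rw [one_pow, mul_one] at this
    have e2 : MM g 1 * cexp w * (w^k)⁻¹ * qq k γ w = MM g 1 * (cexp w * (w^k)⁻¹ * qq k γ w) := by ring
    rw [e2] at this
    exact this

lemma exp_small : Tendsto (fun N : ℝ => N * Real.exp (-(N / 40))) atTop (𝓝 0) := by
  have h := (Real.tendsto_pow_mul_exp_neg_atTop_nhds_zero 1).comp (tendsto_id.atTop_div_const (show (0:ℝ) < 40 by norm_num))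
  have h2 := h.const_mul 40
  rw [mul_zero] at h2
  refine h2.congr fun N => ?_
  simp only [Function.comp, id, pow_one]
  ring

/-- the smoothed sum -/
noncomputable def SS (g : ℝ → ℝ) (k : ℕ) (N T : ℝ) : ℝ := ∑' n : ℕ, g (n / Real.exp N) * an k T n

lemma S_lim {g : ℝ → ℝ} (hg : IsG g) (k : ℕ) (hk : 1 ≤ k) {γ : ℝ} (hγ : 0 < γ) {T : ℝ → ℝ}
    (hT : Tendsto (fun N => T N / N) atTop (𝓝 γ)) (hT0 : ∀ᶠ N in atTop, 0 < T N) (hT1 : ∀ᶠ N in atTop, T N ≤ N / 4) :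
    Tendsto (fun N : ℝ => SS g k N (T N) * N / Real.exp N) atTop (𝓝 ((k.factorial:ℝ)^2 * Rpoly k γ * ∫ x in Ioi (0:ℝ), g x)) := by
  obtain ⟨C, hC, hb⟩ := Phi_bd hg k hk
  have hlim := Ps_lim hg k hk hγ hT
  set L : ℝ := (k.factorial:ℝ)^2 * Rpoly k γ * ∫ x in Ioi (0:ℝ), g x with hL
  have hpi : (Real.pi : ℂ) ≠ 0 := by exact_mod_cast Real.pi_ne_zero
  set E : ℝ → ℂ := fun N => ∫ y : ℝ, Phi g k N (T N) ((9/10:ℝ) + y * I) with hE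
  have hEb : ∀ᶠ N in atTop, ‖E N * N * cexp (-N)‖ ≤ (C * Real.pi) * (N * Real.exp (-(N / 40))) := by
    filter_upwards [hT0, hT1, eventually_gt_atTop 10] with N h0 h1 hN
    have h2 : ‖E N‖ ≤ C * Real.exp (N * (9/10) + 3/10 * T N) * Real.pi := by
      rw [← integral_univ_inv_one_add_sq, ← integral_const_mul]
      refine norm_integral_le_of_norm_le (integrable_inv_one_add_sq.const_mul _) (Eventually.of_forall fun y => ?_)
      have hre : (((9/10:ℝ):ℂ) + y * I).re = 9/10 := by simp
      have him : (((9/10:ℝ):ℂ) + y * I).im = y := by simp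
      have := hb N (T N) h0 ((9/10:ℝ) + y * I) (by rw [hre]) (by rw [hre]; norm_num) (by
        refine le_trans ?_ (Complex.abs_re_le_norm _)
        rw [sub_re, hre, one_re]; norm_num)
      rw [hre, him] at this
      rw [← div_eq_mul_inv]; exact this
    rw [norm_mul, norm_mul, Complex.norm_exp, norm_real, Real.norm_of_nonneg (by linarith), neg_re, ofReal_re]
    calc ‖E N‖ * N * Real.exp (-N) ≤ (C * Real.exp (N * (9/10) + 3/10 * T N) * Real.pi) * N * Real.exp (-N) := by gcongr
      _ = (C * Real.pi) * (N * (Real.exp (N * (9/10) + 3/10 * T N) * Real.exp (-N))) := by ring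
      _ ≤ _ := by
        gcongr
        rw [← Real.exp_add]
        exact Real.exp_le_exp.mpr (by linarith)
  have hE0 : Tendsto (fun N : ℝ => E N * N * cexp (-N)) atTop (𝓝 0) := by
    refine squeeze_zero_norm' hEb ?_
    simpa using exp_small.const_mul (C * Real.pi)
  have key : ∀ᶠ N : ℝ in atTop, (2 * Real.pi * I)⁻¹ * Sq (Ps g k N (T N)) + (2 * Real.pi : ℂ)⁻¹ * (E N * N * cexp (-N)) = ((SS g k N (T N) * N / Real.exp N : ℝ) : ℂ) := by
    filter_upwards [hT0, eventually_gt_atTop 10] with N h0 hN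
    have hN0 : N ≠ 0 := by linarith
    have hNc : (N:ℂ) ≠ 0 := by exact_mod_cast hN0
    have hd : ∀ s : ℂ, 9/10 ≤ s.re → s ≠ 1 → DifferentiableAt ℂ (Phi g k N (T N)) s := fun s _ hs => Phi_diff hg k N (T N) hs
    have hbb : ∀ s : ℂ, 9/10 ≤ s.re → s.re ≤ 2 → 1 ≤ |s.im| → ‖Phi g k N (T N) s‖ ≤ (C * Real.exp (N * 2 + 3/10 * T N)) / (1 + s.im^2) := by
      intro s h9 h2 h1
      refine (hb N (T N) h0 s h9 h2 ?_).trans ?_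
      · refine le_trans ?_ (Complex.abs_im_le_norm _)
        rw [sub_im, one_im, sub_zero]; linarith
      · gcongr
    have hcont := contour hd hbb hN
    rw [perron_sum hg] at hcont
    have hsq : Sq (fun w => Phi g k N (T N) (1 + w / N)) = cexp N * Sq (Ps g k N (T N)) := by
      rw [← Sq_smul]
      exact Sq_congr fun w _ hw0 => Phi_Ps g k hN0 (T N) hw0
    rw [hsq] at hcont
    have hcont' : I * (2 * Real.pi * (SS g k N (T N) : ℂ) - E N) = (N:ℂ)⁻¹ * (cexp N * Sq (Ps g k N (T N))) := hcont
    have hex : cexp N ≠ 0 := Complex.exp_ne_zero _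
    have hS : Sq (Ps g k N (T N)) = (cexp N)⁻¹ * N * (I * (2 * Real.pi * (SS g k N (T N) : ℂ) - E N)) := by
      rw [hcont']; field_simp
    rw [hS, Complex.exp_neg]
    push_cast
    field_simp
    ring
  have hfin := (hlim.const_mul (2 * Real.pi * I)⁻¹).add (hE0.const_mul (2 * Real.pi : ℂ)⁻¹)
  have hval : (2 * Real.pi * I)⁻¹ * (2 * Real.pi * I * (L : ℂ)) + (2 * Real.pi : ℂ)⁻¹ * 0 = (L : ℂ) := by
    field_simp; simp
  rw [hval] at hfin
  have hfin2 := hfin.congr' key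
  have := (Complex.continuous_re.tendsto _).comp hfin2
  rw [ofReal_re] at this
  exact this.congr fun N => ofReal_re _

end Sel

end PartB8

section PartB9

namespace FinS
open Filter Topology MeasureTheory Set Sel Mel

lemma T_lim (γ : ℝ) : Tendsto (fun N : ℝ => (γ * N - √N) / N) atTop (𝓝 γ) := by
  have h : Tendsto (fun N : ℝ => γ - (√N)⁻¹) atTop (𝓝 (γ - 0)) :=
    tendsto_const_nhds.sub (tendsto_inv_atTop_zero.comp Real.tendsto_sqrt_atTop)
  rw [sub_zero] at h
  refine h.congr' ?_
  filter_upwards [eventually_gt_atTop 0] with N hN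
  have h1 : √N ≠ 0 := (Real.sqrt_pos.mpr hN).ne'
  have h2 : √N * √N = N := Real.mul_self_sqrt hN.le
  rw [sub_div, mul_div_assoc, div_self hN.ne', mul_one]
  congr 1
  nth_rw 3 [← h2]
  field_simp

lemma T_pos {γ : ℝ} (hγ : 0 < γ) : ∀ᶠ N : ℝ in atTop, 0 < γ * N - √N := by
  have := (T_lim γ).eventually (lt_mem_nhds hγ)
  filter_upwards [this, eventually_gt_atTop 0] with N h1 hN
  exact (div_pos_iff_of_pos_right hN).mp h1

lemma weight_eq (k : ℕ) (γ : ℝ) {X : ℝ} (hX : 0 < X) (d : ℕ) :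
    selbergWeight k (X ^ γ * Real.exp (-√(Real.log X))) d = wt k (γ * Real.log X - √(Real.log X)) d := by
  unfold wt
  congr 1
  rw [Real.rpow_def_of_pos hX, ← Real.exp_add]
  congr 1; ring

lemma term_le (k : ℕ) (T : ℝ) (n : ℕ) {c : ℝ} (hc : 0 ≤ c) :
    c * (|Kloosterman 1 1 n| / √n) * ((ArithmeticFunction.moebius n : ℤ) : ℝ) ^ 2 * ((k : ℝ) / 2) ^ n.primeFactors.card *
      (∑ d ∈ n.divisors, wt k T d) ^ 2 ≤ c * an k T n := by
  by_cases hn : Squarefree n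
  · have hn0 : (0:ℝ) < n := by exact_mod_cast Nat.pos_of_ne_zero hn.ne_zero
    have hm : ((ArithmeticFunction.moebius n : ℤ) : ℝ) ^ 2 = 1 := by
      have := ArithmeticFunction.moebius_sq_eq_one_of_squarefree hn
      exact_mod_cast this
    have hK : |Kloosterman 1 1 n| / √n ≤ 2 ^ n.primeFactors.card := by
      rw [div_le_iff₀ (Real.sqrt_pos.mpr hn0)]
      exact Weil.Kloosterman_le n hn
    rw [hm, mul_one, an, tk_sf k hn]
    calc _ ≤ c * (2 ^ n.primeFactors.card) * ((k : ℝ) / 2) ^ n.primeFactors.card * (∑ d ∈ n.divisors, wt k T d) ^ 2 := by gcongr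
      _ = c * ((2 ^ n.primeFactors.card * ((k : ℝ) / 2) ^ n.primeFactors.card) * (∑ d ∈ n.divisors, wt k T d) ^ 2) := by ring
      _ = _ := by
        rw [← mul_pow, mul_div_cancel₀ _ (two_ne_zero)]
        push_cast; ring
  · rw [ArithmeticFunction.moebius_eq_zero_of_not_squarefree hn]
    have := mul_nonneg hc (an_nonneg k T n)
    simpa using this

lemma summ {g : ℝ → ℝ} (hg : IsG g) {X : ℝ} (hX : 0 < X) (f : ℕ → ℝ) (h : ∀ n : ℕ, g (n / X) = 0 → f n = 0) : Summable f := by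
  refine summable_of_ne_finset_zero (s := Finset.range (⌈2 * X⌉₊ + 1)) fun n hn => h n (hg.zero fun h1 => hn ?_)
  have h2 := h1.2
  rw [div_le_iff₀ hX] at h2
  rw [Finset.mem_range, Nat.lt_succ_iff]
  exact_mod_cast h2.trans (Nat.le_ceil _)

lemma g_pos {g : ℝ → ℝ} (hg : IsG g) (hg0 : ∀ x, 0 ≤ g x) (hgne : g ≠ 0) : 0 < ∫ x in Ioi (0:ℝ), g x := by
  rw [setIntegral_eq_integral_of_forall_compl_eq_zero]
  · have hcs : HasCompactSupport g := HasCompactSupport.intro (isCompact_Icc (a := (1:ℝ)) (b := 2)) fun x hx => hg.zero hx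
    obtain ⟨x, hx⟩ := Function.ne_iff.mp hgne
    exact hg.1.continuous.integral_pos_of_hasCompactSupport_nonneg_nonzero hcs hg0 hx
  · intro x hx
    refine hg.zero fun h1 => hx ?_
    exact lt_of_lt_of_le one_pos h1.1

end FinS

end PartB9

/-- Upper bound for `H₂(X)`:
`limsup_{X→∞} H₂(X)·log X/(g̃(1)·X) ≤ (k!)²·R_k(γ)`. -/
theorem H2_upper_bound (k : ℕ) (hk : 1 ≤ k) (γ : ℝ) (hγ : 0 < γ)
    (hγ' : γ ≤ 1 / 4) (g : ℝ → ℝ) (hg : ContDiff ℝ (⊤ : ℕ∞) g) (hg0 : ∀ x, 0 ≤ g x)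
    (hgne : g ≠ 0) (hsupp : Function.support g ⊆ Set.Icc 1 2) :
    limsup (fun X : ℝ =>
        (∑' n : ℕ, g (n / X) * (|Kloosterman 1 1 n| / Real.sqrt n) *
            ((ArithmeticFunction.moebius n : ℤ) : ℝ) ^ 2 *
            ((k : ℝ) / 2) ^ n.primeFactors.card *
            (∑ d ∈ n.divisors,
              selbergWeight k (X ^ γ * Real.exp (-Real.sqrt (Real.log X))) d) ^ 2) *
          Real.log X / ((∫ x in Set.Ioi (0 : ℝ), g x) * X)) atTop ≤
      (Nat.factorial k : ℝ) ^ 2 * Rpoly k γ := by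
  classical
  have hG : Mel.IsG g := ⟨hg, hsupp⟩
  have hGpos := FinS.g_pos hG hg0 hgne
  set G := ∫ x in Set.Ioi (0 : ℝ), g x with hGdef
  set T : ℝ → ℝ := fun N => γ * N - √N with hTdef
  have hT1 : ∀ᶠ N in atTop, T N ≤ N / 4 := by
    filter_upwards [eventually_ge_atTop 0] with N hN
    have := Real.sqrt_nonneg N
    rw [hTdef]
    show γ * N - √N ≤ N / 4
    nlinarith
  have hlim := Sel.S_lim hG k hk hγ (T := T) (FinS.T_lim γ) (FinS.T_pos hγ) hT1
  have hlim2 := (hlim.div_const G).comp Real.tendsto_log_atTop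
  rw [← hGdef, mul_div_assoc, div_self hGpos.ne', mul_one] at hlim2
  refine (Filter.limsup_le_limsup (v := fun X => Sel.SS g k (Real.log X) (T (Real.log X)) * Real.log X / Real.exp (Real.log X) / G) ?_ ?_ ?_).trans_eq hlim2.limsup_eq
  · filter_upwards [eventually_gt_atTop 1] with X hX
    have hX0 : 0 < X := by linarith
    have hlog : 0 ≤ Real.log X := Real.log_nonneg hX.le
    rw [Real.exp_log hX0, div_div, mul_comm X G]
    refine div_le_div_of_nonneg_right ?_ (by positivity)
    refine mul_le_mul_of_nonneg_right ?_ hlog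
    unfold Sel.SS
    rw [Real.exp_log hX0]
    simp only [FinS.weight_eq k γ hX0]
    refine Summable.tsum_le_tsum (fun n => FinS.term_le k _ n (hg0 _)) ?_ ?_
    · exact FinS.summ hG hX0 _ fun n hn => by simp [hn]
    · exact FinS.summ hG hX0 _ fun n hn => by simp [hn]
  · refine isCoboundedUnder_le_of_eventually_le atTop (x := 0) ?_
    filter_upwards [eventually_gt_atTop 1] with X hX
    have hX0 : 0 < X := by linarith
    have hlog : 0 ≤ Real.log X := Real.log_nonneg hX.le
    refine div_nonneg (mul_nonneg (tsum_nonneg fun n => ?_) hlog) (by positivity)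
    have := hg0 (n / X)
    positivity
  · exact hlim2.isBoundedUnder_le
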